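/- Let (X,T) be a topological dynamical system, f ∈ C(X,ℝ), and μ an ergodic T-invariant Borel probability measure with h_μ(T) > 0. Then for μ-almost every x ∈ X there exists a closed subset E(x) ⊆ closure(W^s(x,T)) ∩ closure(W^u(x,T)) such that: (1) E(x) is a weakly mixing set for T and also a weakly mixing set for T^{-1}; (2) P(T,f,E(x)) ≥ P_μ(T,f) and P(T^{-1},f,E(x)) ≥ P_μ(T,f). -/

import Mathlib

open Filter Set Topology MeasureTheory

noncomputable section

variable {X : Type*}

/-- Birkhoff sum `f_n(x) = ∑_{j<n} f(T^j x)`. -/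
def birk (T : X → X) (f : X → ℝ) (n : ℕ) (x : X) : ℝ :=
  ∑ j ∈ Finset.range n, f (T^[j] x)

/-- `P_n(T,f,δ,K)`: supremum of `∑_{x∈E} exp f_n(x)` over `(n,δ)`-separated
subsets `E ⊆ K`. -/
def sepPn [MetricSpace X] (T : X → X) (f : X → ℝ) (n : ℕ) (δ : ℝ) (K : Set X) : ℝ :=
  sSup { r : ℝ | ∃ E : Finset X, ↑E ⊆ K ∧
    (∀ x ∈ E, ∀ y ∈ E, x ≠ y → ∃ i < n, δ < dist (T^[i] x) (T^[i] y)) ∧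
    r = ∑ x ∈ E, Real.exp (birk T f n x) }

/-- The topological pressure of `T` for the subset `K`:
`P(T,f,K) = lim_{δ→0} limsup_n (1/n) log P_n(T,f,δ,K)`; since the expression is
nonincreasing in `δ`, the limit is the supremum over `δ > 0`. -/
def pres [MetricSpace X] (T : X → X) (f : X → ℝ) (K : Set X) : EReal :=
  ⨆ (δ : ℝ) (_ : 0 < δ), atTop.limsup fun n : ℕ =>
    ((Real.log (sepPn T f n δ K) / n : ℝ) : EReal)

/-- The `ε`-stable set `W^s_ε(x,T)`. -/
def epsStable [MetricSpace X] (T : X → X) (ε : ℝ) (x : X) : Set X :=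
  { y | ∀ n : ℕ, dist (T^[n] x) (T^[n] y) ≤ ε }

/-- The topological pressure of the preimages of the `ε`-stable set of `x`:
`P_s(T,f,x,ε) = lim_{δ→0} limsup_n (1/n) log P_n(T,f,δ,T^{-n}W^s_ε(x,T))`. -/
def Ps [MetricSpace X] (T : X → X) (f : X → ℝ) (x : X) (ε : ℝ) : EReal :=
  ⨆ (δ : ℝ) (_ : 0 < δ), atTop.limsup fun n : ℕ =>
    ((Real.log (sepPn T f n δ ((T^[n]) ⁻¹' epsStable T ε x)) / n : ℝ) : EReal)

/-- A finite open cover of `X`. -/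
def IsOpenCover [TopologicalSpace X] (𝒰 : Finset (Set X)) : Prop :=
  (∀ U ∈ 𝒰, IsOpen U) ∧ ⋃₀ (𝒰 : Set (Set X)) = univ

/-- A finite Borel cover of `X`. -/
def IsBorelCover [MeasurableSpace X] (𝒱 : Finset (Set X)) : Prop :=
  (∀ V ∈ 𝒱, MeasurableSet V) ∧ ⋃₀ (𝒱 : Set (Set X)) = univ

/-- `𝒱` refines the iterated cover `𝒰_0^{n-1} = ⋁_{i<n} T^{-i}𝒰`. -/
def RefinesIter (T : X → X) (𝒰 : Finset (Set X)) (n : ℕ) (𝒱 : Finset (Set X)) : Prop :=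
  ∀ V ∈ 𝒱, ∃ g : Fin n → Set X, (∀ i, g i ∈ 𝒰) ∧ V ⊆ ⋂ i : Fin n, (T^[(i : ℕ)]) ⁻¹' g i

/-- `P_n(T,f,𝒰,K)`: infimum over finite Borel covers `𝒱` refining `𝒰_0^{n-1}` of
`∑_{V∈𝒱} sup_{x ∈ V∩K} exp f_n(x)` (an empty summand contributes `0`, which is
`Real.sSup ∅`). -/
def covPn [MeasurableSpace X] (T : X → X) (f : X → ℝ) (𝒰 : Finset (Set X)) (n : ℕ)
    (K : Set X) : ℝ :=
  sInf { r : ℝ | ∃ 𝒱 : Finset (Set X), IsBorelCover 𝒱 ∧ RefinesIter T 𝒰 n 𝒱 ∧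
    r = ∑ V ∈ 𝒱, sSup ((fun x => Real.exp (birk T f n x)) '' (V ∩ K)) }

/-- A finite Borel partition of `X`. -/
def IsFinPartition [MeasurableSpace X] (α : Finset (Set X)) : Prop :=
  (∀ A ∈ α, MeasurableSet A) ∧ ⋃₀ (α : Set (Set X)) = univ ∧
    (α : Set (Set X)).Pairwise Disjoint

/-- `H_μ(⋁_{i<n} T^{-i}α)`, computed over all atoms `⋂_{i<n} T^{-i} A_i`. -/
def dynH [MeasurableSpace X] (μ : Measure X) (T : X → X) (α : Finset (Set X)) (n : ℕ) : ℝ :=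
  ∑ g : Fin n → α, Real.negMulLog ((μ (⋂ i : Fin n, (T^[(i : ℕ)]) ⁻¹' (g i : Set X))).toReal)

/-- `h_μ(T,α) = lim_n (1/n) H_μ(α_0^{n-1})`, which for an invariant measure equals
the infimum of `(1/n) H_μ(α_0^{n-1})` over `n ≥ 1`. -/
def entPart [MeasurableSpace X] (μ : Measure X) (T : X → X) (α : Finset (Set X)) : ℝ :=
  ⨅ n : ℕ, dynH μ T α (n + 1) / (n + 1 : ℝ)

/-- The measure-theoretic entropy `h_μ(T)`. -/
def mEnt [MeasurableSpace X] (μ : Measure X) (T : X → X) : EReal :=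
  ⨆ (α : Finset (Set X)) (_ : IsFinPartition α), ((entPart μ T α : ℝ) : EReal)

/-- The measure-theoretic pressure `P_μ(T,f) = h_μ(T) + ∫ f dμ`. -/
def mPres [MeasurableSpace X] (μ : Measure X) (T : X → X) (f : X → ℝ) : EReal :=
  mEnt μ T + ((∫ x, f x ∂μ : ℝ) : EReal)

/-- The stable set `W^s(x,T)`. -/
def stableSet [MetricSpace X] (T : X → X) (x : X) : Set X :=
  { y | Tendsto (fun n : ℕ => dist (T^[n] x) (T^[n] y)) atTop (𝓝 0) }

/-- A Cantor set: a nonempty compact perfect totally disconnected set. -/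
def IsCantorSet [TopologicalSpace X] (C : Set X) : Prop :=
  C.Nonempty ∧ IsCompact C ∧ Perfect C ∧ IsTotallyDisconnected C

/-- A weakly mixing set for `T`. -/
def IsWeaklyMixingSet [TopologicalSpace X] (T : X → X) (A : Set X) : Prop :=
  A.Nonempty ∧ IsClosed A ∧
  ∃ B : Set X, B ⊆ A ∧
    (∃ C : ℕ → Set X, (∀ n, IsCantorSet (C n)) ∧ B = ⋃ n, C n) ∧
    closure B = A ∧
    ∀ C : Set X, C ⊆ B → IsCantorSet C →
      ∀ g : C → X, Continuous g → (∀ c : C, g c ∈ A) →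
        ∃ φ : ℕ → ℕ, StrictMono φ ∧
          ∀ c : C, Tendsto (fun i => T^[φ i] (c : X)) atTop (𝓝 (g c))

open scoped ProbabilityTheory

/-- The σ-algebra generated by a finitely valued map. -/
@[reducible] def sig {ι : Type*} (ξ : X → ι) : MeasurableSpace X := MeasurableSpace.comap ξ ⊤

/-- The conditional entropy `H_μ(ξ | m)` of a finitely valued map, seen as a partition. -/
def cEnt (m : MeasurableSpace X) [MeasurableSpace X] (μ : Measure X) {ι : Type*} [Fintype ι]
    (ξ : X → ι) : ℝ :=
  ∑ a, ∫ x, Real.negMulLog ((μ⟦ξ ⁻¹' {a} | m⟧) x) ∂μ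

section CondEntropy

set_option linter.unusedSectionVars false

variable {m m' : MeasurableSpace X} {ι κ : Type*}

lemma sig_le_iff {ξ : X → ι} : sig ξ ≤ m ↔ ∀ s : Set ι, MeasurableSet[m] (ξ ⁻¹' s) :=
  ⟨fun h s => h _ ⟨s, trivial, rfl⟩, by rintro h _ ⟨s, -, rfl⟩; exact h s⟩

lemma sig_le_iff_singleton [Finite ι] {ξ : X → ι} :
    sig ξ ≤ m ↔ ∀ a : ι, MeasurableSet[m] (ξ ⁻¹' {a}) := by
  rw [sig_le_iff]
  refine ⟨fun h a => h _, fun h s => ?_⟩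
  have : ξ ⁻¹' s = ⋃ a ∈ s, ξ ⁻¹' {a} := by ext; simp
  rw [this]
  exact MeasurableSet.biUnion s.to_countable fun a _ => h a

lemma measurableSet_sig (ξ : X → ι) (s : Set ι) : MeasurableSet[sig ξ] (ξ ⁻¹' s) :=
  ⟨s, trivial, rfl⟩

lemma sig_prod (ξ : X → ι) (ζ : X → κ) [Finite ι] [Finite κ] :
    sig (fun x => (ξ x, ζ x)) = sig ξ ⊔ sig ζ := by
  apply le_antisymm
  · rw [sig_le_iff_singleton]
    rintro ⟨a, b⟩
    have : (fun x => (ξ x, ζ x)) ⁻¹' {(a, b)} = ξ ⁻¹' {a} ∩ ζ ⁻¹' {b} := by ext; simp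
    rw [this]
    exact MeasurableSet.inter ((le_sup_left : sig ξ ≤ sig ξ ⊔ sig ζ) _ (measurableSet_sig _ _))
      ((le_sup_right : sig ζ ≤ sig ξ ⊔ sig ζ) _ (measurableSet_sig _ _))
  · refine sup_le ?_ ?_
    · rw [sig_le_iff]; intro s; exact ⟨Prod.fst ⁻¹' s, trivial, rfl⟩
    · rw [sig_le_iff]; intro s; exact ⟨Prod.snd ⁻¹' s, trivial, rfl⟩

lemma sig_comp_le (ξ : X → ι) (g : ι → κ) : sig (g ∘ ξ) ≤ sig ξ := by
  rw [sig_le_iff]; intro s; exact ⟨g ⁻¹' s, trivial, rfl⟩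

variable [mX : MeasurableSpace X] {μ : Measure X} [IsProbabilityMeasure μ]

lemma integrable_indicator_one {s : Set X} (hs : MeasurableSet s) :
    Integrable (s.indicator fun _ => (1 : ℝ)) μ := (integrable_const 1).indicator hs

lemma setIntegral_indicator_one {s : Set X} (hs : MeasurableSet s) (t : Set X) :
    ∫ x in t, s.indicator (fun _ => (1 : ℝ)) x ∂μ = μ.real (s ∩ t) := by
  rw [← measureReal_restrict_apply hs, ← integral_indicator_one hs]; rfl

lemma condProb_mem (hm : m ≤ mX) {s : Set X} (hs : MeasurableSet s) :
    ∀ᵐ x ∂μ, (μ⟦s | m⟧) x ∈ Icc (0 : ℝ) 1 := by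
  have h0 : 0 ≤ᵐ[μ] μ⟦s | m⟧ := condExp_nonneg (ae_of_all _ fun x => by
    by_cases h : x ∈ s <;> simp [h])
  have h1 : μ⟦s | m⟧ ≤ᵐ[μ] μ[fun _ => (1 : ℝ) | m] :=
    condExp_mono (integrable_indicator_one hs) (integrable_const 1) (ae_of_all _ fun x => by
      by_cases h : x ∈ s <;> simp [h])
  rw [condExp_const hm] at h1
  filter_upwards [h0, h1] with x h0 h1 using ⟨h0, h1⟩

lemma negMulLog_le {t : ℝ} (ht : 0 ≤ t) : Real.negMulLog t ≤ 1 - t := by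
  rcases ht.eq_or_lt with rfl | ht
  · simp
  have := Real.one_sub_inv_le_log_of_pos ht
  rw [Real.negMulLog]
  have h2 : t * (1 - t⁻¹) ≤ t * Real.log t := mul_le_mul_of_nonneg_left this ht.le
  have h3 : t * (1 - t⁻¹) = t - 1 := by field_simp
  linarith

lemma negMulLog_mem {t : ℝ} (ht : t ∈ Icc (0 : ℝ) 1) : Real.negMulLog t ∈ Icc (0 : ℝ) 1 :=
  ⟨Real.negMulLog_nonneg ht.1 ht.2, by linarith [negMulLog_le ht.1, ht.1]⟩

lemma negMulLog_condProb_mem (hm : m ≤ mX) {s : Set X} (hs : MeasurableSet s) :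
    ∀ᵐ x ∂μ, Real.negMulLog ((μ⟦s | m⟧) x) ∈ Icc (0 : ℝ) 1 := by
  filter_upwards [condProb_mem (μ := μ) hm hs] with x hx using negMulLog_mem hx

lemma integrable_of_ae_mem_Icc {f : X → ℝ} (hf : AEStronglyMeasurable f μ)
    (h : ∀ᵐ x ∂μ, f x ∈ Icc (0 : ℝ) 1) : Integrable f μ := by
  refine Integrable.of_bound hf 1 ?_
  filter_upwards [h] with x hx
  rw [Real.norm_eq_abs, abs_le]
  exact ⟨by linarith [hx.1], hx.2⟩

lemma stronglyMeasurable_negMulLog_condProb (s : Set X) :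
    StronglyMeasurable[m] fun x => Real.negMulLog ((μ⟦s | m⟧) x) :=
  Real.continuous_negMulLog.comp_stronglyMeasurable stronglyMeasurable_condExp

lemma integrable_negMulLog_condProb (hm : m ≤ mX) {s : Set X} (hs : MeasurableSet s) :
    Integrable (fun x => Real.negMulLog ((μ⟦s | m⟧) x)) μ :=
  integrable_of_ae_mem_Icc
    ((stronglyMeasurable_negMulLog_condProb s).mono hm).aestronglyMeasurable
    (negMulLog_condProb_mem hm hs)

lemma cEnt_nonneg [Fintype ι] (hm : m ≤ mX) {ξ : X → ι} (hξ : sig ξ ≤ mX) :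
    0 ≤ cEnt m μ ξ :=
  Finset.sum_nonneg fun a _ => integral_nonneg_of_ae (by
    filter_upwards [negMulLog_condProb_mem (μ := μ) hm (sig_le_iff.1 hξ {a})] with x hx using hx.1)

lemma cEnt_le_card [Fintype ι] (hm : m ≤ mX) {ξ : X → ι} (hξ : sig ξ ≤ mX) :
    cEnt m μ ξ ≤ Fintype.card ι := by
  rw [cEnt]
  have : ∀ a : ι, ∫ x, Real.negMulLog ((μ⟦ξ ⁻¹' {a} | m⟧) x) ∂μ ≤ 1 := by
    intro a
    have := integral_mono_ae (integrable_negMulLog_condProb (μ := μ) hm (sig_le_iff.1 hξ {a}))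
      (integrable_const 1) (by
        filter_upwards [negMulLog_condProb_mem (μ := μ) hm (sig_le_iff.1 hξ {a})] with x hx
        using hx.2)
    simpa using this
  calc _ ≤ ∑ a : ι, (1 : ℝ) := Finset.sum_le_sum fun a _ => this a
    _ = _ := by simp

lemma cEnt_anti [Fintype ι] (hmm : m ≤ m') (hm' : m' ≤ mX) {ξ : X → ι} (hξ : sig ξ ≤ mX) :
    cEnt m' μ ξ ≤ cEnt m μ ξ := by
  refine Finset.sum_le_sum fun a _ => ?_
  have hs := sig_le_iff.1 hξ {a}
  have hm := hmm.trans hm'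
  have h1 := ConcaveOn.condExp_map_le (μ := μ) (f := μ⟦ξ ⁻¹' {a} | m'⟧)
    (φ := Real.negMulLog) (s := Ici 0) hm Real.concaveOn_negMulLog
    (Real.continuous_negMulLog.upperSemicontinuous.upperSemicontinuousOn _)
    (by filter_upwards [condProb_mem (μ := μ) hm' hs] with x hx using hx.1) isClosed_Ici
    integrable_condExp (integrable_negMulLog_condProb hm' hs)
  have h2 : μ[μ⟦ξ ⁻¹' {a} | m'⟧ | m] =ᵐ[μ] μ⟦ξ ⁻¹' {a} | m⟧ := condExp_condExp_of_le hmm hm'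
  rw [← integral_condExp hm (f := fun x => Real.negMulLog ((μ⟦ξ ⁻¹' {a} | m'⟧) x))]
  refine integral_mono_ae integrable_condExp (integrable_negMulLog_condProb hm hs) ?_
  filter_upwards [h1, h2] with x h1 h2
  calc _ ≤ _ := h1
    _ = _ := by simp only [Function.comp_apply]; rw [h2]

lemma cEnt_eq_zero_of_le [Fintype ι] (hm : m ≤ mX) {ξ : X → ι} (hξ : sig ξ ≤ m) :
    cEnt m μ ξ = 0 := by
  refine Finset.sum_eq_zero fun a _ => ?_
  have hs := sig_le_iff.1 hξ {a}
  rw [condExp_of_stronglyMeasurable hm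
    (StronglyMeasurable.indicator stronglyMeasurable_const hs)
    (integrable_indicator_one (hm _ hs))]
  rw [← integral_zero X ℝ (μ := μ)]
  congr 1
  ext x
  by_cases h : x ∈ ξ ⁻¹' {a} <;> simp [h]

lemma condProb_eq_indicator_of_cEnt_eq_zero [Fintype ι] (hm : m ≤ mX) {ξ : X → ι}
    (hξ : sig ξ ≤ mX) (h : cEnt m μ ξ = 0) (a : ι) :
    μ⟦ξ ⁻¹' {a} | m⟧ =ᵐ[μ] (ξ ⁻¹' {a}).indicator fun _ => (1 : ℝ) := by
  have hs := fun a => sig_le_iff.1 hξ {a}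
  have hn : ∀ a, 0 ≤ᵐ[μ] fun x => Real.negMulLog ((μ⟦ξ ⁻¹' {a} | m⟧) x) := fun a => by
    filter_upwards [negMulLog_condProb_mem (μ := μ) hm (hs a)] with x hx using hx.1
  have h0 := (Finset.sum_eq_zero_iff_of_nonneg fun a _ => integral_nonneg_of_ae (hn a)).1 h a
    (Finset.mem_univ a)
  rw [integral_eq_zero_iff_of_nonneg_ae (hn a) (integrable_negMulLog_condProb hm (hs a))] at h0
  set s := ξ ⁻¹' {a}
  set D := {x | (μ⟦s | m⟧) x = 1} with hDdef
  have hD : MeasurableSet[m] D :=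
    measurableSet_eq_fun stronglyMeasurable_condExp.measurable measurable_const
  have hD1 : μ⟦s | m⟧ =ᵐ[μ] D.indicator fun _ => (1 : ℝ) := by
    filter_upwards [h0, condProb_mem (μ := μ) hm (hs a)] with x h0 h1
    by_cases hx : x ∈ D
    · rw [indicator_of_mem hx]; exact hx
    · rw [indicator_of_notMem hx]
      simp only [Pi.zero_apply, Real.negMulLog, neg_mul, neg_eq_zero, mul_eq_zero,
        Real.log_eq_zero] at h0
      rcases h0 with h0 | h0 | h0 | h0
      · exact h0
      · exact h0
      · exact absurd h0 hx
      · have := h1.1; simp only [s] at this h0; linarith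
  have e1 : ∫ x in D, (μ⟦s | m⟧) x ∂μ = ∫ x in D, s.indicator (fun _ => (1 : ℝ)) x ∂μ :=
    setIntegral_condExp hm (integrable_indicator_one (hs a)) hD
  have e2 : ∫ x in Dᶜ, (μ⟦s | m⟧) x ∂μ = ∫ x in Dᶜ, s.indicator (fun _ => (1 : ℝ)) x ∂μ :=
    setIntegral_condExp hm (integrable_indicator_one (hs a)) hD.compl
  have e1' : ∫ x in D, (μ⟦s | m⟧) x ∂μ = μ.real D := by
    rw [setIntegral_congr_fun (g := fun _ => (1 : ℝ)) (hm _ hD) (fun x hx => hx)]; simp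
  have e2' : ∫ x in Dᶜ, (μ⟦s | m⟧) x ∂μ = 0 := by
    rw [setIntegral_congr_ae (g := fun _ => (0 : ℝ)) (hm _ hD.compl)]
    · simp
    · filter_upwards [hD1] with x hx hx'
      rw [hx, indicator_of_notMem hx']
  rw [e1', setIntegral_indicator_one (hs a)] at e1
  rw [e2', setIntegral_indicator_one (hs a)] at e2
  have e3 : μ (s ∩ Dᶜ) = 0 := by
    rwa [eq_comm, measureReal_eq_zero_iff] at e2
  have e4 : μ (D \ s) = 0 := by
    have := measureReal_sdiff_add_inter (μ := μ) (s := D) (hs a)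
    rw [inter_comm, ← e1] at this
    have : μ.real (D \ s) = 0 := by linarith
    rwa [measureReal_eq_zero_iff] at this
  have e5 : s =ᵐ[μ] D := by
    rw [ae_eq_set]; exact ⟨e3, e4⟩
  exact hD1.trans (indicator_ae_eq_of_ae_eq_set e5.symm)

lemma cEnt_tendsto [Fintype ι] {F : ℕ → MeasurableSpace X} (hF : Monotone F)
    (hFX : ∀ n, F n ≤ mX) {ξ : X → ι} (hξ : sig ξ ≤ mX) :
    Tendsto (fun n => cEnt (F n) μ ξ) atTop (𝓝 (cEnt (⨆ n, F n) μ ξ)) := by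
  refine tendsto_finsetSum _ fun a _ => ?_
  have hs := sig_le_iff.1 hξ {a}
  let ℱ : Filtration ℕ mX := ⟨F, hF, hFX⟩
  have h := tendsto_ae_condExp (μ := μ) (ℱ := ℱ) ((ξ ⁻¹' {a}).indicator fun _ => (1 : ℝ))
  refine tendsto_integral_of_dominated_convergence (fun _ => (1 : ℝ))
    (fun n => ((stronglyMeasurable_negMulLog_condProb _).mono (hFX n)).aestronglyMeasurable)
    (integrable_const 1) (fun n => ?_) ?_
  · filter_upwards [negMulLog_condProb_mem (μ := μ) (hFX n) hs] with x hx
    rw [Real.norm_eq_abs, abs_of_nonneg hx.1]; exact hx.2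
  · filter_upwards [h] with x hx
    exact (Real.continuous_negMulLog.tendsto _).comp hx

lemma condExp_comp_comap {g : X → X} (hg : MeasurePreserving g μ μ) (hm : m ≤ mX)
    {f : X → ℝ} (hf : Integrable f μ) :
    μ[f ∘ g | m.comap g] =ᵐ[μ] μ[f | m] ∘ g := by
  have hm' : m.comap g ≤ mX := by
    rintro _ ⟨t, ht, rfl⟩; exact hg.measurable (hm _ ht)
  have hi : Integrable (μ[f | m] ∘ g) μ := hg.integrable_comp_of_integrable integrable_condExp
  symm
  refine ae_eq_condExp_of_forall_setIntegral_eq hm' (hg.integrable_comp_of_integrable hf)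
    (fun s _ _ => hi.integrableOn) ?_ ?_
  · rintro _ ⟨t, ht, rfl⟩ -
    have key : ∀ u : X → ℝ, Integrable u μ →
        ∫ x in g ⁻¹' t, (u ∘ g) x ∂μ = ∫ x in t, u x ∂μ := by
      intro u hu
      have := setIntegral_map (μ := μ) (hm _ ht) (f := u) (g := g)
        (by rw [hg.map_eq]; exact hu.aestronglyMeasurable) hg.measurable.aemeasurable
      rw [hg.map_eq] at this
      exact this.symm
    rw [key _ integrable_condExp, key _ hf]
    exact setIntegral_condExp hm hf ht
  · exact (stronglyMeasurable_condExp.comp_measurable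
      (comap_measurable g)).aestronglyMeasurable

lemma cEnt_comp [Fintype ι] {g : X → X} (hg : MeasurePreserving g μ μ) (hm : m ≤ mX)
    {ξ : X → ι} (hξ : sig ξ ≤ mX) : cEnt (m.comap g) μ (ξ ∘ g) = cEnt m μ ξ := by
  refine Finset.sum_congr rfl fun a _ => ?_
  have hs := sig_le_iff.1 hξ {a}
  have h1 : μ⟦(ξ ∘ g) ⁻¹' {a} | m.comap g⟧ =ᵐ[μ] μ⟦ξ ⁻¹' {a} | m⟧ ∘ g :=
    condExp_comp_comap hg hm (integrable_indicator_one hs)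
  have h2 : ∫ x, Real.negMulLog ((μ⟦(ξ ∘ g) ⁻¹' {a} | m.comap g⟧) x) ∂μ =
      ∫ x, Real.negMulLog ((μ⟦ξ ⁻¹' {a} | m⟧) (g x)) ∂μ := by
    refine integral_congr_ae ?_
    filter_upwards [h1] with x hx
    rw [hx]; rfl
  rw [h2]
  have := integral_map (μ := μ) hg.measurable.aemeasurable
    (f := fun x => Real.negMulLog ((μ⟦ξ ⁻¹' {a} | m⟧) x))
    (by rw [hg.map_eq]; exact (integrable_negMulLog_condProb hm hs).aestronglyMeasurable)
  rw [hg.map_eq] at this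
  exact this.symm

lemma exists_inter_of_measurableSet_sup_sig [Finite κ] {ζ : X → κ} {s : Set X}
    (hs : MeasurableSet[m ⊔ sig ζ] s) :
    ∃ M : κ → Set X, (∀ b, MeasurableSet[m] (M b)) ∧ ∀ x, x ∈ s ↔ x ∈ M (ζ x) := by
  let : MeasurableSpace κ := ⊤
  have h : m ⊔ sig ζ ≤ (@Prod.instMeasurableSpace X κ m ⊤).comap fun x => (x, ζ x) := by
    refine sup_le ?_ ?_
    · intro t ht
      exact ⟨Prod.fst ⁻¹' t, (@measurable_fst X κ m ⊤) ht, rfl⟩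
    · rintro _ ⟨t, ht, rfl⟩
      exact ⟨Prod.snd ⁻¹' t, (@measurable_snd X κ m ⊤) ht, rfl⟩
  obtain ⟨S, hS, rfl⟩ := h _ hs
  exact ⟨fun b => (fun x => (x, b)) ⁻¹' S,
    fun b => (@measurable_prodMk_right X κ m ⊤ b) hS, fun x => Iff.rfl⟩

lemma integral_indicator_mul_condProb (hm : m ≤ mX) {B : Set X} (hB : MeasurableSet B)
    {r : X → ℝ} (hr : StronglyMeasurable[m] r) (hr1 : ∀ᵐ x ∂μ, r x ∈ Icc (0 : ℝ) 1) :
    ∫ x, r x * B.indicator (fun _ => (1 : ℝ)) x ∂μ = ∫ x, r x * (μ⟦B | m⟧) x ∂μ := by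
  have hi : Integrable (r * B.indicator fun _ => (1 : ℝ)) μ := by
    refine integrable_of_ae_mem_Icc ((hr.mono hm).aestronglyMeasurable.mul
      (integrable_indicator_one hB).aestronglyMeasurable) ?_
    filter_upwards [hr1] with x hx
    by_cases h : x ∈ B <;> simp [h, hx.1, hx.2]
  have := condExp_mul_of_stronglyMeasurable_left hr hi (integrable_indicator_one hB)
  rw [← integral_condExp hm (f := fun x => r x * B.indicator (fun _ => (1 : ℝ)) x)]
  exact integral_congr_ae this

lemma condProb_mono (s t : Set X) (hs : MeasurableSet s) (ht : MeasurableSet t) (h : s ⊆ t) :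
    μ⟦s | m⟧ ≤ᵐ[μ] μ⟦t | m⟧ :=
  condExp_mono (integrable_indicator_one hs) (integrable_indicator_one ht)
    (ae_of_all _ fun x => indicator_le_indicator_of_subset h (fun _ => zero_le_one) x)

lemma condProb_sup_sig [Finite κ] (hm : m ≤ mX) {ζ : X → κ} (hζ : sig ζ ≤ mX) {A : Set X}
    (hA : MeasurableSet A) :
    μ⟦A | m ⊔ sig ζ⟧ =ᵐ[μ] fun x =>
      (μ⟦A ∩ ζ ⁻¹' {ζ x} | m⟧) x / (μ⟦ζ ⁻¹' {ζ x} | m⟧) x := by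
  have := Fintype.ofFinite κ
  have hB := fun b => sig_le_iff.1 hζ {b}
  let r : κ → X → ℝ := fun b x => (μ⟦A ∩ ζ ⁻¹' {b} | m⟧) x / (μ⟦ζ ⁻¹' {b} | m⟧) x
  have hrm : ∀ b, StronglyMeasurable[m] (r b) := fun b =>
    StronglyMeasurable.div stronglyMeasurable_condExp stronglyMeasurable_condExp
  have hle : ∀ b, ∀ᵐ x ∂μ, (μ⟦A ∩ ζ ⁻¹' {b} | m⟧) x ≤ (μ⟦ζ ⁻¹' {b} | m⟧) x := fun b =>
    condProb_mono _ _ (hA.inter (hB b)) (hB b) inter_subset_right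
  have hr1 : ∀ b, ∀ᵐ x ∂μ, r b x ∈ Icc (0 : ℝ) 1 := fun b => by
    filter_upwards [hle b, condProb_mem (μ := μ) hm (hA.inter (hB b)),
      condProb_mem (μ := μ) hm (hB b)] with x h1 h2 h3
    exact ⟨div_nonneg h2.1 h3.1, div_le_one_of_le₀ h1 h3.1⟩
  have hrp : ∀ b, ∀ᵐ x ∂μ, r b x * (μ⟦ζ ⁻¹' {b} | m⟧) x = (μ⟦A ∩ ζ ⁻¹' {b} | m⟧) x := fun b => by
    filter_upwards [hle b, condProb_mem (μ := μ) hm (hA.inter (hB b))] with x h1 h2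
    exact div_mul_cancel_of_imp fun h => le_antisymm (h ▸ h1) h2.1
  have hsum : (fun x => r (ζ x) x) =
      fun x => ∑ b, r b x * (ζ ⁻¹' {b}).indicator (fun _ => (1 : ℝ)) x := by
    ext x
    rw [Finset.sum_eq_single (ζ x)]
    · simp
    · intro b _ hb
      simp [indicator, hb.symm]
    · simp
  have hmm : m ⊔ sig ζ ≤ mX := sup_le hm hζ
  have hmeas : StronglyMeasurable[m ⊔ sig ζ] fun x => r (ζ x) x := by
    rw [hsum]
    refine Finset.stronglyMeasurable_fun_sum _ fun b _ => ?_
    exact ((hrm b).mono le_sup_left).mul (stronglyMeasurable_const.indicator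
      ((le_sup_right : sig ζ ≤ m ⊔ sig ζ) _ (measurableSet_sig ζ {b})))
  have hInt : ∀ b, Integrable (fun x => r b x * (ζ ⁻¹' {b}).indicator (fun _ => (1 : ℝ)) x) μ := by
    intro b
    refine integrable_of_ae_mem_Icc (((hrm b).mono hm).aestronglyMeasurable.mul
      (integrable_indicator_one (hB b)).aestronglyMeasurable) ?_
    filter_upwards [hr1 b] with x hx
    by_cases h : x ∈ ζ ⁻¹' {b}
    · simpa [h] using hx
    · simp [h]
  have hInt' : Integrable (fun x => r (ζ x) x) μ := by
    rw [hsum]; exact integrable_finsetSum _ fun b _ => hInt b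
  symm
  refine ae_eq_condExp_of_forall_setIntegral_eq hmm (integrable_indicator_one hA)
    (fun s _ _ => hInt'.integrableOn) ?_ hmeas.aestronglyMeasurable
  intro S hS _
  obtain ⟨M, hM, hSM⟩ := exists_inter_of_measurableSet_sup_sig hS
  have e1 : ∀ b, ∫ x in S, r b x * (ζ ⁻¹' {b}).indicator (fun _ => (1 : ℝ)) x ∂μ =
      μ.real (A ∩ ζ ⁻¹' {b} ∩ M b) := by
    intro b
    have f1 : ∫ x in S, r b x * (ζ ⁻¹' {b}).indicator (fun _ => (1 : ℝ)) x ∂μ =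
        ∫ x, (M b).indicator (r b) x * (ζ ⁻¹' {b}).indicator (fun _ => (1 : ℝ)) x ∂μ := by
      rw [← integral_indicator (hmm _ hS)]
      congr 1
      ext x
      by_cases hb : ζ x = b
      · have : x ∈ S ↔ x ∈ M b := by rw [hSM, hb]
        by_cases hx : x ∈ S <;> simp [hx, this.symm, hb]
      · by_cases hx : x ∈ S <;> simp [hx, hb]
    rw [f1, integral_indicator_mul_condProb hm (hB b) ((hrm b).indicator (hM b))]
    · have f2 : ∫ x, (M b).indicator (r b) x * (μ⟦ζ ⁻¹' {b} | m⟧) x ∂μ =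
          ∫ x in M b, (μ⟦A ∩ ζ ⁻¹' {b} | m⟧) x ∂μ := by
        rw [← integral_indicator (hm _ (hM b))]
        refine integral_congr_ae ?_
        filter_upwards [hrp b] with x hx
        by_cases h : x ∈ M b <;> simp [h, hx]
      rw [f2, setIntegral_condExp hm (integrable_indicator_one (hA.inter (hB b))) (hM b),
        setIntegral_indicator_one (hA.inter (hB b))]
    · filter_upwards [hr1 b] with x hx
      by_cases h : x ∈ M b
      · simpa [h] using hx
      · simp [h]
  rw [show (∫ x in S, r (ζ x) x ∂μ) = ∫ x in S, (fun x => r (ζ x) x) x ∂μ from rfl, hsum,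
    integral_finsetSum _ fun b _ => (hInt b).integrableOn, setIntegral_indicator_one hA]
  simp_rw [e1]
  rw [← measureReal_biUnion_finset]
  · congr 1
    ext x
    simp only [Finset.mem_univ, iUnion_true, mem_iUnion, mem_inter_iff, mem_preimage,
      mem_singleton_iff]
    constructor
    · rintro ⟨b, ⟨h1, rfl⟩, h3⟩; exact ⟨h1, (hSM x).2 h3⟩
    · rintro ⟨h1, h2⟩; exact ⟨ζ x, ⟨h1, rfl⟩, (hSM x).1 h2⟩
  · intro b _ b' _ hbb
    refine Set.disjoint_left.2 ?_
    rintro x ⟨⟨-, h⟩, -⟩ ⟨⟨-, h'⟩, -⟩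
    exact hbb (h.symm.trans h')
  · intro b _
    exact (hA.inter (hB b)).inter (hm _ (hM b))

lemma sum_condProb_inter [Fintype ι] {ξ : X → ι} (hξ : sig ξ ≤ mX) {B : Set X}
    (hB : MeasurableSet B) :
    ∀ᵐ x ∂μ, ∑ a, (μ⟦ξ ⁻¹' {a} ∩ B | m⟧) x = (μ⟦B | m⟧) x := by
  have h1 := condExp_finsetSum (μ := μ) (s := Finset.univ)
    (f := fun a => (ξ ⁻¹' {a} ∩ B).indicator fun _ => (1 : ℝ))
    (fun a _ => integrable_indicator_one ((sig_le_iff.1 hξ {a}).inter hB)) m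
  have h2 : ∑ a, ((ξ ⁻¹' {a} ∩ B).indicator fun _ => (1 : ℝ)) = B.indicator fun _ => 1 := by
    ext x
    rw [Finset.sum_apply, Finset.sum_eq_single (ξ x)]
    · by_cases h : x ∈ B <;> simp [h]
    · intro a _ ha
      simp [indicator, ha.symm]
    · simp
  rw [h2] at h1
  filter_upwards [h1] with x hx
  rw [hx, Finset.sum_apply]

lemma cEnt_prod [Fintype ι] [Fintype κ] (hm : m ≤ mX) {ξ : X → ι} {ζ : X → κ}
    (hξ : sig ξ ≤ mX) (hζ : sig ζ ≤ mX) :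
    cEnt m μ (fun x => (ξ x, ζ x)) = cEnt m μ ζ + cEnt (m ⊔ sig ζ) μ ξ := by
  have hA := fun a => sig_le_iff.1 hξ {a}
  have hB := fun b => sig_le_iff.1 hζ {b}
  let p : ι → κ → X → ℝ := fun a b => μ⟦ξ ⁻¹' {a} ∩ ζ ⁻¹' {b} | m⟧
  let q : κ → X → ℝ := fun b => μ⟦ζ ⁻¹' {b} | m⟧
  have hp1 : ∀ a b, ∀ᵐ x ∂μ, p a b x ∈ Icc (0 : ℝ) 1 := fun a b =>
    condProb_mem hm ((hA a).inter (hB b))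
  have hq1 : ∀ b, ∀ᵐ x ∂μ, q b x ∈ Icc (0 : ℝ) 1 := fun b => condProb_mem hm (hB b)
  have hle : ∀ a b, ∀ᵐ x ∂μ, p a b x ≤ q b x := fun a b =>
    condProb_mono _ _ ((hA a).inter (hB b)) (hB b) inter_subset_right
  have hr1 : ∀ a b, ∀ᵐ x ∂μ, p a b x / q b x ∈ Icc (0 : ℝ) 1 := fun a b => by
    filter_upwards [hle a b, hp1 a b, hq1 b] with x h1 h2 h3
    exact ⟨div_nonneg h2.1 h3.1, div_le_one_of_le₀ h1 h3.1⟩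
  have hsm : ∀ a b, StronglyMeasurable[m] fun x => Real.negMulLog (p a b x / q b x) := fun a b =>
    Real.continuous_negMulLog.comp_stronglyMeasurable
      (StronglyMeasurable.div stronglyMeasurable_condExp stronglyMeasurable_condExp)
  have hr2 : ∀ a b, ∀ᵐ x ∂μ, Real.negMulLog (p a b x / q b x) ∈ Icc (0 : ℝ) 1 := fun a b => by
    filter_upwards [hr1 a b] with x hx using negMulLog_mem hx
  have hip : ∀ a b, Integrable (fun x => Real.negMulLog (p a b x)) μ := fun a b =>
    integrable_negMulLog_condProb hm ((hA a).inter (hB b))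
  have hiq : ∀ b, Integrable (fun x => Real.negMulLog (q b x)) μ := fun b =>
    integrable_negMulLog_condProb hm (hB b)
  have hind : ∀ a b, Integrable (fun x => Real.negMulLog (p a b x / q b x) *
      (ζ ⁻¹' {b}).indicator (fun _ => (1 : ℝ)) x) μ := fun a b => by
    refine integrable_of_ae_mem_Icc (((hsm a b).mono hm).aestronglyMeasurable.mul
      (integrable_indicator_one (hB b)).aestronglyMeasurable) ?_
    filter_upwards [hr2 a b] with x hx
    by_cases h : x ∈ ζ ⁻¹' {b}
    · simpa [h] using hx
    · simp [h]
  have hirq : ∀ a b, Integrable (fun x => Real.negMulLog (p a b x / q b x) * q b x) μ := fun a b => by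
    refine integrable_of_ae_mem_Icc (((hsm a b).mono hm).aestronglyMeasurable.mul
      (stronglyMeasurable_condExp.mono hm).aestronglyMeasurable) ?_
    filter_upwards [hr2 a b, hq1 b] with x hx hx'
    exact ⟨mul_nonneg hx.1 hx'.1, mul_le_one₀ hx.2 hx'.1 hx'.2⟩
  have e1 : cEnt m μ (fun x => (ξ x, ζ x)) = ∑ b, ∑ a, ∫ x, Real.negMulLog (p a b x) ∂μ := by
    rw [cEnt, Fintype.sum_prod_type, Finset.sum_comm]
    have : ∀ a b, (fun x => (ξ x, ζ x)) ⁻¹' {(a, b)} = ξ ⁻¹' {a} ∩ ζ ⁻¹' {b} := by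
      intro a b; ext; simp
    simp_rw [this]; rfl
  have e2 : cEnt (m ⊔ sig ζ) μ ξ =
      ∑ b, ∑ a, ∫ x, Real.negMulLog (p a b x / q b x) * q b x ∂μ := by
    rw [cEnt, Finset.sum_comm]
    refine Finset.sum_congr rfl fun a _ => ?_
    have hI : ∀ b, ∫ x, Real.negMulLog (p a b x / q b x) * q b x ∂μ = _ := fun b =>
      (integral_indicator_mul_condProb hm (hB b) (hsm a b) (hr2 a b)).symm
    rw [Finset.sum_congr rfl fun b _ => hI b]
    rw [← integral_finsetSum _ fun b _ => hind a b]
    refine integral_congr_ae ?_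
    filter_upwards [condProb_sup_sig (μ := μ) hm hζ (hA a)] with x hx
    rw [hx, Finset.sum_eq_single (ζ x)]
    · have h1 : (ζ ⁻¹' {ζ x}).indicator (fun _ => (1 : ℝ)) x = 1 :=
        indicator_of_mem (mem_preimage.2 (mem_singleton _)) _
      rw [h1, mul_one]
    · intro b _ hb
      simp [indicator, hb.symm]
    · simp
  have e3 : cEnt m μ ζ = ∑ b, ∫ x, Real.negMulLog (q b x) ∂μ := rfl
  rw [e1, e2, e3, ← Finset.sum_add_distrib]
  refine Finset.sum_congr rfl fun b _ => ?_
  rw [← integral_finsetSum _ fun a _ => hip a b, ← integral_finsetSum _ fun a _ => hirq a b,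
    ← integral_add (hiq b) (integrable_finsetSum _ fun a _ => hirq a b)]
  refine integral_congr_ae ?_
  filter_upwards [ae_all_iff.2 fun a => hp1 a b, ae_all_iff.2 fun a => hle a b, hq1 b,
    sum_condProb_inter (μ := μ) hξ (hB b)] with x h1 h2 h3 h4
  have key : ∀ a, Real.negMulLog (p a b x) =
      Real.negMulLog (p a b x / q b x) * q b x + p a b x * (-Real.log (q b x)) := by
    intro a
    rcases eq_or_ne (p a b x) 0 with h0 | h0
    · simp [h0]
    · have hp : 0 < p a b x := lt_of_le_of_ne (h1 a).1 h0.symm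
      have hq : 0 < q b x := hp.trans_le (h2 a)
      rw [Real.negMulLog, Real.negMulLog, Real.log_div hp.ne' hq.ne']
      field_simp
      ring
  rw [Finset.sum_congr rfl fun a _ => key a, Finset.sum_add_distrib, ← Finset.sum_mul,
    ← Finset.sum_mul]
  have h4' : ∑ a, p a b x = q b x := h4
  rw [h4', Real.negMulLog]
  ring

end CondEntropy

section CondEntropy

set_option linter.unusedSectionVars false

variable {m m' : MeasurableSpace X} {ι κ : Type*}

/-- The map recording the first `n` terms of a sequence of maps. -/
def tup (ξ : ℕ → X → ι) (n : ℕ) : X → Fin n → ι := fun x i => ξ i x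

lemma sig_tup_le_iff [Finite ι] {ξ : ℕ → X → ι} {n : ℕ} :
    sig (tup ξ n) ≤ m ↔ ∀ i < n, sig (ξ i) ≤ m := by
  constructor
  · intro h i hi
    exact (sig_comp_le (tup ξ n) (fun v => v ⟨i, hi⟩)).trans h
  · intro h
    rw [sig_le_iff_singleton]
    intro a
    have : tup ξ n ⁻¹' {a} = ⋂ i : Fin n, ξ i ⁻¹' {a i} := by
      ext x; simp [tup, funext_iff]
    rw [this]
    exact MeasurableSet.iInter fun i => sig_le_iff_singleton.1 (h i i.2) _

lemma sig_tup_succ [Finite ι] (ξ : ℕ → X → ι) (n : ℕ) :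
    sig (tup ξ (n + 1)) = sig (ξ n) ⊔ sig (tup ξ n) := by
  apply le_antisymm
  · rw [sig_tup_le_iff]
    intro i hi
    rcases Nat.lt_succ_iff_lt_or_eq.1 hi with h | rfl
    · exact (sig_tup_le_iff.1 le_rfl i h).trans le_sup_right
    · exact le_sup_left
  · refine sup_le (sig_tup_le_iff.1 le_rfl n n.lt_succ_self) ?_
    rw [sig_tup_le_iff]
    exact fun i hi => sig_tup_le_iff.1 le_rfl i (hi.trans n.lt_succ_self)

lemma sig_tup_succ' [Finite ι] (ξ : ℕ → X → ι) (n : ℕ) :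
    sig (tup ξ (n + 1)) = sig (ξ 0) ⊔ sig (tup (fun i => ξ (i + 1)) n) := by
  apply le_antisymm
  · rw [sig_tup_le_iff]
    rintro (_ | i) hi
    · exact le_sup_left
    · exact (sig_tup_le_iff (ξ := fun i => ξ (i + 1)).1 le_rfl i
        (Nat.lt_of_succ_lt_succ hi)).trans le_sup_right
  · refine sup_le (sig_tup_le_iff.1 le_rfl 0 n.succ_pos) ?_
    rw [sig_tup_le_iff]
    exact fun i hi => sig_tup_le_iff.1 le_rfl (i + 1) (Nat.succ_lt_succ hi)

variable [mX : MeasurableSpace X] {μ : Measure X}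

lemma cEnt_prod_comm [Fintype ι] [Fintype κ] (ξ : X → ι) (ζ : X → κ) :
    cEnt m μ (fun x => (ξ x, ζ x)) = cEnt m μ (fun x => (ζ x, ξ x)) := by
  refine Fintype.sum_equiv (Equiv.prodComm ι κ) _ _ ?_
  rintro ⟨a, b⟩
  have : (fun x => (ξ x, ζ x)) ⁻¹' {(a, b)} = (fun x => (ζ x, ξ x)) ⁻¹' {(b, a)} := by
    ext x; simp [and_comm]
  simp [this]

variable [IsProbabilityMeasure μ]

lemma cEnt_bot [Fintype ι] {ξ : X → ι} (hξ : sig ξ ≤ mX) :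
    cEnt ⊥ μ ξ = ∑ a, Real.negMulLog (μ.real (ξ ⁻¹' {a})) := by
  refine Finset.sum_congr rfl fun a _ => ?_
  have h : ∫ x, (ξ ⁻¹' {a}).indicator (fun _ => (1 : ℝ)) x ∂μ = μ.real (ξ ⁻¹' {a}) :=
    integral_indicator_one (sig_le_iff.1 hξ _)
  rw [condExp_bot, h]
  simp

lemma cEnt_mono_sig [Fintype ι] [Fintype κ] (hm : m ≤ mX) {ξ : X → ι} {ζ : X → κ}
    (hξ : sig ξ ≤ mX) (hζ : sig ζ ≤ mX) (h : sig ξ ≤ m ⊔ sig ζ) :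
    cEnt m μ ξ ≤ cEnt m μ ζ := by
  have h1 := cEnt_prod (μ := μ) hm hξ hζ
  have h2 := cEnt_prod (μ := μ) hm hζ hξ
  rw [cEnt_eq_zero_of_le (sup_le hm hζ) h, cEnt_prod_comm] at h1
  have h3 := cEnt_nonneg (μ := μ) (sup_le hm hξ) hζ
  linarith

lemma cEnt_congr_sig [Fintype ι] [Fintype κ] (hm : m ≤ mX) {ξ : X → ι} {ζ : X → κ}
    (hξ : sig ξ ≤ mX) (h : sig ξ = sig ζ) : cEnt m μ ξ = cEnt m μ ζ :=
  le_antisymm (cEnt_mono_sig hm hξ (h ▸ hξ) (h.le.trans le_sup_right))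
    (cEnt_mono_sig hm (h ▸ hξ) hξ (h.ge.trans le_sup_right))

lemma cEnt_chain {θ : Type*} [Fintype ι] [Fintype κ] [Fintype θ] (hm : m ≤ mX) {ξ : X → ι}
    {ζ : X → κ} {χ : X → θ} (hξ : sig ξ ≤ mX) (hζ : sig ζ ≤ mX) (h : sig χ = sig ξ ⊔ sig ζ) :
    cEnt m μ χ = cEnt m μ ζ + cEnt (m ⊔ sig ζ) μ ξ := by
  rw [← cEnt_prod hm hξ hζ]
  exact cEnt_congr_sig hm (h.le.trans (sup_le hξ hζ)) (h.trans (sig_prod ξ ζ).symm)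

/-- Refining a partition increases the loss of entropy caused by further conditioning. -/
lemma cEnt_sub_le_sub [Fintype ι] [Fintype κ] (hmm : m ≤ m') (hm' : m' ≤ mX) {ξ : X → ι}
    {ζ : X → κ} (hζ : sig ζ ≤ mX) (h : sig ξ ≤ sig ζ) :
    cEnt m μ ξ - cEnt m' μ ξ ≤ cEnt m μ ζ - cEnt m' μ ζ := by
  have hξ := h.trans hζ
  rw [cEnt_chain (hmm.trans hm') hζ hξ (sup_eq_left.2 h).symm,
    cEnt_chain hm' hζ hξ (sup_eq_left.2 h).symm]
  have := cEnt_anti (μ := μ) (sup_le_sup_right hmm (sig ξ)) (sup_le hm' hξ) hζ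
  linarith

lemma cEnt_tup_eq_sum [Fintype ι] (hm : m ≤ mX) {ξ : ℕ → X → ι} (hξ : ∀ i, sig (ξ i) ≤ mX)
    (n : ℕ) : cEnt m μ (tup ξ n) = ∑ j ∈ Finset.range n, cEnt (m ⊔ sig (tup ξ j)) μ (ξ j) := by
  induction n with
  | zero =>
    rw [Finset.sum_range_zero]
    exact cEnt_eq_zero_of_le hm (sig_tup_le_iff.2 fun i hi => absurd hi i.not_lt_zero)
  | succ n ih =>
    rw [Finset.sum_range_succ, ← ih]
    exact cEnt_chain hm (hξ n) (sig_tup_le_iff.2 fun i _ => hξ i) (sig_tup_succ ξ n)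

lemma cEnt_tup_le_sum [Fintype ι] (hm : m ≤ mX) {ξ : ℕ → X → ι} (hξ : ∀ i, sig (ξ i) ≤ mX)
    (n : ℕ) : cEnt m μ (tup ξ n) ≤ ∑ j ∈ Finset.range n, cEnt m μ (ξ j) := by
  rw [cEnt_tup_eq_sum hm hξ]
  exact Finset.sum_le_sum fun j _ => cEnt_anti le_sup_left
    (sup_le hm (sig_tup_le_iff.2 fun i _ => hξ i)) (hξ j)

end CondEntropy

section Futures

set_option linter.unusedSectionVars false

variable {ι κ : Type*} {T : X → X}

/-- The σ-algebra generated by the present and the future of `ξ` under `T`. -/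
@[reducible] def fut (T : X → X) (ξ : X → ι) : MeasurableSpace X := ⨆ i : ℕ, sig (ξ ∘ T^[i])

/-- The itinerary of length `n` along `ξ`. -/
def itin (T : X → X) (ξ : X → ι) (n : ℕ) : X → Fin n → ι := tup (fun i => ξ ∘ T^[i]) n

lemma sig_comp (ξ : X → ι) (g : X → X) : sig (ξ ∘ g) = (sig ξ).comap g := by
  rw [sig, sig, MeasurableSpace.comap_comp]

lemma sig_comp_iterate_le_fut (ξ : X → ι) (n : ℕ) : sig (ξ ∘ T^[n]) ≤ fut T ξ :=
  le_iSup (fun i : ℕ => sig (ξ ∘ T^[i])) n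

lemma sig_le_fut (ξ : X → ι) : sig ξ ≤ fut T ξ := sig_comp_iterate_le_fut ξ 0

lemma comap_iterate_le {m : MeasurableSpace X} (h : m.comap T ≤ m) (n : ℕ) :
    m.comap T^[n] ≤ m := by
  induction n with
  | zero => simp
  | succ n ih =>
    rw [Function.iterate_succ, ← MeasurableSpace.comap_comp]
    exact (MeasurableSpace.comap_mono ih).trans h

lemma fut_le {m : MeasurableSpace X} (hm : m.comap T ≤ m) {ξ : X → ι} (hξ : sig ξ ≤ m) :
    fut T ξ ≤ m := by
  refine iSup_le fun i => ?_
  rw [sig_comp]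
  exact (MeasurableSpace.comap_mono hξ).trans (comap_iterate_le hm i)

lemma comap_fut (ξ : X → ι) (n : ℕ) : (fut T ξ).comap T^[n] = ⨆ i : ℕ, sig (ξ ∘ T^[i + n]) := by
  rw [fut, MeasurableSpace.comap_iSup]
  refine iSup_congr fun i => ?_
  rw [← sig_comp, Function.comp_assoc, ← Function.iterate_add]

lemma comap_fut_one (ξ : X → ι) : (fut T ξ).comap T = ⨆ i : ℕ, sig (ξ ∘ T^[i + 1]) :=
  comap_fut ξ 1

lemma comap_fut_le (ξ : X → ι) : (fut T ξ).comap T ≤ fut T ξ := by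
  rw [comap_fut_one]
  exact iSup_le fun i => sig_comp_iterate_le_fut ξ (i + 1)

lemma fut_eq_sup (ξ : X → ι) : fut T ξ = sig ξ ⊔ (fut T ξ).comap T := by
  apply le_antisymm
  · refine iSup_le fun i => ?_
    rcases i with _ | i
    · exact le_sup_left
    · rw [comap_fut_one]
      exact (le_iSup (fun i : ℕ => sig (ξ ∘ T^[i + 1])) i).trans le_sup_right
  · exact sup_le (sig_le_fut ξ) (comap_fut_le ξ)

lemma fut_comp_iterate (ξ : X → ι) (n : ℕ) : fut T (ξ ∘ T^[n]) = (fut T ξ).comap T^[n] := by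
  rw [comap_fut, fut]
  refine iSup_congr fun i => ?_
  rw [Function.comp_assoc, ← Function.iterate_add, add_comm]

lemma fut_prod [Finite ι] [Finite κ] (ξ : X → ι) (ζ : X → κ) :
    fut T (fun x => (ξ x, ζ x)) = fut T ξ ⊔ fut T ζ := by
  rw [fut, fut, fut, ← iSup_sup_eq]
  exact iSup_congr fun i => sig_prod (ξ ∘ T^[i]) (ζ ∘ T^[i])

lemma sig_itin_succ [Finite ι] (ξ : X → ι) (n : ℕ) :
    sig (itin T ξ (n + 1)) = sig ξ ⊔ sig (itin T ξ n ∘ T) :=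
  sig_tup_succ' (fun i => ξ ∘ T^[i]) n

lemma sig_itin_le_iff [Finite ι] {m : MeasurableSpace X} {ξ : X → ι} {n : ℕ} :
    sig (itin T ξ n) ≤ m ↔ ∀ i < n, sig (ξ ∘ T^[i]) ≤ m := sig_tup_le_iff

lemma sig_itin_mono [Finite ι] (ξ : X → ι) : Monotone fun n => sig (itin T ξ n) :=
  fun _ _ hab => sig_itin_le_iff.2 fun i hi => sig_itin_le_iff.1 le_rfl i (hi.trans_le hab)

lemma iSup_sig_itin [Finite ι] (ξ : X → ι) : ⨆ n, sig (itin T ξ n) = fut T ξ := by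
  apply le_antisymm
  · exact iSup_le fun n => sig_itin_le_iff.2 fun i _ => sig_comp_iterate_le_fut ξ i
  · exact iSup_le fun i => (sig_itin_le_iff.1 le_rfl i i.lt_succ_self).trans
      (le_iSup (fun n => sig (itin T ξ n)) (i + 1))

lemma fut_eq_itin_sup [Finite ι] (ξ : X → ι) (n : ℕ) :
    fut T ξ = sig (itin T ξ n) ⊔ (fut T ξ).comap T^[n] := by
  apply le_antisymm
  · refine iSup_le fun i => ?_
    rcases lt_or_ge i n with h | h
    · exact (sig_itin_le_iff.1 le_rfl i h).trans le_sup_left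
    · rw [comap_fut]
      obtain ⟨k, rfl⟩ := Nat.exists_eq_add_of_le' h
      exact (le_iSup (fun i : ℕ => sig (ξ ∘ T^[i + n])) k).trans le_sup_right
  · exact sup_le (sig_itin_le_iff.2 fun i _ => sig_comp_iterate_le_fut ξ i)
      (comap_iterate_le (comap_fut_le ξ) n)

lemma comap_fut_sup_itin [Finite ι] (ξ : X → ι) (n : ℕ) :
    (fut T ξ).comap T^[n + 1] ⊔ sig (itin T ξ n ∘ T) = (fut T ξ).comap T := by
  conv_rhs => rw [fut_eq_itin_sup ξ n]
  rw [MeasurableSpace.comap_sup, sig_comp, sup_comm, Function.iterate_succ,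
    ← MeasurableSpace.comap_comp]

lemma sig_itin_prod [Finite ι] [Finite κ] (ξ : X → ι) (ζ : X → κ) (n : ℕ) :
    sig (itin T (fun x => (ξ x, ζ x)) n) = sig (itin T ξ n) ⊔ sig (itin T ζ n) := by
  have hp : ∀ i, sig ((fun x => (ξ x, ζ x)) ∘ T^[i]) = sig (ξ ∘ T^[i]) ⊔ sig (ζ ∘ T^[i]) :=
    fun i => sig_prod _ _
  apply le_antisymm
  · refine sig_itin_le_iff.2 fun i hi => ?_
    rw [hp]
    exact sup_le_sup (sig_itin_le_iff.1 le_rfl i hi) (sig_itin_le_iff.1 le_rfl i hi)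
  · refine sup_le (sig_itin_le_iff.2 fun i hi => ?_) (sig_itin_le_iff.2 fun i hi => ?_)
    · exact (le_sup_left.trans (hp i).ge).trans (sig_itin_le_iff.1 le_rfl i hi)
    · exact (le_sup_right.trans (hp i).ge).trans (sig_itin_le_iff.1 le_rfl i hi)

end Futures

section Entropy

set_option linter.unusedSectionVars false

variable {m : MeasurableSpace X} [mX : MeasurableSpace X] {μ : Measure X} [IsProbabilityMeasure μ]
  {ι κ : Type*} [Fintype ι] [Fintype κ] {T : X → X} {ξ : X → ι} {ζ : X → κ}

/-- The entropy of `T` relative to the partition defined by `ξ`. -/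
def ent (μ : Measure X) (T : X → X) (ξ : X → ι) : ℝ := cEnt ((fut T ξ).comap T) μ ξ

lemma fut_le_borel (hT : MeasurePreserving T μ μ) (hξ : sig ξ ≤ mX) : fut T ξ ≤ mX :=
  fut_le hT.measurable.comap_le hξ

lemma sig_comp_iterate_le (hT : MeasurePreserving T μ μ) (hξ : sig ξ ≤ mX) (n : ℕ) :
    sig (ξ ∘ T^[n]) ≤ mX :=
  (sig_comp_iterate_le_fut ξ n).trans (fut_le_borel hT hξ)

lemma sig_itin_le (hT : MeasurePreserving T μ μ) (hξ : sig ξ ≤ mX) (n : ℕ) :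
    sig (itin T ξ n) ≤ mX := sig_itin_le_iff.2 fun i _ => sig_comp_iterate_le hT hξ i

lemma comap_iterate_le_borel (hT : MeasurePreserving T μ μ) (hm : m ≤ mX) (n : ℕ) :
    m.comap T^[n] ≤ mX :=
  (MeasurableSpace.comap_mono hm).trans (hT.iterate n).measurable.comap_le

lemma comap_le_borel (hT : MeasurePreserving T μ μ) (hm : m ≤ mX) : m.comap T ≤ mX :=
  comap_iterate_le_borel hT hm 1

lemma ent_nonneg (hT : MeasurePreserving T μ μ) (hξ : sig ξ ≤ mX) : 0 ≤ ent μ T ξ :=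
  cEnt_nonneg (comap_le_borel hT (fut_le_borel hT hξ)) hξ

lemma cEnt_itin_succ (hT : MeasurePreserving T μ μ) (hm : m ≤ mX) (hξ : sig ξ ≤ mX) (n : ℕ) :
    cEnt m μ (itin T ξ (n + 1)) =
      cEnt m μ (itin T ξ n ∘ T) + cEnt (m ⊔ sig (itin T ξ n ∘ T)) μ ξ := by
  refine cEnt_chain hm hξ ?_ (sig_itin_succ ξ n)
  rw [sig_comp]
  exact comap_le_borel hT (sig_itin_le hT hξ n)

lemma cEnt_bot_itin (hT : MeasurePreserving T μ μ) (hξ : sig ξ ≤ mX) (n : ℕ) :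
    cEnt ⊥ μ (itin T ξ n) = ∑ j ∈ Finset.range n, cEnt (sig (itin T ξ j ∘ T)) μ ξ := by
  induction n with
  | zero =>
    rw [Finset.sum_range_zero]
    exact cEnt_eq_zero_of_le bot_le (sig_itin_le_iff.2 fun i hi => absurd hi i.not_lt_zero)
  | succ n ih =>
    rw [Finset.sum_range_succ, ← ih, cEnt_itin_succ hT bot_le hξ, bot_sup_eq]
    congr 1
    have := cEnt_comp (μ := μ) hT bot_le (sig_itin_le hT hξ n)
    rwa [MeasurableSpace.comap_bot] at this

lemma tendsto_cEnt_itin_comp (hT : MeasurePreserving T μ μ) (hξ : sig ξ ≤ mX) :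
    Tendsto (fun n => cEnt (sig (itin T ξ n ∘ T)) μ ξ) atTop (𝓝 (ent μ T ξ)) := by
  have hmono : Monotone fun n => sig (itin T ξ n ∘ T) := fun a b hab => by
    simp only [sig_comp]
    exact MeasurableSpace.comap_mono (sig_itin_mono ξ hab)
  have hle : ∀ n, sig (itin T ξ n ∘ T) ≤ mX := fun n => by
    rw [sig_comp]; exact comap_le_borel hT (sig_itin_le hT hξ n)
  have := cEnt_tendsto (μ := μ) hmono hle hξ
  have h2 : ⨆ n, sig (itin T ξ n ∘ T) = (fut T ξ).comap T := by
    simp only [sig_comp]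
    rw [← MeasurableSpace.comap_iSup, iSup_sig_itin]
  rwa [h2] at this

lemma mul_ent_le (hT : MeasurePreserving T μ μ) (hξ : sig ξ ≤ mX) (n : ℕ) :
    n * ent μ T ξ ≤ cEnt ⊥ μ (itin T ξ n) := by
  rw [cEnt_bot_itin hT hξ]
  have : ∀ j ∈ Finset.range n, ent μ T ξ ≤ cEnt (sig (itin T ξ j ∘ T)) μ ξ := fun j _ => by
    refine cEnt_anti ?_ (comap_le_borel hT (fut_le_borel hT hξ)) hξ
    rw [sig_comp, ← iSup_sig_itin]
    exact MeasurableSpace.comap_mono (le_iSup (fun n => sig (itin T ξ n)) j)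
  simpa using Finset.card_nsmul_le_sum _ _ _ this

lemma tendsto_cEnt_bot_itin (hT : MeasurePreserving T μ μ) (hξ : sig ξ ≤ mX) :
    Tendsto (fun n : ℕ => cEnt ⊥ μ (itin T ξ n) / n) atTop (𝓝 (ent μ T ξ)) := by
  refine (tendsto_cEnt_itin_comp hT hξ).cesaro.congr fun n => ?_
  rw [cEnt_bot_itin hT hξ, div_eq_inv_mul]

lemma ent_le_of_le_cEnt (hT : MeasurePreserving T μ μ) (hξ : sig ξ ≤ mX) {c : ℝ} {C : ℝ}
    (h : ∀ n : ℕ, n * c - C ≤ cEnt ⊥ μ (itin T ξ n)) : c ≤ ent μ T ξ := by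
  have h1 : Tendsto (fun n : ℕ => c - C / n) atTop (𝓝 (c - 0)) :=
    tendsto_const_nhds.sub (tendsto_const_div_atTop_nhds_zero_nat C)
  rw [sub_zero] at h1
  refine le_of_tendsto_of_tendsto h1 (tendsto_cEnt_bot_itin hT hξ) ?_
  filter_upwards [eventually_gt_atTop 0] with n hn
  have hn' : (0 : ℝ) < n := Nat.cast_pos.2 hn
  rw [le_div_iff₀ hn', sub_mul, div_mul_cancel₀ _ hn'.ne', mul_comm]
  exact h n

lemma cEnt_comap_itin (hT : MeasurePreserving T μ μ) (hm : m ≤ mX) (hξ : sig ξ ≤ mX) (n : ℕ) :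
    cEnt (m.comap T^[n]) μ (itin T ξ n) =
      ∑ j ∈ Finset.range n, cEnt (m.comap T^[j + 1] ⊔ sig (itin T ξ j ∘ T)) μ ξ := by
  induction n with
  | zero =>
    rw [Finset.sum_range_zero]
    exact cEnt_eq_zero_of_le (comap_iterate_le_borel hT hm 0)
      (sig_itin_le_iff.2 fun i hi => absurd hi i.not_lt_zero)
  | succ n ih =>
    rw [Finset.sum_range_succ, ← ih, cEnt_itin_succ hT (comap_iterate_le_borel hT hm _) hξ]
    congr 1
    rw [Function.iterate_succ, ← MeasurableSpace.comap_comp]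
    exact cEnt_comp hT (comap_iterate_le_borel hT hm n) (sig_itin_le hT hξ n)

lemma sum_lower_bound (hT : MeasurePreserving T μ μ) (hξ : sig ξ ≤ mX) (hζ : sig ζ ≤ mX) (n : ℕ) :
    n * ent μ T (fun x => (ξ x, ζ x)) - cEnt ⊥ μ (itin T (fun x => (ξ x, ζ x)) n) +
      n * ent μ T ξ ≤
    ∑ j ∈ Finset.range n, cEnt ((fut T ξ).comap T ⊔ (fut T ζ).comap T^[j + 1]) μ ξ := by
  set χ := fun x => (ξ x, ζ x)
  have hχ : sig χ ≤ mX := (sig_prod ξ ζ).le.trans (sup_le hξ hζ)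
  have hC := fut_le_borel hT hχ
  have h1 : cEnt ((fut T χ).comap T^[n]) μ (itin T χ n) = n * ent μ T χ := by
    rw [cEnt_comap_itin hT hC hχ, Finset.sum_congr rfl fun j _ => by rw [comap_fut_sup_itin]]
    simp [ent]
  have h2 : cEnt ((fut T χ).comap T^[n]) μ (itin T ξ n) =
      ∑ j ∈ Finset.range n, cEnt ((fut T ξ).comap T ⊔ (fut T ζ).comap T^[j + 1]) μ ξ := by
    rw [cEnt_comap_itin hT hC hξ]
    refine Finset.sum_congr rfl fun j _ => ?_
    rw [fut_prod, MeasurableSpace.comap_sup, sup_right_comm,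
      comap_fut_sup_itin]
  have hCn := comap_iterate_le_borel hT hC n
  have hs : sig (itin T χ n) = sig (itin T ζ n) ⊔ sig (itin T ξ n) := by
    rw [sig_itin_prod, sup_comm]
  have h3 := cEnt_chain (μ := μ) hCn (sig_itin_le hT hζ n) (sig_itin_le hT hξ n) hs
  have h4 := cEnt_chain (μ := μ) bot_le (sig_itin_le hT hζ n) (sig_itin_le hT hξ n) hs
  have h5 := cEnt_anti (μ := μ)
    (sup_le_sup_right (bot_le (a := (fut T χ).comap T^[n])) (sig (itin T ξ n)))
    (sup_le hCn (sig_itin_le hT hξ n)) (sig_itin_le hT hζ n)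
  have h6 := mul_ent_le hT hξ n
  linarith

/-- Conditioning on the remote future of a second partition costs little entropy. -/
lemma exists_ent_lt_cEnt (hT : MeasurePreserving T μ μ) (hξ : sig ξ ≤ mX) (hζ : sig ζ ≤ mX)
    {ε : ℝ} (hε : 0 < ε) : ∃ j : ℕ, ∀ i ≥ j,
      ent μ T ξ - ε < cEnt ((fut T ξ).comap T ⊔ (fut T ζ).comap T^[i + 1]) μ ξ := by
  have hle : ∀ i, (fut T ξ).comap T ⊔ (fut T ζ).comap T^[i] ≤ mX := fun i =>
    sup_le (comap_le_borel hT (fut_le_borel hT hξ))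
      (comap_iterate_le_borel hT (fut_le_borel hT hζ) _)
  suffices h : ∃ j : ℕ,
      ent μ T ξ - ε < cEnt ((fut T ξ).comap T ⊔ (fut T ζ).comap T^[j + 1]) μ ξ by
    obtain ⟨j, hj⟩ := h
    refine ⟨j, fun i hi => hj.trans_le (cEnt_anti (sup_le_sup_left ?_ _) (hle _) hξ)⟩
    obtain ⟨k, rfl⟩ := Nat.exists_eq_add_of_le' hi
    rw [add_assoc, Function.iterate_add, ← MeasurableSpace.comap_comp]
    exact MeasurableSpace.comap_mono (comap_iterate_le (comap_fut_le ζ) k)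
  by_contra! hcon
  have hχ : sig (fun x => (ξ x, ζ x)) ≤ mX := (sig_prod ξ ζ).le.trans (sup_le hξ hζ)
  have h1 : ent μ T (fun x => (ξ x, ζ x)) + ε ≤ ent μ T (fun x => (ξ x, ζ x)) := by
    refine ent_le_of_le_cEnt hT hχ (C := 0) fun n => ?_
    have h2 := sum_lower_bound hT hξ hζ n
    have h3 := Finset.sum_le_card_nsmul (Finset.range n) _ _ fun j _ => hcon j
    rw [Finset.card_range, nsmul_eq_mul] at h3
    linarith
  linarith

lemma ent_prod_le (hT : MeasurePreserving T μ μ) (hξ : sig ξ ≤ mX) (hζ : sig ζ ≤ mX) :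
    ent μ T (fun x => (ξ x, ζ x)) ≤ ent μ T ξ + cEnt (fut T ξ) μ ζ := by
  have hm : (fut T (fun x => (ξ x, ζ x))).comap T ≤ mX :=
    comap_le_borel hT (fut_le_borel hT ((sig_prod ξ ζ).le.trans (sup_le hξ hζ)))
  have hle : fut T ξ ≤ fut T (fun x => (ξ x, ζ x)) := by rw [fut_prod]; exact le_sup_left
  rw [ent, cEnt_chain hm hζ hξ ((sig_prod ξ ζ).trans (sup_comm _ _))]
  refine add_le_add (cEnt_anti (MeasurableSpace.comap_mono hle) hm hξ)
    (cEnt_anti ?_ (sup_le hm hξ) hζ)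
  rw [fut_eq_sup ξ, sup_comm]
  exact sup_le_sup_right (MeasurableSpace.comap_mono hle) _

lemma ent_mono (hT : MeasurePreserving T μ μ) (hζ : sig ζ ≤ mX) (h : sig ξ ≤ sig ζ) :
    ent μ T ξ ≤ ent μ T ζ := by
  have hξ := h.trans hζ
  refine le_of_tendsto_of_tendsto' (tendsto_cEnt_bot_itin hT hξ) (tendsto_cEnt_bot_itin hT hζ)
    fun n => ?_
  gcongr
  refine cEnt_mono_sig bot_le (sig_itin_le hT hξ n) (sig_itin_le hT hζ n) ?_
  rw [bot_sup_eq]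
  refine sig_itin_le_iff.2 fun i hi => ?_
  rw [sig_comp]
  refine (MeasurableSpace.comap_mono h).trans ?_
  rw [← sig_comp]
  exact sig_itin_le_iff.1 le_rfl i hi

lemma ent_comp_iterate (hT : MeasurePreserving T μ μ) (hξ : sig ξ ≤ mX) (n : ℕ) :
    ent μ T (ξ ∘ T^[n]) = ent μ T ξ := by
  rw [ent, fut_comp_iterate, MeasurableSpace.comap_comp, ← Function.iterate_succ,
    Function.iterate_succ', ← MeasurableSpace.comap_comp]
  exact cEnt_comp (hT.iterate n) (comap_le_borel hT (fut_le_borel hT hξ)) hξ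

end Entropy

section Tail

/-- The remote σ-algebra `⋂ T⁻ⁿ m`. -/
@[reducible] def tail (T : X → X) (m : MeasurableSpace X) : MeasurableSpace X := ⨅ n : ℕ, m.comap T^[n]

variable {m : MeasurableSpace X}

lemma tail_le_comap (T : X → X) (n : ℕ) : tail T m ≤ m.comap T^[n] :=
  iInf_le (fun n : ℕ => m.comap T^[n]) n

lemma tail_le (T : X → X) : tail T m ≤ m := by
  simpa using tail_le_comap (m := m) T 0

lemma comap_tail_le {T : X → X} (h : m.comap T ≤ m) : (tail T m).comap T ≤ tail T m := by
  refine le_iInf fun n => ?_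
  refine (MeasurableSpace.comap_mono (tail_le_comap T n)).trans ?_
  rw [MeasurableSpace.comap_comp, ← Function.iterate_succ, Function.iterate_succ',
    ← MeasurableSpace.comap_comp]
  exact MeasurableSpace.comap_mono h

lemma comap_tail [MeasurableSpace X] {T : X ≃ᵐ X} (h : m.comap T ≤ m) :
    (tail T m).comap T = tail T m := by
  refine le_antisymm (comap_tail_le h) fun s hs => ?_
  refine ⟨T.symm ⁻¹' s, ?_, by ext; simp⟩
  rw [MeasurableSpace.measurableSet_iInf] at hs ⊢
  intro n
  obtain ⟨u, hu, rfl⟩ := hs (n + 1)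
  exact ⟨u, hu, by ext; simp⟩

lemma comap_symm_tail [MeasurableSpace X] {T : X ≃ᵐ X} (h : m.comap T ≤ m) :
    (tail T m).comap T.symm = tail T m := by
  conv_lhs => rw [← comap_tail h, MeasurableSpace.comap_comp]
  simp

/-- Sets recursively a sequence of numbers. -/
def recSeq (F : ∀ p : ℕ, (Fin p → ℕ) → ℕ) (p : ℕ) : ℕ := F p fun i => recSeq F i
termination_by p
decreasing_by exact i.2

lemma exists_recSeq {R : ∀ p : ℕ, (Fin p → ℕ) → ℕ → Prop} (h : ∀ p v, ∃ j, R p v j) :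
    ∃ k : ℕ → ℕ, ∀ p, R p (fun i => k i) (k p) := by
  choose F hF using h
  refine ⟨recSeq F, fun p => ?_⟩
  rw [recSeq.eq_1 F p]
  exact hF p _

end Tail

section RokhlinSinai

set_option linter.unusedSectionVars false

variable {m : MeasurableSpace X} [mX : MeasurableSpace X] {μ : Measure X} [IsProbabilityMeasure μ]
  {ι κ : Type*} [Fintype ι] [Fintype κ] {T : X ≃ᵐ X} {ξ : X → ι} {ζ : X → κ}

lemma fut_eq_sup_of_sig {θ : Type*} {T : X → X} {χ : X → θ} (h : sig χ = sig ξ ⊔ sig ζ) :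
    fut T χ = fut T ξ ⊔ fut T ζ := by
  rw [fut, fut, fut, ← iSup_sup_eq]
  refine iSup_congr fun i => ?_
  rw [sig_comp, h, MeasurableSpace.comap_sup, sig_comp, sig_comp]

lemma cEnt_sup_sig_eq (hm : m ≤ mX) (hξ : sig ξ ≤ mX) (hζ : sig ζ ≤ mX) (h : cEnt m μ ξ = 0) :
    cEnt (m ⊔ sig ξ) μ ζ = cEnt m μ ζ := by
  have h1 : cEnt (m ⊔ sig ζ) μ ξ = 0 :=
    le_antisymm ((cEnt_anti le_sup_left (sup_le hm hζ) hξ).trans h.le)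
      (cEnt_nonneg (sup_le hm hζ) hξ)
  have h2 := cEnt_prod (μ := μ) hm hζ hξ
  have h3 := cEnt_prod (μ := μ) hm hξ hζ
  rw [cEnt_prod_comm] at h3
  linarith

/-- Partitions of zero entropy do not distinguish the past of `ζ` from its past and present. -/
lemma cEnt_comap_fut_eq {T : X → X} (hT : MeasurePreserving T μ μ) (hξ : sig ξ ≤ mX)
    (hζ : sig ζ ≤ mX) (h0 : ent μ T ξ = 0) :
    cEnt ((fut T ζ).comap T) μ ξ = cEnt (fut T ζ) μ ξ := by
  have hfζ := fut_le_borel hT hζ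
  have hfξ := fut_le_borel hT hξ
  have hm := comap_le_borel hT hfζ
  have h1 := cEnt_prod (μ := μ) hm hξ hζ
  have h2 := cEnt_prod (μ := μ) hm hζ hξ
  rw [sup_comm _ (sig ζ), ← fut_eq_sup] at h1
  rw [cEnt_prod_comm] at h2
  have h3 : cEnt ((fut T ζ).comap T ⊔ fut T ξ) μ ζ ≤ cEnt ((fut T ζ).comap T ⊔ sig ξ) μ ζ :=
    cEnt_anti (sup_le_sup_left (sig_le_fut ξ) _) (sup_le hm hfξ) hζ
  have h4 : ent μ T ζ ≤ cEnt ((fut T ζ).comap T ⊔ fut T ξ) μ ζ := by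
    refine le_of_forall_pos_lt_add fun ε hε => ?_
    obtain ⟨j, hj⟩ := exists_ent_lt_cEnt hT hζ hξ hε
    have hj := hj j le_rfl
    have hm'X : (fut T ζ).comap T ⊔ (fut T ξ).comap T^[j + 1] ≤ mX :=
      sup_le hm (comap_iterate_le_borel hT hfξ _)
    have hi := sig_itin_le hT hξ (j + 1)
    have h5 : cEnt ((fut T ξ).comap T^[j + 1]) μ (itin T ξ (j + 1)) = 0 := by
      rw [cEnt_comap_itin hT hfξ hξ, Finset.sum_congr rfl fun j _ => by rw [comap_fut_sup_itin]]
      simpa [ent] using Or.inr h0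
    have h6 : cEnt ((fut T ζ).comap T ⊔ (fut T ξ).comap T^[j + 1]) μ (itin T ξ (j + 1)) = 0 :=
      le_antisymm ((cEnt_anti le_sup_right hm'X hi).trans h5.le) (cEnt_nonneg hm'X hi)
    have h7 := cEnt_sup_sig_eq hm'X hi hζ h6
    rw [sup_assoc, sup_comm _ (sig _), ← fut_eq_itin_sup] at h7
    linarith
  have h5 : cEnt ((fut T ζ).comap T ⊔ sig ξ) μ ζ ≤ ent μ T ζ :=
    cEnt_anti le_sup_left (sup_le hm hξ) hζ
  have h6 : ent μ T ζ = cEnt ((fut T ζ).comap T) μ ζ := rfl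
  linarith

lemma comap_symm_fut (T : X ≃ᵐ X) (ξ : X → ι) (n : ℕ) :
    (fut T ξ).comap T.symm^[n] = fut T (ξ ∘ T.symm^[n]) := by
  rw [fut, fut, MeasurableSpace.comap_iSup]
  refine iSup_congr fun i => ?_
  rw [← sig_comp]
  have hc : Function.Commute (T : X → X) T.symm := fun x => by simp
  have := (hc.iterate_iterate i n).comp_eq
  rw [Function.comp_assoc, this, ← Function.comp_assoc]

lemma cEnt_comap_iterate_fut_eq (hT : MeasurePreserving T μ μ) (hξ : sig ξ ≤ mX)
    (hζ : sig ζ ≤ mX) (h0 : ent μ T ξ = 0) (n : ℕ) :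
    cEnt ((fut T ζ).comap T^[n]) μ ξ = cEnt (fut T ζ) μ ξ := by
  induction n with
  | zero => simp
  | succ n ih =>
    have h := cEnt_comap_fut_eq hT hξ (sig_comp_iterate_le hT hζ n) h0
    rw [fut_comp_iterate, MeasurableSpace.comap_comp, ← Function.iterate_succ] at h
    rw [h, ih]

lemma cEnt_comap_symm_iterate_fut_eq (hT : MeasurePreserving T μ μ) (hξ : sig ξ ≤ mX)
    (hζ : sig ζ ≤ mX) (h0 : ent μ T ξ = 0) (n : ℕ) :
    cEnt ((fut T ζ).comap T.symm^[n]) μ ξ = cEnt (fut T ζ) μ ξ := by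
  have h := cEnt_comap_iterate_fut_eq hT hξ
    (sig_comp_iterate_le (hT.symm T) hζ n) h0 n
  rw [← comap_symm_fut, MeasurableSpace.comap_comp] at h
  have h2 : (T.symm : X → X)^[n] ∘ (T : X → X)^[n] = id := by
    have : Function.LeftInverse T.symm T := T.symm_apply_apply
    exact (this.iterate n).comp_eq_id
  rw [← h, h2, MeasurableSpace.comap_id]

end RokhlinSinai

section RokhlinSinai

set_option linter.unusedSectionVars false

variable {m : MeasurableSpace X} [mX : MeasurableSpace X] {μ : Measure X} [IsProbabilityMeasure μ]
  {ι κ : Type*} [Fintype ι] [Fintype κ] {T : X ≃ᵐ X} {ξ : X → ι} {ζ : X → κ}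

/-- The join of the first `p` partitions, the `i`-th being observed at time `k i`. -/
def delayed (T : X → X) (α : ℕ → X → ι) (k : ℕ → ℕ) (p : ℕ) : X → Fin p → ι :=
  tup (fun i => α i ∘ T^[k i]) p

/-- The delays `k` are so long that the later partitions cost little conditional entropy. -/
def GoodDelays (μ : Measure X) (T : X → X) (α : ℕ → X → ι) (k : ℕ → ℕ) : Prop :=
  ∀ p, ent μ T (delayed T α k p) - (1 / 2) ^ p <
    cEnt ((fut T (delayed T α k (p + 1))).comap T) μ (delayed T α k p)

lemma sig_delayed_le {T : X → X} (hT : MeasurePreserving T μ μ) {α : ℕ → X → ι}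
    (hα : ∀ p, sig (α p) ≤ mX) (k : ℕ → ℕ) (p : ℕ) : sig (delayed T α k p) ≤ mX :=
  sig_tup_le_iff.2 fun i _ => sig_comp_iterate_le hT (hα i) (k i)

lemma fut_delayed_succ (T : X → X) (α : ℕ → X → ι) (k : ℕ → ℕ) (p : ℕ) :
    fut T (delayed T α k (p + 1)) = (fut T (α p)).comap T^[k p] ⊔ fut T (delayed T α k p) := by
  rw [fut_eq_sup_of_sig (χ := delayed T α k (p + 1)) (ξ := α p ∘ T^[k p]) (ζ := delayed T α k p)
    (sig_tup_succ _ p), fut_comp_iterate]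

lemma exists_goodDelays {T : X → X} (hT : MeasurePreserving T μ μ) {α : ℕ → X → ι}
    (hα : ∀ p, sig (α p) ≤ mX) : ∃ k : ℕ → ℕ, GoodDelays μ T α k := by
  obtain ⟨k, hk⟩ := exists_recSeq (R := fun p v j =>
      ent μ T (fun (x : X) (i : Fin p) => α i (T^[v i] x)) - (1 / 2) ^ p <
        cEnt ((fut T (fun (x : X) (i : Fin p) => α i (T^[v i] x))).comap T ⊔
          (fut T (α p)).comap T^[j + 1]) μ (fun (x : X) (i : Fin p) => α i (T^[v i] x))) (by
    intro p v
    have hv : sig (fun (x : X) (i : Fin p) => α i (T^[v i] x)) ≤ mX := by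
      rw [sig_le_iff_singleton]
      intro a
      have : (fun (x : X) (i : Fin p) => α i (T^[v i] x)) ⁻¹' {a} =
          ⋂ i : Fin p, (α i ∘ T^[v i]) ⁻¹' {a i} := by
        ext x; simp [funext_iff]
      rw [this]
      exact MeasurableSet.iInter fun i =>
        sig_le_iff_singleton.1 (sig_comp_iterate_le hT (hα i) (v i)) _
    obtain ⟨j, hj⟩ := exists_ent_lt_cEnt (μ := μ) hT hv (hα p)
      (ε := (1 / 2) ^ p) (by positivity)
    exact ⟨j, hj j le_rfl⟩)
  refine ⟨k, fun p => ?_⟩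
  have := hk p
  rw [fut_delayed_succ, MeasurableSpace.comap_sup, sup_comm, MeasurableSpace.comap_comp,
    ← Function.iterate_succ]
  exact this

/-- The σ-algebra generated by the futures of all the delayed partitions. -/
@[reducible] def rsAlg (T : X → X) (α : ℕ → X → ι) (k : ℕ → ℕ) : MeasurableSpace X :=
  ⨆ p, fut T (delayed T α k p)

variable {α : ℕ → X → ι} {k : ℕ → ℕ}

lemma fut_delayed_mono (T : X → X) (α : ℕ → X → ι) (k : ℕ → ℕ) :
    Monotone fun p => fut T (delayed T α k p) :=
  monotone_nat_of_le_succ fun p => by rw [fut_delayed_succ]; exact le_sup_right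

lemma comap_rsAlg (T : X → X) (α : ℕ → X → ι) (k : ℕ → ℕ) (g : X → X) :
    (rsAlg T α k).comap g = ⨆ p, (fut T (delayed T α k p)).comap g := by
  rw [rsAlg, MeasurableSpace.comap_iSup]

lemma comap_rsAlg_le (T : X → X) (α : ℕ → X → ι) (k : ℕ → ℕ) :
    (rsAlg T α k).comap T ≤ rsAlg T α k := by
  rw [comap_rsAlg]
  exact iSup_mono fun p => comap_fut_le _

lemma rsAlg_le {T : X → X} (hT : MeasurePreserving T μ μ) (hα : ∀ p, sig (α p) ≤ mX) :
    rsAlg T α k ≤ mX :=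
  iSup_le fun p => fut_le_borel hT (sig_delayed_le hT hα k p)

lemma sig_comp_iterate_le_fut_delayed (T : X → X) (α : ℕ → X → ι) (k : ℕ → ℕ) (p i : ℕ)
    (hi : k p ≤ i) : sig (α p ∘ T^[i]) ≤ fut T (delayed T α k (p + 1)) := by
  obtain ⟨j, rfl⟩ := Nat.exists_eq_add_of_le hi
  rw [fut_delayed_succ]
  refine le_trans ?_ le_sup_left
  rw [comap_fut, add_comm]
  exact le_iSup (fun i : ℕ => sig (α p ∘ T^[i + k p])) j

lemma sig_comp_iterate_le_rsAlg (T : X → X) (α : ℕ → X → ι) (k : ℕ → ℕ) (p i : ℕ)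
    (hi : k p ≤ i) : sig (α p ∘ T^[i]) ≤ rsAlg T α k :=
  (sig_comp_iterate_le_fut_delayed T α k p i hi).trans
    (le_iSup (fun p => fut T (delayed T α k p)) (p + 1))

lemma GoodDelays.le_cEnt {T : X → X} (hk : GoodDelays μ T α k) (hT : MeasurePreserving T μ μ)
    (hα : ∀ p, sig (α p) ≤ mX) (q : ℕ) :
    ent μ T (delayed T α k q) - 2 * (1 / 2) ^ q ≤
      cEnt ((rsAlg T α k).comap T) μ (delayed T α k q) := by
  have hle : ∀ p, (fut T (delayed T α k p)).comap T ≤ mX := fun p =>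
    comap_le_borel hT (fut_le_borel hT (sig_delayed_le hT hα k p))
  have hY := sig_delayed_le hT hα k
  have hmono : Monotone fun p => (fut T (delayed T α k p)).comap T := fun a b hab =>
    MeasurableSpace.comap_mono (fut_delayed_mono T α k hab)
  have hstep : ∀ r : ℕ, ent μ T (delayed T α k q) - 2 * (1 / 2) ^ q + 2 * (1 / 2) ^ (q + r) ≤
      cEnt ((fut T (delayed T α k (q + r))).comap T) μ (delayed T α k q) := by
    intro r
    induction r with
    | zero => simp [ent]
    | succ r ih =>
      have h1 := cEnt_sub_le_sub (μ := μ) (hmono (Nat.le_succ (q + r))) (hle _)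
        (ξ := delayed T α k q) (hY (q + r)) (sig_tup_le_iff.2 fun i hi =>
          sig_tup_le_iff (ξ := fun i => α i ∘ T^[k i]).1 le_rfl i (hi.trans_le (Nat.le_add_right q r)))
      have h2 := hk (q + r)
      rw [ent] at h2
      rw [← add_assoc, pow_succ (1 / 2 : ℝ) (q + r)]
      simp only [Nat.succ_eq_add_one] at h1
      linarith
  have hlim := cEnt_tendsto (μ := μ) hmono hle (hY q)
  rw [← comap_rsAlg] at hlim
  refine ge_of_tendsto hlim ?_
  filter_upwards [eventually_ge_atTop q] with p hp
  obtain ⟨r, rfl⟩ := Nat.exists_eq_add_of_le hp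
  have := hstep r
  have : (0 : ℝ) ≤ 2 * (1 / 2) ^ (q + r) := by positivity
  linarith

lemma comap_symm_delayed_mono (T : X ≃ᵐ X) (α : ℕ → X → ι) (k : ℕ → ℕ) :
    Monotone fun q => (fut T (delayed T α k q)).comap T.symm^[q] := by
  refine monotone_nat_of_le_succ fun q => ?_
  refine (MeasurableSpace.comap_mono (fut_delayed_mono T α k (Nat.le_succ q))).trans ?_
  rw [Function.iterate_succ', ← MeasurableSpace.comap_comp]
  refine MeasurableSpace.comap_mono ?_
  have h := MeasurableSpace.comap_mono (g := T.symm) (comap_fut_le (T := T) (delayed T α k (q + 1)))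
  rw [MeasurableSpace.comap_comp] at h
  simpa using h

lemma le_iSup_comap_symm_delayed (T : X ≃ᵐ X) (α : ℕ → X → ι) (k : ℕ → ℕ) :
    ⨆ p, sig (α p) ≤ ⨆ q, (fut T (delayed T α k q)).comap T.symm^[q] := by
  refine iSup_le fun p => ?_
  set q := max (p + 1) (k p) with hq
  have h1 : sig (α p ∘ T^[q]) ≤ fut T (delayed T α k q) :=
    (sig_comp_iterate_le_fut_delayed T α k p q (le_max_right _ _)).trans
      (fut_delayed_mono T α k (le_max_left _ _))
  have h2 : (α p ∘ T^[q]) ∘ T.symm^[q] = α p := by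
    have : Function.RightInverse T.symm T := T.apply_symm_apply
    rw [Function.comp_assoc, (this.iterate q).comp_eq_id, Function.comp_id]
  refine le_trans ?_ (le_iSup (fun q => (fut T (delayed T α k q)).comap T.symm^[q]) q)
  conv_lhs => rw [← h2]
  rw [sig_comp]
  exact MeasurableSpace.comap_mono h1

lemma tendsto_cEnt_comap_symm_delayed (hT : MeasurePreserving T μ μ) (hα : ∀ p, sig (α p) ≤ mX)
    (hgen : mX ≤ ⨆ p, sig (α p)) (hζ : sig ζ ≤ mX) :
    Tendsto (fun q => cEnt ((fut T (delayed T α k q)).comap T.symm^[q]) μ ζ) atTop (𝓝 0) := by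
  have hle : ∀ q, (fut T (delayed T α k q)).comap T.symm^[q] ≤ mX := fun q =>
    comap_iterate_le_borel (hT.symm T) (fut_le_borel hT (sig_delayed_le hT hα k q)) q
  have h := cEnt_tendsto (μ := μ) (comap_symm_delayed_mono T α k) hle hζ
  rwa [cEnt_eq_zero_of_le (iSup_le hle)
    (hζ.trans (hgen.trans (le_iSup_comap_symm_delayed T α k)))] at h

lemma iSup_comap_symm_rsAlg (hT : MeasurePreserving T μ μ) (hα : ∀ p, sig (α p) ≤ mX)
    (hgen : mX ≤ ⨆ p, sig (α p)) : ⨆ n, (rsAlg T α k).comap T.symm^[n] = mX := by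
  apply le_antisymm
  · exact iSup_le fun n => comap_iterate_le_borel (hT.symm T) (rsAlg_le hT hα) n
  · refine hgen.trans ((le_iSup_comap_symm_delayed T α k).trans (iSup_mono fun q => ?_))
    exact MeasurableSpace.comap_mono (le_iSup (fun p => fut T (delayed T α k p)) q)

lemma cEnt_comp_symm_shift (hT : MeasurePreserving T μ μ) (hm : m ≤ mX) (hξ : sig ξ ≤ mX) (n : ℕ) :
    cEnt m μ (ξ ∘ T^[n]) = cEnt (m.comap T.symm^[n]) μ ξ := by
  have h := cEnt_comp (μ := μ) ((hT.symm T).iterate n) hm (sig_comp_iterate_le hT hξ n)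
  have h2 : (ξ ∘ T^[n]) ∘ T.symm^[n] = ξ := by
    have : Function.RightInverse T.symm T := T.apply_symm_apply
    rw [Function.comp_assoc, (this.iterate n).comp_eq_id, Function.comp_id]
  rw [← h, h2]

lemma exists_ent_lt_delayed (hT : MeasurePreserving T μ μ) (hα : ∀ p, sig (α p) ≤ mX)
    (hgen : mX ≤ ⨆ p, sig (α p)) (hζ : sig ζ ≤ mX) {ε : ℝ} (hε : 0 < ε) :
    ∀ᶠ q in atTop, ent μ T ζ < ent μ T (delayed T α k q) + ε := by
  filter_upwards [(tendsto_cEnt_comap_symm_delayed (k := k) hT hα hgen hζ).eventually_lt_const hε]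
    with q hq
  have hY := sig_delayed_le hT hα k q
  have hζq := sig_comp_iterate_le hT hζ q
  rw [← cEnt_comp_symm_shift hT (fut_le_borel hT hY) hζ] at hq
  have h1 := ent_prod_le hT hY hζq
  have h2 : ent μ T (ζ ∘ T^[q]) ≤ ent μ T (fun x => (delayed T α k q x, (ζ ∘ T^[q]) x)) := by
    refine ent_mono hT ((sig_prod _ _).le.trans (sup_le hY hζq)) ?_
    rw [sig_prod]
    exact le_sup_right
  rw [ent_comp_iterate hT hζ] at h2
  linarith

lemma mul_cEnt_le_cEnt_tail (hT : MeasurePreserving T μ μ) (hm : m ≤ mX) (hm' : m.comap T ≤ m)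
    (hξ : sig ξ ≤ mX) (hξm : sig ξ ≤ m) (n : ℕ) :
    n * cEnt (m.comap T) μ ξ ≤ cEnt (tail T m) μ (itin T ξ n) := by
  have hG : tail T m ≤ mX := (tail_le T).trans hm
  induction n with
  | zero => simpa using cEnt_nonneg hG (sig_itin_le hT hξ 0)
  | succ n ih =>
    have h1 : cEnt (tail T m) μ (itin T ξ n ∘ T) = cEnt (tail T m) μ (itin T ξ n) := by
      rw [← cEnt_comp hT hG (sig_itin_le hT hξ n), comap_tail hm']
    rw [cEnt_itin_succ hT hG hξ, h1]
    have h2 : cEnt (m.comap T) μ ξ ≤ cEnt (tail T m ⊔ sig (itin T ξ n ∘ T)) μ ξ := by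
      refine cEnt_anti (sup_le (tail_le_comap T 1) ?_) (comap_le_borel hT hm) hξ
      rw [sig_comp]
      refine MeasurableSpace.comap_mono (sig_itin_le_iff.2 fun i _ => ?_)
      rw [sig_comp]
      exact (MeasurableSpace.comap_mono hξm).trans (comap_iterate_le hm' i)
    push_cast
    linarith

lemma GoodDelays.mul_le_cEnt_tail (hk : GoodDelays μ T α k) (hT : MeasurePreserving T μ μ)
    (hα : ∀ p, sig (α p) ≤ mX) (q n : ℕ) :
    n * (ent μ T (delayed T α k q) - 2 * (1 / 2) ^ q) ≤
      cEnt (tail T (rsAlg T α k)) μ (itin T (delayed T α k q) n) :=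
  (mul_le_mul_of_nonneg_left (hk.le_cEnt hT hα q) n.cast_nonneg).trans
    (mul_cEnt_le_cEnt_tail hT (rsAlg_le hT hα) (comap_rsAlg_le T α k) (sig_delayed_le hT hα k q)
      ((sig_le_fut _).trans (le_iSup (fun p => fut T (delayed T α k p)) q)) n)

lemma tendsto_two_mul_half_pow : Tendsto (fun q : ℕ => 2 * (1 / 2 : ℝ) ^ q) atTop (𝓝 0) := by
  simpa using (tendsto_pow_atTop_nhds_zero_of_lt_one (r := (1 / 2 : ℝ)) (by norm_num)
    (by norm_num)).const_mul 2

lemma GoodDelays.ent_eq_zero (hk : GoodDelays μ T α k) (hT : MeasurePreserving T μ μ)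
    (hα : ∀ p, sig (α p) ≤ mX) (hgen : mX ≤ ⨆ p, sig (α p))
    (hξ : sig ξ ≤ tail T (rsAlg T α k)) : ent μ T ξ = 0 := by
  have hG : tail T (rsAlg T α k) ≤ mX := (tail_le T).trans (rsAlg_le hT hα)
  have hξX := hξ.trans hG
  refine le_antisymm ?_ (ent_nonneg hT hξX)
  have hlim := tendsto_two_mul_half_pow.add
    (tendsto_cEnt_comap_symm_delayed (k := k) hT hα hgen hξX)
  rw [add_zero] at hlim
  refine ge_of_tendsto' hlim fun q => ?_
  have hY := sig_delayed_le hT hα k q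
  have hζX := sig_comp_iterate_le hT hξX q
  have hζG : ∀ i, sig ((ξ ∘ T^[q]) ∘ T^[i]) ≤ tail T (rsAlg T α k) := fun i => by
    rw [sig_comp, sig_comp]
    exact ((MeasurableSpace.comap_mono (MeasurableSpace.comap_mono hξ)).trans
      (MeasurableSpace.comap_mono (comap_iterate_le (comap_tail_le (comap_rsAlg_le T α k)) q))).trans
      (comap_iterate_le (comap_tail_le (comap_rsAlg_le T α k)) i)
  have hχ : sig (fun x => (delayed T α k q x, (ξ ∘ T^[q]) x)) ≤ mX :=
    (sig_prod _ _).le.trans (sup_le hY hζX)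
  have h1 : ent μ T ξ + (ent μ T (delayed T α k q) - 2 * (1 / 2) ^ q) ≤
      ent μ T (fun x => (delayed T α k q x, (ξ ∘ T^[q]) x)) := by
    refine ent_le_of_le_cEnt hT hχ (C := 0) fun n => ?_
    rw [cEnt_chain bot_le (sig_itin_le hT hY n) (sig_itin_le hT hζX n) (sig_itin_prod _ _ n)]
    have h2 := mul_ent_le hT hζX n
    rw [ent_comp_iterate hT hξX] at h2
    have h3 := hk.mul_le_cEnt_tail hT hα q n
    have h4 : cEnt (tail T (rsAlg T α k)) μ (itin T (delayed T α k q) n) ≤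
        cEnt (⊥ ⊔ sig (itin T (ξ ∘ T^[q]) n)) μ (itin T (delayed T α k q) n) :=
      cEnt_anti (sup_le bot_le (sig_itin_le_iff.2 fun i _ => hζG i)) hG (sig_itin_le hT hY n)
    linarith
  have h2 := ent_prod_le hT hY hζX
  rw [cEnt_comp_symm_shift hT (fut_le_borel hT hY) hξX] at h2
  linarith

lemma cEnt_comap_rsAlg_eq_zero (hT : MeasurePreserving T μ μ) (hα : ∀ p, sig (α p) ≤ mX)
    (hgen : mX ≤ ⨆ p, sig (α p)) (hξ : sig ξ ≤ mX) (h0 : ent μ T ξ = 0) (n : ℕ) :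
    cEnt ((rsAlg T α k).comap T^[n]) μ ξ = 0 := by
  have hle := comap_iterate_le_borel hT (rsAlg_le (k := k) hT hα) n
  refine le_antisymm ?_ (cEnt_nonneg hle hξ)
  refine ge_of_tendsto' (tendsto_cEnt_comap_symm_delayed (k := k) hT hα hgen hξ) fun q => ?_
  rw [cEnt_comap_symm_iterate_fut_eq hT hξ (sig_delayed_le hT hα k q) h0,
    ← cEnt_comap_iterate_fut_eq hT hξ (sig_delayed_le hT hα k q) h0 n]
  exact cEnt_anti (MeasurableSpace.comap_mono (le_iSup (fun p => fut T (delayed T α k p)) q)) hle hξ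

lemma sig_mem_le_iff {A : Set X} : sig (fun x => x ∈ A) ≤ m ↔ MeasurableSet[m] A := by
  rw [sig_le_iff_singleton]
  constructor
  · intro h
    have := h True
    rwa [show (fun x => x ∈ A) ⁻¹' {True} = A by ext; simp] at this
  · intro h a
    by_cases ha : a
    · rwa [show (fun x => x ∈ A) ⁻¹' {a} = A by ext; simp [ha]]
    · rw [show (fun x => x ∈ A) ⁻¹' {a} = Aᶜ by ext; simp [ha]]
      exact h.compl

/-- A set which is, up to null sets, in every `m.comap T^[n]` is so in the remote σ-algebra. -/
lemma exists_tail_ae_eq {T : X → X} (hm : m.comap T ≤ m) (hT : MeasurePreserving T μ μ)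
    (hmX : m ≤ mX) {A : Set X} (hA : MeasurableSet A)
    (h : ∀ n, cEnt (m.comap T^[n]) μ (fun x => x ∈ A) = 0) :
    ∃ A', MeasurableSet[tail T m] A' ∧ A =ᵐ[μ] A' := by
  have hs := fun n => condProb_eq_indicator_of_cEnt_eq_zero
    (comap_iterate_le_borel hT hmX n) (sig_mem_le_iff.2 hA) (h n) True
  rw [show (fun x => x ∈ A) ⁻¹' {True} = A by ext; simp] at hs
  let A' : ℕ → Set X := fun n => {x | (μ[A.indicator (fun _ => (1 : ℝ)) | m.comap T^[n]]) x = 1}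
  have hA' : ∀ n, MeasurableSet[m.comap T^[n]] (A' n) := fun n =>
    (stronglyMeasurable_condExp (m := m.comap T^[n])).measurable (measurableSet_singleton (1 : ℝ))
  have hanti : ∀ a b, m.comap T^[a + b] ≤ m.comap T^[b] := fun a b => by
    rw [Function.iterate_add, ← MeasurableSpace.comap_comp]
    exact MeasurableSpace.comap_mono (comap_iterate_le hm a)
  refine ⟨{x | ∀ N, ∃ n, x ∈ A' (n + N)}, ?_, ?_⟩
  · rw [MeasurableSpace.measurableSet_iInf]
    intro M
    have : {x | ∀ N, ∃ n, x ∈ A' (n + N)} = ⋂ N, ⋃ n, A' (n + N + M) := by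
      ext x
      simp only [mem_ofPred_eq, mem_iInter, mem_iUnion]
      constructor
      · intro hx N
        obtain ⟨n, hn⟩ := hx (N + M)
        exact ⟨n, by rwa [add_assoc]⟩
      · intro hx N
        obtain ⟨n, hn⟩ := hx N
        exact ⟨n + M, by rwa [add_right_comm]⟩
    rw [this]
    exact MeasurableSet.iInter fun N => MeasurableSet.iUnion fun n => hanti _ M _ (hA' _)
  · rw [eventuallyEq_set]
    filter_upwards [ae_all_iff.2 hs] with x hx
    have : ∀ n, x ∈ A' n ↔ x ∈ A := fun n => by
      show (_ = 1) ↔ _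
      rw [hx n]
      by_cases hxA : x ∈ A <;> simp [hxA]
    simp [this]

lemma ent_symm (hT : MeasurePreserving T μ μ) (hξ : sig ξ ≤ mX) : ent μ T.symm ξ = ent μ T ξ := by
  have hT' := hT.symm T
  refine tendsto_nhds_unique (tendsto_cEnt_bot_itin hT' hξ) ?_
  refine (tendsto_cEnt_bot_itin hT hξ).congr fun n => ?_
  congr 1
  rcases n with _ | n
  · rw [cEnt_bot_itin hT hξ, cEnt_bot_itin hT' hξ]
    simp
  have h1 := cEnt_comp (μ := μ) (hT.iterate n) bot_le (sig_itin_le hT' hξ (n + 1))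
  rw [MeasurableSpace.comap_bot] at h1
  rw [← h1]
  have hc : ∀ i ≤ n, (ξ ∘ T.symm^[i]) ∘ T^[n] = ξ ∘ T^[n - i] := by
    intro i hi
    obtain ⟨j, rfl⟩ := Nat.exists_eq_add_of_le hi
    have : Function.LeftInverse T.symm T := T.symm_apply_apply
    rw [Function.iterate_add, Function.comp_assoc, ← Function.comp_assoc (T.symm^[i]),
      (this.iterate i).comp_eq_id, Function.id_comp, Nat.add_sub_cancel_left]
  refine cEnt_congr_sig bot_le (sig_itin_le hT hξ _) (le_antisymm ?_ ?_)
  · refine sig_itin_le_iff.2 fun i hi => ?_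
    have := hc (n - i) (Nat.sub_le _ _)
    rw [Nat.sub_sub_self (Nat.le_of_lt_succ hi)] at this
    rw [← this, sig_comp, sig_comp _ T^[n]]
    refine MeasurableSpace.comap_mono ?_
    exact sig_itin_le_iff.1 le_rfl (n - i) (by omega)
  · refine sig_tup_le_iff (ξ := fun i => (ξ ∘ T.symm^[i]) ∘ T^[n]).2 fun i hi => ?_
    rw [hc i (Nat.le_of_lt_succ hi)]
    exact sig_itin_le_iff.1 le_rfl (n - i) (by omega)

end RokhlinSinai

section RokhlinSinaiTheorem

/-- A Rokhlin-Sinai σ-algebra: a decreasing generator whose remote σ-algebra is the Pinsker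
σ-algebra, such that the future of each set `U p` is eventually observed. -/
structure IsRokhlinSinai {𝒜 : MeasurableSpace X} [mX : MeasurableSpace X] (μ : Measure X)
    (T : X ≃ᵐ X) (U : ℕ → Set X) : Prop where
  le : 𝒜 ≤ mX
  comap_le : 𝒜.comap T ≤ 𝒜
  eventually_measurable : ∀ p, ∃ k, ∀ i ≥ k, MeasurableSet[𝒜] (T^[i] ⁻¹' U p)
  iSup_eq : ⨆ n, 𝒜.comap T.symm^[n] = mX
  exists_le_cEnt : ∀ c : ℝ, (c : EReal) < mEnt μ T → ∃ q, ∃ η : X → (Fin q → Prop),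
    sig η ≤ mX ∧ ∀ n : ℕ, n * c ≤ cEnt (tail T 𝒜) μ (itin T η n)
  ent_eq_zero : ∀ A, MeasurableSet[tail T 𝒜] A → ent μ T (fun x => x ∈ A) = 0
  exists_tail : ∀ A, MeasurableSet[mX] A → ent μ T (fun x => x ∈ A) = 0 →
    ∃ A', MeasurableSet[tail T 𝒜] A' ∧ A =ᵐ[μ] A'

variable [mX : MeasurableSpace X] {μ : Measure X} [IsProbabilityMeasure μ]

lemma exists_entPart_le_ent {T : X → X} (hT : MeasurePreserving T μ μ) {P : Finset (Set X)}
    (hP : IsFinPartition P) : ∃ ξ : X → Fin P.card, sig ξ ≤ mX ∧ entPart μ T P ≤ ent μ T ξ := by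
  obtain ⟨hmeas, hcov, hdisj⟩ := hP
  have hex : ∀ x, ∃ A : P, x ∈ (A : Set X) := fun x => by
    obtain ⟨A, hA, hx⟩ := hcov.ge (mem_univ x)
    exact ⟨⟨A, hA⟩, hx⟩
  choose ξ hξ using hex
  have hiff : ∀ x (A : P), ξ x = A ↔ x ∈ (A : Set X) := fun x A => by
    refine ⟨fun h => h ▸ hξ x, fun h => ?_⟩
    by_contra hne
    exact (hdisj (ξ x).2 A.2 fun h => hne (Subtype.ext h)).le_bot ⟨hξ x, h⟩
  have hsig : sig ξ ≤ mX := by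
    rw [sig_le_iff_singleton]
    intro A
    rw [show ξ ⁻¹' {A} = (A : Set X) by ext x; exact hiff x A]
    exact hmeas A A.2
  have he : sig (P.equivFin ∘ ξ) ≤ sig ξ := sig_comp_le ξ P.equivFin
  have he' := sig_comp_le (P.equivFin ∘ ξ) P.equivFin.symm
  rw [← Function.comp_assoc, Equiv.symm_comp_self, Function.id_comp] at he'
  refine ⟨P.equivFin ∘ ξ, he.trans hsig, le_trans ?_ (ent_mono hT (he.trans hsig) he')⟩
  have hH : ∀ n, dynH μ T P n = cEnt ⊥ μ (itin T ξ n) := fun n => by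
    rw [cEnt_bot (sig_itin_le hT hsig n), dynH]
    refine Finset.sum_congr rfl fun g _ => ?_
    rw [show itin T ξ n ⁻¹' {g} = ⋂ i : Fin n, (T^[(i : ℕ)]) ⁻¹' (g i : Set X) by
      ext x; simp [itin, tup, funext_iff, hiff]]
    rfl
  refine ge_of_tendsto ((tendsto_cEnt_bot_itin hT hsig).comp (tendsto_add_atTop_nat 1))
    (Eventually.of_forall fun n => ?_)
  simp only [Function.comp_apply, ← hH]
  push_cast
  refine ciInf_le (f := fun n : ℕ => dynH μ T P (n + 1) / (n + 1 : ℝ)) ⟨0, ?_⟩ n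
  rintro _ ⟨k, rfl⟩
  have : 0 ≤ dynH μ T P (k + 1) := by
    rw [hH]; exact cEnt_nonneg bot_le (sig_itin_le hT hsig _)
  positivity

lemma generateFrom_le_iSup_sig (U : ℕ → Set X) :
    MeasurableSpace.generateFrom (range U) ≤ ⨆ p, sig (fun x => x ∈ U p) := by
  refine MeasurableSpace.generateFrom_le ?_
  rintro _ ⟨p, rfl⟩
  exact le_iSup (fun p => sig (fun x => x ∈ U p)) p _ (sig_mem_le_iff.1 le_rfl)

theorem exists_rokhlinSinai {T : X ≃ᵐ X} (hT : MeasurePreserving T μ μ) (U : ℕ → Set X)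
    (hU : mX = MeasurableSpace.generateFrom (range U)) :
    ∃ 𝒜 : MeasurableSpace X, @IsRokhlinSinai X 𝒜 mX μ T U := by
  have hUm : ∀ p, MeasurableSet (U p) := fun p => by
    rw [hU]; exact MeasurableSpace.measurableSet_generateFrom (mem_range_self p)
  set α : ℕ → X → Prop := fun p x => x ∈ U p with hα_def
  have hα : ∀ p, sig (α p) ≤ mX := fun p => sig_mem_le_iff.2 (hUm p)
  have hgen : mX ≤ ⨆ p, sig (α p) := hU.le.trans (generateFrom_le_iSup_sig U)
  obtain ⟨k, hk⟩ := exists_goodDelays (μ := μ) hT hα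
  refine ⟨rsAlg T α k, rsAlg_le hT hα, comap_rsAlg_le T α k, fun p => ⟨k p, fun i hi => ?_⟩,
    iSup_comap_symm_rsAlg hT hα hgen, fun c hc => ?_, fun A hA => ?_, fun A hA h0 => ?_⟩
  · exact sig_mem_le_iff.1 (sig_comp_iterate_le_rsAlg T α k p i hi)
  · rw [mEnt, lt_iSup_iff] at hc
    obtain ⟨P, hc⟩ := hc
    rw [lt_iSup_iff] at hc
    obtain ⟨hP, hc⟩ := hc
    obtain ⟨ξ, hξ, hle⟩ := exists_entPart_le_ent hT hP
    have hc' : c < ent μ T ξ := (EReal.coe_lt_coe_iff.1 hc).trans_le hle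
    have hε : 0 < (ent μ T ξ - c) / 2 := by linarith
    obtain ⟨q, h1, h2⟩ := ((exists_ent_lt_delayed (k := k) hT hα hgen hξ hε).and
      (tendsto_two_mul_half_pow.eventually_lt_const hε)).exists
    refine ⟨q, delayed T α k q, sig_delayed_le hT hα k q, fun n => ?_⟩
    refine le_trans ?_ (hk.mul_le_cEnt_tail hT hα q n)
    exact mul_le_mul_of_nonneg_left (by linarith) n.cast_nonneg
  · exact hk.ent_eq_zero hT hα hgen (sig_mem_le_iff.2 hA)
  · exact exists_tail_ae_eq (comap_rsAlg_le T α k) hT (rsAlg_le hT hα) hA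
      fun n => cEnt_comap_rsAlg_eq_zero hT hα hgen (sig_mem_le_iff.2 hA) h0 n

end RokhlinSinaiTheorem

section WeaklyMixing

/-- The initial block of length `n` of a point of the Cantor space. -/
def block (n : ℕ) (x : ℕ → Bool) : Fin n → Bool := fun i => x i

lemma continuous_block (n : ℕ) : Continuous (block n) :=
  continuous_pi fun i => continuous_apply (i : ℕ)

lemma isClopen_block (n : ℕ) (w : Fin n → Bool) : IsClopen (block n ⁻¹' {w}) :=
  (isClopen_discrete _).preimage (continuous_block n)

lemma tendsto_of_block_eq {x : ℕ → Bool} {y : ℕ → ℕ → Bool}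
    (h : ∀ᶠ n in atTop, block n (y n) = block n x) : Tendsto y atTop (𝓝 x) := by
  refine tendsto_pi_nhds.2 fun i => ?_
  refine tendsto_const_nhds.congr' ?_
  filter_upwards [h, eventually_gt_atTop i] with n hn hi
  exact (congrFun hn ⟨i, hi⟩).symm

lemma exists_block_dist_lt {Y : Type*} [PseudoMetricSpace Y] (ψ : C(ℕ → Bool, Y)) {ε : ℝ}
    (hε : 0 < ε) : ∀ᶠ n in atTop, ∀ x y, block n x = block n y → dist (ψ x) (ψ y) < ε := by
  by_contra hcon
  rw [not_eventually] at hcon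
  obtain ⟨φ, hφ, h⟩ := extraction_of_frequently_atTop hcon
  push Not at h
  choose x y hxy hd using h
  obtain ⟨z, -, σ, hσ, hz⟩ := isCompact_univ.tendsto_subseq (x := x) fun _ => mem_univ _
  have hy : Tendsto (y ∘ σ) atTop (𝓝 z) := by
    refine tendsto_pi_nhds.2 fun i => ?_
    refine ((continuous_apply i).continuousAt.tendsto.comp hz).congr' ?_
    filter_upwards [eventually_gt_atTop i] with n hn
    have : i < φ (σ n) := hn.trans_le ((hσ.id_le n).trans (hφ.id_le _))
    exact congrFun (hxy (σ n)) ⟨i, this⟩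
  have h0 : Tendsto (fun n => dist (ψ (x (σ n))) (ψ (y (σ n)))) atTop (𝓝 0) := by
    rw [← dist_self (ψ z)]
    exact ((ψ.continuous.tendsto z).comp hz).dist ((ψ.continuous.tendsto z).comp hy)
  obtain ⟨n, hn⟩ := (h0.eventually_lt_const hε).exists
  exact absurd hn (not_lt.2 (hd _))

lemma isCantorSet_range [TopologicalSpace X] [T2Space X] {ψ : (ℕ → Bool) → X}
    (hψ : Continuous ψ) (hinj : Function.Injective ψ) : IsCantorSet (range ψ) := by
  have hce := hψ.isClosedEmbedding hinj
  refine ⟨range_nonempty _, isCompact_range hψ, ⟨hce.isClosed_range, ?_⟩,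
    hce.isEmbedding.isTotallyDisconnected_range.2 inferInstance⟩
  rintro _ ⟨x, rfl⟩
  rw [accPt_iff_nhds]
  intro U hU
  have hlim : Tendsto (fun n => Function.update x n (!(x n))) atTop (𝓝 x) :=
    tendsto_of_block_eq (Eventually.of_forall fun n => funext fun i =>
      Function.update_of_ne (ne_of_lt i.2) _ _)
  obtain ⟨n, hn⟩ := (((hψ.tendsto x).comp hlim).eventually_mem hU).exists
  refine ⟨_, ⟨hn, mem_range_self _⟩, fun h => ?_⟩
  have := congrFun (hinj h) n
  simp at this

variable [MetricSpace X] {T : X → X} {A : Set X}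

/-- `A` is topologically weakly mixing of all orders: the sets `U i` visit the sets `V i`
simultaneously along `A`. -/
def IsMixingOn (T : X → X) (A : Set X) : Prop :=
  ∀ (ι : Type) [Finite ι] (U V : ι → Set X), (∀ i, IsOpen (U i)) → (∀ i, IsOpen (V i)) →
    (∀ i, (A ∩ U i).Nonempty) → (∀ i, (A ∩ V i).Nonempty) →
    ∀ N, ∃ m ≥ N, ∀ i, (A ∩ U i ∩ T^[m] ⁻¹' V i).Nonempty

lemma isMixingOn_of_basis {U : ℕ → Set X} (hU : TopologicalSpace.IsTopologicalBasis (range U))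
    (h : ∀ k (p q : Fin k → ℕ) N, (∀ i, (A ∩ U (p i)).Nonempty) → (∀ i, (A ∩ U (q i)).Nonempty) →
      ∃ m ≥ N, ∀ i, (A ∩ U (p i) ∩ T^[m] ⁻¹' U (q i)).Nonempty) : IsMixingOn T A := by
  intro ι _ O V hO hV hAO hAV N
  have key : ∀ O : Set X, IsOpen O → (A ∩ O).Nonempty → ∃ p, U p ⊆ O ∧ (A ∩ U p).Nonempty := by
    rintro O hO ⟨x, hxA, hxO⟩
    obtain ⟨_, ⟨p, rfl⟩, hxp, hp⟩ := hU.exists_subset_of_mem_open hxO hO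
    exact ⟨p, hp, x, hxA, hxp⟩
  choose p hpO hpA using fun i => key (O i) (hO i) (hAO i)
  choose q hqV hqA using fun i => key (V i) (hV i) (hAV i)
  obtain ⟨k, ⟨e⟩⟩ := Finite.exists_equiv_fin ι
  obtain ⟨m, hm, hne⟩ := h k (p ∘ e.symm) (q ∘ e.symm) N (fun i => hpA _) fun i => hqA _
  refine ⟨m, hm, fun i => ?_⟩
  have := hne (e i)
  simp only [Function.comp_apply, e.symm_apply_apply] at this
  exact this.mono (inter_subset_inter (inter_subset_inter_right _ (hpO i))
    (preimage_mono (hqV i)))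

/-- Some iterate of `T` beyond time `n` maps the cylinders of level `n` under the first `n` maps
close to prescribed points. -/
def SteerSet (T : X → X) (A : Set X) (n : ℕ) (t : Fin n → (Fin n → Bool) → A) :
    Set (ℕ → C(ℕ → Bool, A)) :=
  {Ψ | ∃ m ≥ n, ∀ (j : Fin n) (w : Fin n → Bool),
    MapsTo (Ψ j) (block n ⁻¹' {w}) {y | dist (T^[m] y) (t j w) < 1 / (n + 1)}}

lemma isOpen_steerSet (hT : Continuous T) (n : ℕ) (t : Fin n → (Fin n → Bool) → A) :
    IsOpen (SteerSet T A n t) := by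
  have : SteerSet T A n t = ⋃ m ≥ n, ⋂ (j : Fin n) (w : Fin n → Bool),
      (fun Ψ : ℕ → C(ℕ → Bool, A) => Ψ j) ⁻¹'
        {ψ | MapsTo ψ (block n ⁻¹' {w}) {y | dist (T^[m] y) (t j w) < 1 / (n + 1)}} := by
    ext Ψ; simp [SteerSet]
  rw [this]
  refine isOpen_biUnion fun m _ => isOpen_iInter_of_finite fun j => isOpen_iInter_of_finite fun w =>
    IsOpen.preimage (continuous_apply _) ?_
  refine ContinuousMap.isOpen_setOfPred_mapsTo (isClopen_block n w).1.isCompact ?_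
  exact isOpen_lt (((hT.iterate m).comp continuous_subtype_val).dist continuous_const)
    continuous_const

lemma dense_steerSet (h : IsMixingOn T A) (n : ℕ) (t : Fin n → (Fin n → Bool) → A) :
    Dense (SteerSet T A n t) := by
  rw [dense_iff_inter_open]
  rintro O hO ⟨Ψ, hΨ⟩
  obtain ⟨I, u, hu, hIu⟩ := isOpen_pi_iff.1 hO Ψ hΨ
  have hε : ∀ i : I, ∃ ε > 0, Metric.ball (Ψ i) ε ⊆ u i := fun i =>
    Metric.isOpen_iff.1 (hu i i.2).1 _ (hu i i.2).2
  choose ε hε hball using hε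
  obtain ⟨L, hLn, hL⟩ : ∃ L ≥ n, ∀ i : I, ∀ x y, block L x = block L y →
      dist (Ψ i x) (Ψ i y) < ε i / 4 :=
    ((eventually_ge_atTop n).and (eventually_all.2 fun i : I =>
      exists_block_dist_lt (Ψ i) (by linarith [hε i] : 0 < ε i / 4))).exists
  have hJ : ∀ j : ℕ, ∃ r > 0, ∀ hj : j ∈ I, r = ε ⟨j, hj⟩ / 4 := fun j => by
    by_cases hj : j ∈ I
    · exact ⟨ε ⟨j, hj⟩ / 4, by linarith [hε ⟨j, hj⟩], fun _ => rfl⟩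
    · exact ⟨1, one_pos, fun h => absurd h hj⟩
  choose r hr hrI using hJ
  set J : Finset ℕ := I ∪ Finset.range n
  have hext : ∀ w : Fin L → Bool, block L (fun i => if h : i < L then w ⟨i, h⟩ else false) = w :=
    fun w => by ext i; simp [block]
  set pt : (Fin L → Bool) → ℕ → Bool := fun w i => if h : i < L then w ⟨i, h⟩ else false
  set tgt : ℕ → (Fin L → Bool) → A := fun j w =>
    if hj : j < n then t ⟨j, hj⟩ (fun i => w ⟨i, i.2.trans_le hLn⟩) else Ψ j (pt w)
  obtain ⟨m, hm, hne⟩ := h (J × (Fin L → Bool))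
    (fun q => Metric.ball (Ψ q.1 (pt q.2) : X) (r q.1))
    (fun q => Metric.ball (tgt q.1 q.2 : X) (1 / (n + 1)))
    (fun _ => Metric.isOpen_ball) (fun _ => Metric.isOpen_ball)
    (fun q => ⟨_, (Ψ q.1 (pt q.2)).2, Metric.mem_ball_self (hr _)⟩)
    (fun q => ⟨_, (tgt q.1 q.2).2, Metric.mem_ball_self (by positivity)⟩) n
  choose y hy using hne
  set Ψ' : ℕ → C(ℕ → Bool, A) := fun j => if hj : j ∈ J then
    ⟨fun x => ⟨y (⟨j, hj⟩, block L x), (hy (⟨j, hj⟩, block L x)).1.1⟩,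
      (continuous_of_discreteTopology (f := fun w : Fin L → Bool =>
        (⟨y (⟨j, hj⟩, w), (hy (⟨j, hj⟩, w)).1.1⟩ : A))).comp (continuous_block L)⟩ else Ψ j with hΨ'
  refine ⟨Ψ', hIu fun i hi => ?_, m, hm, fun j w x hx => ?_⟩
  · have hiJ : i ∈ J := Finset.mem_union_left _ hi
    refine hball ⟨i, hi⟩ ?_
    rw [Metric.mem_ball, ContinuousMap.dist_lt_iff (hε _)]
    intro x
    simp only [hΨ', dif_pos hiJ, ContinuousMap.coe_mk, Subtype.dist_eq]
    have h1 := (hy (⟨i, hiJ⟩, block L x)).1.2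
    have h2 := hL ⟨i, hi⟩ (pt (block L x)) x (hext _)
    rw [Metric.mem_ball] at h1
    simp only [hrI i hi, Subtype.dist_eq] at h1 h2
    refine (dist_triangle _ _ _).trans_lt ((add_lt_add h1 h2).trans ?_)
    linarith [hε ⟨i, hi⟩]
  · have hjJ : (j : ℕ) ∈ J := Finset.mem_union_right _ (Finset.mem_range.2 j.2)
    have h1 := (hy (⟨j, hjJ⟩, block L x)).2
    rw [mem_preimage, Metric.mem_ball] at h1
    simp only [hΨ', dif_pos hjJ, mem_ofPred_eq, ContinuousMap.coe_mk]
    convert h1 using 3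
    simp only [tgt, dif_pos j.2]
    rw [← (hx : block n x = w)]
    rfl

lemma dense_setOf_mem (a : A) {O : Set A} (hO : IsOpen O) (ha : a ∈ O) :
    IsOpen {Ψ : ℕ → C(ℕ → Bool, A) | ∃ j x, Ψ j x ∈ O} ∧
      Dense {Ψ : ℕ → C(ℕ → Bool, A) | ∃ j x, Ψ j x ∈ O} := by
  constructor
  · have : {Ψ : ℕ → C(ℕ → Bool, A) | ∃ j x, Ψ j x ∈ O} = ⋃ (j : ℕ) (x : ℕ → Bool),
      (fun Ψ : ℕ → C(ℕ → Bool, A) => Ψ j x) ⁻¹' O := by ext; simp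
    rw [this]
    refine isOpen_iUnion fun j => isOpen_iUnion fun x => hO.preimage ?_
    exact (continuous_eval_const x).comp (continuous_apply j)
  · rw [dense_iff_inter_open]
    rintro W hW ⟨Ψ, hΨ⟩
    obtain ⟨I, u, hu, hIu⟩ := isOpen_pi_iff.1 hW Ψ hΨ
    obtain ⟨j, hj⟩ := Infinite.exists_notMem_finset I
    refine ⟨Function.update Ψ j (ContinuousMap.const _ a), hIu fun i hi => ?_, j, fun _ => false, ?_⟩
    · rw [Function.update_of_ne (ne_of_mem_of_not_mem hi hj)]
      exact (hu i hi).2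
    · simpa using ha

lemma exists_generic [CompactSpace X] (hT : Continuous T) (hA : IsClosed A)
    (h : IsMixingOn T A) {a : ℕ → A} (ha : DenseRange a) :
    ∃ Ψ : ℕ → C(ℕ → Bool, A),
      (∀ (n : ℕ) (θ : Fin n → (Fin n → Bool) → ℕ), ∃ m ≥ n, ∀ (j : Fin n) (x : ℕ → Bool),
        dist (T^[m] (Ψ j x)) (a (θ j (block n x))) < 1 / (n + 1)) ∧
      Dense (⋃ j, range (Ψ j)) := by
  have : CompleteSpace A := hA.completeSpace_coe
  have : BaireSpace (ℕ → C(ℕ → Bool, A)) := inferInstance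
  have h1 := dense_iInter_of_isOpen
    (f := fun s : Σ n : ℕ, (Fin n → (Fin n → Bool) → ℕ) =>
      SteerSet T A s.1 fun j w => a (s.2 j w))
    (fun s => isOpen_steerSet hT _ _) (fun s => dense_steerSet h _ _)
  have h1G := IsGδ.iInter_of_isOpen (f := fun s : Σ n : ℕ, (Fin n → (Fin n → Bool) → ℕ) =>
      SteerSet T A s.1 fun j w => a (s.2 j w)) (fun s => isOpen_steerSet hT _ _)
  have h2 := fun q : ℕ × ℕ => dense_setOf_mem (a q.1)
    (Metric.isOpen_ball (x := a q.1) (ε := 1 / (q.2 + 1 : ℝ)))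
    (Metric.mem_ball_self (by positivity))
  have h2D := dense_iInter_of_isOpen (fun q => (h2 q).1) (fun q => (h2 q).2)
  have h2G := IsGδ.iInter_of_isOpen (fun q => (h2 q).1)
  have : Nonempty (ℕ → C(ℕ → Bool, A)) := ⟨fun _ => ContinuousMap.const _ (a 0)⟩
  obtain ⟨Ψ, hΨ1, hΨ2⟩ := (h1.inter_of_Gδ h1G h2G h2D).nonempty
  refine ⟨Ψ, fun n θ => ?_, ?_⟩
  · obtain ⟨m, hm, hd⟩ := mem_iInter.1 hΨ1 ⟨n, θ⟩
    exact ⟨m, hm, fun j x => hd j _ rfl⟩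
  · rw [Metric.dense_iff]
    intro b r hr
    obtain ⟨k, hk⟩ := Metric.denseRange_iff.1 ha b (r / 2) (by linarith)
    obtain ⟨N, hN⟩ := exists_nat_one_div_lt (half_pos hr)
    obtain ⟨j, x, hx⟩ := mem_iInter.1 hΨ2 (k, N)
    refine ⟨Ψ j x, ?_, mem_iUnion.2 ⟨j, mem_range_self x⟩⟩
    rw [Metric.mem_ball] at hx ⊢
    rw [dist_comm] at hk
    linarith [dist_triangle (Ψ j x) (a k) b]

theorem IsMixingOn.isWeaklyMixingSet [CompactSpace X] (hT : Continuous T) (hA : IsClosed A)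
    (hnt : A.Nontrivial) (h : IsMixingOn T A) : IsWeaklyMixingSet T A := by
  have : Nonempty A := hnt.nonempty.to_subtype
  set a : ℕ → A := TopologicalSpace.denseSeq A
  have ha : DenseRange a := TopologicalSpace.denseRange_denseSeq A
  obtain ⟨Ψ, hΨ, hdense⟩ := exists_generic hT hA h ha
  have happrox : ∀ (b : A) (n : ℕ), ∃ k, dist (b : X) (a k) < 1 / (n + 1) := fun b n =>
    Metric.denseRange_iff.1 ha b _ (by positivity)
  have hinj : ∀ j, Function.Injective fun x => (Ψ j x : X) := by
    intro j x y hxy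
    by_contra hne
    obtain ⟨i, hi⟩ := Function.ne_iff.1 hne
    obtain ⟨b, hb, c, hc, hbc⟩ := hnt
    obtain ⟨N, hN⟩ := exists_nat_one_div_lt (by linarith [dist_pos.2 hbc] : 0 < dist b c / 4)
    set n := max N (max i j + 1)
    have hn : 1 / (n + 1 : ℝ) < dist b c / 4 := (Nat.one_div_le_one_div (le_max_left _ _)).trans_lt hN
    have hin : i < n := by omega
    have hjn : j < n := by omega
    obtain ⟨k, hk⟩ := happrox ⟨b, hb⟩ n
    obtain ⟨l, hl⟩ := happrox ⟨c, hc⟩ n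
    obtain ⟨m, -, hm⟩ := hΨ n fun _ w => if w ⟨i, hin⟩ = x i then k else l
    have hx := hm ⟨j, hjn⟩ x
    have hy := hm ⟨j, hjn⟩ y
    have hby : block n y ⟨i, hin⟩ ≠ x i := Ne.symm hi
    have hbx : block n x ⟨i, hin⟩ = x i := rfl
    rw [if_pos hbx] at hx
    rw [if_neg hby] at hy
    simp only at hxy
    rw [hxy] at hx
    rw [dist_comm] at hl hx
    have := dist_triangle4 b (a k) (T^[m] (Ψ j y)) (a l)
    have := dist_triangle b (a l) c
    simp only at hk hl hx hy
    linarith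
  refine ⟨hnt.nonempty, hA, ⋃ j, range fun x => (Ψ j x : X), ?_, ⟨fun j => range fun x => (Ψ j x : X),
    fun j => isCantorSet_range (continuous_subtype_val.comp (Ψ j).continuous) (hinj j), rfl⟩, ?_, ?_⟩
  · exact iUnion_subset fun j => range_subset_iff.2 fun x => (Ψ j x).2
  · have : (⋃ j, range fun x => (Ψ j x : X)) = Subtype.val '' ⋃ j, range (Ψ j) := by
      rw [image_iUnion]
      simp only [← range_comp]
      rfl
    rw [this]
    apply subset_antisymm
    · exact closure_minimal (by rintro _ ⟨x, -, rfl⟩; exact x.2) hA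
    · intro x hx
      exact closure_subtype.1 (hdense ⟨x, hx⟩)
  · intro C hCB hC g hg hgA
    have hsel : ∀ (n : ℕ) (j : ℕ) (w : Fin n → Bool), ∃ k : ℕ, (∃ x, block n x = w ∧ (Ψ j x : X) ∈ C) →
        ∃ x, ∃ hx : (Ψ j x : X) ∈ C, block n x = w ∧ dist (g ⟨_, hx⟩) (a k) < 1 / (n + 1) := by
      intro n j w
      by_cases hex : ∃ x, block n x = w ∧ (Ψ j x : X) ∈ C
      · obtain ⟨x, hxw, hx⟩ := hex
        obtain ⟨k, hk⟩ := happrox ⟨_, hgA ⟨_, hx⟩⟩ n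
        exact ⟨k, fun _ => ⟨x, hx, hxw, hk⟩⟩
      · exact ⟨0, fun h => absurd h hex⟩
    choose θ hθ using hsel
    choose m hm hmd using fun n => hΨ n fun j w => θ n j w
    obtain ⟨σ, hσ, hmσ⟩ := strictMono_subseq_of_tendsto_atTop
      (tendsto_atTop_mono hm tendsto_id)
    refine ⟨m ∘ σ, hmσ, ?_⟩
    rintro ⟨c, hc⟩
    obtain ⟨j, x, rfl⟩ := mem_iUnion.1 (hCB hc)
    refine Tendsto.comp (g := fun n => T^[m n] (Ψ j x : X)) ?_ hσ.tendsto_atTop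
    choose y hyC hyb hyd using fun n => hθ n j (block n x) ⟨x, rfl, hc⟩
    have hy : Tendsto y atTop (𝓝 x) := tendsto_of_block_eq (Eventually.of_forall hyb)
    have hgy : Tendsto (fun n => g ⟨_, hyC n⟩) atTop (𝓝 (g ⟨_, hc⟩)) := by
      refine (hg.tendsto _).comp (tendsto_subtype_rng.2 ?_)
      exact ((continuous_subtype_val.comp (Ψ j).continuous).tendsto x).comp hy
    rw [tendsto_iff_dist_tendsto_zero] at hgy ⊢
    have hlim : Tendsto (fun n : ℕ => 1 / (n + 1 : ℝ) + 1 / (n + 1 : ℝ) +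
        dist (g ⟨_, hyC n⟩) (g ⟨_, hc⟩)) atTop (𝓝 0) := by
      simpa using (tendsto_one_div_add_atTop_nhds_zero_nat.add
        tendsto_one_div_add_atTop_nhds_zero_nat).add hgy
    refine squeeze_zero' (Eventually.of_forall fun _ => dist_nonneg) ?_ hlim
    filter_upwards [eventually_gt_atTop j] with n hn
    have h1 := hmd n ⟨j, hn⟩ x
    have h2 := hyd n
    rw [dist_comm] at h2
    simp only at h1
    linarith [dist_triangle4 (T^[m n] (Ψ j x : X)) (a (θ n j (block n x))) (g ⟨_, hyC n⟩)
      (g ⟨_, hc⟩)]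

end WeaklyMixing

section Separated

lemma abs_birk_le {S : X → X} {f : X → ℝ} {M : ℝ} (hM : ∀ x, |f x| ≤ M) (n : ℕ) (x : X) : |birk S f n x| ≤ n * M := by
  refine (Finset.abs_sum_le_sum_abs _ _).trans ((Finset.sum_le_sum fun i _ => hM _).trans ?_)
  simp

lemma continuous_birk [TopologicalSpace X] {S : X → X} {f : X → ℝ} (hS : Continuous S) (hf : Continuous f) (n : ℕ) :
    Continuous (birk S f n) :=
  continuous_finsetSum _ fun j _ => hf.comp (hS.iterate j)

variable [MetricSpace X] [CompactSpace X] {S : X → X} {f : X → ℝ} {δ : ℝ}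

/-- `E` is `(n, δ)`-separated for `S`. -/
def IsSep (S : X → X) (n : ℕ) (δ : ℝ) (E : Finset X) : Prop :=
  ∀ x ∈ E, ∀ y ∈ E, x ≠ y → ∃ i < n, δ < dist (S^[i] x) (S^[i] y)

lemma exists_card_le_of_isSep (hS : Continuous S) (n : ℕ) (hδ : 0 < δ) :
    ∃ M : ℕ, ∀ E : Finset X, IsSep S n δ E → E.card ≤ M := by
  set O : X → Set X := fun x => ⋂ i ∈ Finset.range n, {y | dist (S^[i] x) (S^[i] y) < δ / 2}
  have hO : ∀ x, IsOpen (O x) := fun x => isOpen_biInter_finset fun i _ =>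
    isOpen_lt (continuous_const.dist (hS.iterate i)) continuous_const
  have hx : ∀ x, x ∈ O x := fun x => by simp [O, hδ]
  obtain ⟨t, ht⟩ := isCompact_univ.elim_finite_subcover O hO
    fun x _ => mem_iUnion.2 ⟨x, hx x⟩
  refine ⟨t.card, fun E hE => ?_⟩
  have hsel : ∀ x, ∃ z ∈ t, x ∈ O z := fun x => by simpa using ht (mem_univ x)
  choose z hzt hz using hsel
  refine Finset.card_le_card_of_injOn z (fun x _ => hzt x) fun x hx y hy hxy => ?_
  by_contra hne
  obtain ⟨i, hi, hd⟩ := hE x hx y hy hne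
  have h1 := mem_iInter₂.1 (hz x) i (Finset.mem_range.2 hi)
  have h2 := mem_iInter₂.1 (hz y) i (Finset.mem_range.2 hi)
  rw [← hxy] at h2
  rw [mem_ofPred_eq] at h1 h2
  linarith [dist_triangle_left (S^[i] x) (S^[i] y) (S^[i] (z x))]

lemma exists_bound (hf : Continuous f) : ∃ M, 0 ≤ M ∧ ∀ x, |f x| ≤ M := by
  obtain ⟨M, hM⟩ := (isCompact_range hf).isBounded.exists_norm_le
  exact ⟨max M 0, le_max_right _ _, fun x => (hM _ (mem_range_self x)).trans (le_max_left _ _)⟩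

lemma le_sepPn (hS : Continuous S) (hf : Continuous f) (n : ℕ) (hδ : 0 < δ) {K : Set X}
    {E : Finset X} (hEK : ↑E ⊆ K) (hE : IsSep S n δ E) :
    ∑ x ∈ E, Real.exp (birk S f n x) ≤ sepPn S f n δ K := by
  refine le_csSup ?_ ⟨E, hEK, hE, rfl⟩
  obtain ⟨C, hC⟩ := exists_card_le_of_isSep hS n hδ
  obtain ⟨M, -, hM⟩ := exists_bound hf
  refine ⟨C * Real.exp (n * M), ?_⟩
  rintro _ ⟨E, -, hE, rfl⟩
  have h1 : ∀ x ∈ E, Real.exp (birk S f n x) ≤ Real.exp (n * M) := fun x _ =>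
    Real.exp_le_exp.2 ((le_abs_self _).trans (abs_birk_le hM n x))
  refine (Finset.sum_le_card_nsmul _ _ _ h1).trans ?_
  rw [nsmul_eq_mul]
  gcongr
  exact hC E hE

lemma exists_isSep_spanning (hS : Continuous S) (n : ℕ) (hδ : 0 < δ) (K : Set X) :
    ∃ E : Finset X, ↑E ⊆ K ∧ IsSep S n δ E ∧
      ∀ x ∈ K, ∃ e ∈ E, ∀ i < n, dist (S^[i] x) (S^[i] e) ≤ δ := by
  classical
  obtain ⟨C, hC⟩ := exists_card_le_of_isSep hS n hδ
  set P : ℕ → Prop := fun k => ∃ E : Finset X, ↑E ⊆ K ∧ IsSep S n δ E ∧ E.card = k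
  have hP0 : P 0 := ⟨∅, by simp, fun x hx => by simp at hx, rfl⟩
  obtain ⟨E, hEK, hE, hcard⟩ := Nat.findGreatest_spec (P := P) (Nat.zero_le C) hP0
  refine ⟨E, hEK, hE, fun x hx => ?_⟩
  by_contra! hcon
  have hxE : x ∉ E := fun h => by
    obtain ⟨i, -, hi⟩ := hcon x h
    rw [dist_self] at hi
    linarith
  have hsep : IsSep S n δ (insert x E) := by
    intro a ha b hb hab
    rw [Finset.mem_insert] at ha hb
    rcases ha with rfl | ha <;> rcases hb with rfl | hb
    · exact absurd rfl hab
    · exact hcon b hb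
    · obtain ⟨i, hi, hd⟩ := hcon a ha
      exact ⟨i, hi, by rwa [dist_comm]⟩
    · exact hE a ha b hb hab
  have hP : P (E.card + 1) := ⟨insert x E, by
    rw [Finset.coe_insert]; exact insert_subset hx hEK, hsep, Finset.card_insert_of_notMem hxE⟩
  have hle : E.card + 1 ≤ C := by
    rw [← Finset.card_insert_of_notMem hxE]; exact hC _ hsep
  have := Nat.le_findGreatest hle hP
  omega

end Separated

section Variational

variable [mX : MeasurableSpace X] {ν : Measure X} [IsProbabilityMeasure ν]

/-- Gibbs' inequality. -/
lemma cEnt_bot_add_integral_le {ω : Type*} [Fintype ω] {ξ : X → ω} (hξ : sig ξ ≤ mX)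
    {g : X → ℝ} (hg : Integrable g ν) {Z : ω → ℝ} (hZ : ∀ w, 0 ≤ Z w)
    (h : ∀ᵐ x ∂ν, Real.exp (g x) ≤ Z (ξ x)) :
    cEnt ⊥ ν ξ + ∫ x, g x ∂ν ≤ Real.log (∑ w, Z w) := by
  classical
  set p : ω → ℝ := fun w => ν.real (ξ ⁻¹' {w})
  have hmeas : ∀ w, MeasurableSet (ξ ⁻¹' {w}) := sig_le_iff_singleton.1 hξ
  have hpsum : ∑ w, p w = 1 := by
    have := measureReal_biUnion_finset (μ := ν) (s := Finset.univ) (f := fun w => ξ ⁻¹' {w})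
      (fun a _ b _ hab => Disjoint.preimage _ (by simpa using hab)) (fun w _ => hmeas w)
    rw [← this, show (⋃ w ∈ Finset.univ, ξ ⁻¹' {w}) = univ by ext x; simp]
    simp
  have hpos : ∀ w, 0 < p w → 0 < Z w := fun w hw => by
    by_contra hcon
    have : ν (ξ ⁻¹' {w}) = 0 := by
      refine measure_mono_null (fun x hx => ?_) (ae_iff.1 h)
      rw [mem_preimage, mem_singleton_iff] at hx
      rw [mem_ofPred_eq, hx]
      exact fun hle => hcon ((Real.exp_pos _).trans_le hle)
    simp [p, Measure.real, this] at hw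
  set Zs := ∑ w, Z w
  have hZs : 0 < Zs := by
    obtain ⟨w, hw⟩ : ∃ w, 0 < p w := by
      by_contra! hcon
      have := Finset.sum_nonpos (s := Finset.univ) fun w _ => hcon w
      linarith
    exact (hpos w hw).trans_le (Finset.single_le_sum (f := Z) (fun i _ => hZ i) (Finset.mem_univ w))
  have hInt : ∫ x, g x ∂ν ≤ ∑ w, p w * Real.log (Z w) := by
    have hi : ∀ w, Integrable ((ξ ⁻¹' {w}).indicator fun _ => Real.log (Z w)) ν := fun w =>
      (integrable_const _).indicator (hmeas w)
    have h1 : ∫ x, g x ∂ν ≤ ∫ x, ∑ w, (ξ ⁻¹' {w}).indicator (fun _ => Real.log (Z w)) x ∂ν := by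
      refine integral_mono_ae hg (integrable_finsetSum _ fun w _ => hi w) ?_
      filter_upwards [h] with x hx
      have : ∑ w, (ξ ⁻¹' {w}).indicator (fun _ => Real.log (Z w)) x = Real.log (Z (ξ x)) := by
        rw [Finset.sum_eq_single (ξ x)]
        · simp
        · intro b _ hb
          exact indicator_of_notMem (fun h => hb h.symm) _
        · simp
      rw [this, ← Real.log_exp (g x)]
      exact Real.log_le_log (Real.exp_pos _) hx
    refine h1.trans_eq ?_
    rw [integral_finsetSum _ fun w _ => hi w]
    refine Finset.sum_congr rfl fun w _ => ?_
    rw [integral_indicator_const _ (hmeas w), smul_eq_mul]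
  have hterm : ∀ w, Real.negMulLog (p w) + p w * Real.log (Z w) ≤
      p w * Real.log Zs + (Z w / Zs - p w) := fun w => by
    rcases (measureReal_nonneg (μ := ν) (s := ξ ⁻¹' {w})).eq_or_lt with h0 | h0
    · have : p w = 0 := h0.symm
      rw [this]
      have := div_nonneg (hZ w) hZs.le
      simpa using this
    · change 0 < p w at h0
      have hw := hpos w h0
      have := Real.log_le_sub_one_of_pos (x := Z w / (p w * Zs)) (by positivity)
      rw [Real.log_div hw.ne' (by positivity), Real.log_mul h0.ne' hZs.ne'] at this
      have h2 := mul_le_mul_of_nonneg_left this h0.le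
      have h3 : p w * (Z w / (p w * Zs) - 1) = Z w / Zs - p w := by field_simp
      rw [h3] at h2
      rw [Real.negMulLog]
      linarith
  rw [cEnt_bot hξ]
  have hsum := Finset.sum_le_sum (s := Finset.univ) fun w _ => hterm w
  rw [Finset.sum_add_distrib, Finset.sum_add_distrib, Finset.sum_sub_distrib, ← Finset.sum_mul,
    ← Finset.sum_div, hpsum, div_self hZs.ne'] at hsum
  linarith

variable [MetricSpace X] [CompactSpace X] [BorelSpace X] {ι : Type*} [Fintype ι] {S : X → X}
  {f : X → ℝ} {δ ε : ℝ}

lemma cEnt_tup_add_integral_le (hS : Continuous S) (hf : Continuous f) {β : X → Option ι}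
    (hβm : sig β ≤ mX) (hδ : 0 < δ)
    (hβ : ∀ x y z, dist x z ≤ δ → dist y z ≤ δ → β x = none ∨ β y = none ∨ β x = β y)
    (hfδ : ∀ x y, dist x y ≤ δ → f x ≤ f y + ε) (n m : ℕ) (τ : ℕ → ℕ) (hτ : ∀ j < m, τ j < n) :
    cEnt ⊥ ν (tup (fun j => β ∘ S^[τ j]) m) + ∫ x, birk S f n x ∂ν ≤
      Real.log (sepPn S f n δ ν.support) + m * Real.log 2 + n * ε := by
  classical
  obtain ⟨E, hEK, hE, hspan⟩ := exists_isSep_spanning hS n hδ ν.support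
  set N : ℕ → X → Finset (Option ι) := fun j e =>
    Finset.univ.filter fun b => ∃ x, β x = b ∧ dist x (S^[τ j] e) ≤ δ
  have hN : ∀ j e, (N j e).card ≤ 2 := fun j e => by
    have : ((N j e).erase none).card ≤ 1 := by
      rw [Finset.card_le_one]
      intro a ha b hb
      simp only [N, Finset.mem_erase, Finset.mem_filter, Finset.mem_univ, true_and] at ha hb
      obtain ⟨ha0, x, rfl, hx⟩ := ha
      obtain ⟨hb0, y, rfl, hy⟩ := hb
      rcases hβ x y _ hx hy with h | h | h
      · exact absurd h ha0
      · exact absurd h hb0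
      · exact h
    have := Finset.pred_card_le_card_erase (s := N j e) (a := none)
    omega
  set W : X → Finset (Fin m → Option ι) := fun e => Fintype.piFinset fun j : Fin m => N j e
  have hW : ∀ e, ((W e).card : ℝ) ≤ 2 ^ m := fun e => by
    rw [Fintype.card_piFinset]
    have := Finset.prod_le_pow_card Finset.univ (fun j : Fin m => (N j e).card) 2 fun j _ => hN j e
    rw [Finset.card_univ, Fintype.card_fin] at this
    exact_mod_cast this
  set Z : (Fin m → Option ι) → ℝ := fun w =>
    ∑ e ∈ E, if w ∈ W e then Real.exp (birk S f n e + n * ε) else 0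
  have hZ0 : ∀ w, 0 ≤ Z w := fun w => Finset.sum_nonneg fun e _ => by
    split_ifs <;> positivity
  have hξ : sig (tup (fun j => β ∘ S^[τ j]) m) ≤ mX := sig_tup_le_iff.2 fun j _ => by
    rw [sig_comp]
    rintro _ ⟨t, ht, rfl⟩
    exact (hS.iterate (τ j)).measurable (hβm _ ht)
  have hInt : Integrable (birk S f n) ν := by
    obtain ⟨M, -, hM⟩ := exists_bound hf
    exact Integrable.of_bound (continuous_birk hS hf n).aestronglyMeasurable (n * M)
      (ae_of_all _ fun x => abs_birk_le hM n x)
  have hle : ∀ᵐ x ∂ν, Real.exp (birk S f n x) ≤ Z (tup (fun j => β ∘ S^[τ j]) m x) := by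
    filter_upwards [Measure.support_mem_ae (μ := ν)] with x hx
    obtain ⟨e, he, hd⟩ := hspan x hx
    have hmem : tup (fun j => β ∘ S^[τ j]) m x ∈ W e := by
      simp only [W, Fintype.mem_piFinset, N, Finset.mem_filter, Finset.mem_univ, true_and]
      exact fun j => ⟨S^[τ j] x, rfl, hd _ (hτ j j.2)⟩
    have h1 : birk S f n x ≤ birk S f n e + n * ε := by
      have := Finset.sum_le_sum (s := Finset.range n) (f := fun j => f (S^[j] x))
        (g := fun j => f (S^[j] e) + ε) fun j hj => hfδ _ _ (hd j (Finset.mem_range.1 hj))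
      simpa [birk, Finset.sum_add_distrib] using this
    refine (Real.exp_le_exp.2 h1).trans ?_
    have h2 := Finset.single_le_sum (f := fun e => if tup (fun j => β ∘ S^[τ j]) m x ∈ W e then
      Real.exp (birk S f n e + n * ε) else 0) (fun e _ => by split_ifs <;> positivity) he
    simpa only [if_pos hmem] using h2
  have hsum : ∑ w, Z w ≤ 2 ^ m * (Real.exp (n * ε) * sepPn S f n δ ν.support) := by
    rw [Finset.sum_comm]
    have : ∀ e ∈ E, (∑ w, if w ∈ W e then Real.exp (birk S f n e + n * ε) else 0) ≤
        2 ^ m * (Real.exp (n * ε) * Real.exp (birk S f n e)) := fun e _ => by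
      rw [← Finset.sum_filter, Finset.sum_const, nsmul_eq_mul, ← Real.exp_add, add_comm]
      gcongr
      refine le_trans ?_ (hW e)
      exact_mod_cast Finset.card_le_card (by simp)
    refine (Finset.sum_le_sum this).trans ?_
    rw [← Finset.mul_sum, ← Finset.mul_sum]
    gcongr
    exact le_sepPn hS hf n hδ hEK hE
  have hne : E.Nonempty := by
    obtain ⟨x, hx⟩ := Measure.nonempty_support (μ := ν) (IsProbabilityMeasure.ne_zero ν)
    obtain ⟨e, he, -⟩ := hspan x hx
    exact ⟨e, he⟩
  have hsep : 0 < sepPn S f n δ ν.support :=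
    (Finset.sum_pos (fun e _ => Real.exp_pos _) hne).trans_le (le_sepPn hS hf n hδ hEK hE)
  refine (cEnt_bot_add_integral_le hξ hInt hZ0 hle).trans ?_
  rcases (Finset.sum_nonneg fun w (_ : w ∈ Finset.univ) => hZ0 w).eq_or_lt with h0 | h0
  · exfalso
    obtain ⟨x, hx⟩ := hle.exists
    have := Finset.single_le_sum (f := Z) (fun w _ => hZ0 w)
      (Finset.mem_univ (tup (fun j => β ∘ S^[τ j]) m x))
    linarith [Real.exp_pos (birk S f n x)]
  refine (Real.log_le_log h0 hsum).trans_eq ?_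
  rw [Real.log_mul (by positivity) (by positivity), Real.log_mul (by positivity) hsep.ne',
    Real.log_exp, Real.log_pow]
  ring

end Variational

section ErgodicLimsup

lemma limsup_le_limsup_of_le_add {u v : ℕ → ENNReal} {r : ℕ → ℝ} (hr : Tendsto r atTop (𝓝 0))
    (h : ∀ m, u m ≤ v m + ENNReal.ofReal (r m)) : limsup u atTop ≤ limsup v atTop := by
  refine ENNReal.le_of_forall_pos_le_add fun ε hε _ => ?_
  rw [← limsup_add_const atTop v (ε : ENNReal) (by isBoundedDefault) (by isBoundedDefault)]
  refine limsup_le_limsup ?_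
  filter_upwards [hr.eventually (gt_mem_nhds (NNReal.coe_pos.2 hε))] with m hm
  refine (h m).trans (add_le_add le_rfl ?_)
  exact ENNReal.ofReal_le_of_le_toReal hm.le

variable [MeasurableSpace X] {μ : Measure X} [IsProbabilityMeasure μ] {S : X → X}

/-- If bounded functions are asymptotically invariant under an ergodic map and their integrals
are eventually at least `c`, then almost surely they frequently exceed every number below `c`. -/
lemma Ergodic.ae_frequently_lt (hS : Ergodic S μ) {F : ℕ → X → ℝ} (hF : ∀ m, Measurable (F m))
    {C : ℝ} (hC : ∀ m, ∀ᵐ x ∂μ, |F m x| ≤ C) {r : ℕ → ℝ} (hr : Tendsto r atTop (𝓝 0))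
    (hFS : ∀ m, ∀ᵐ x ∂μ, |F m (S x) - F m x| ≤ r m) {c : ℝ} (hc : ∀ᶠ m in atTop, c ≤ ∫ x, F m x ∂μ) :
    ∀ᵐ x ∂μ, ∀ ρ < c, ∃ᶠ m in atTop, ρ < F m x := by
  set C' : ℝ := |C| + |c| + 1
  have hCC' : C ≤ C' := by have := le_abs_self C; have := abs_nonneg c; simp only [C']; linarith
  have hcC' : 0 < c + C' := by
    have := neg_abs_le c; have := abs_nonneg C; simp only [C']; linarith
  set G : ℕ → X → ENNReal := fun m x => ENNReal.ofReal (F m x + C')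
  have hG : ∀ m, Measurable (G m) := fun m => ((hF m).add_const _).ennreal_ofReal
  set L : X → ENNReal := fun x => limsup (fun m => G m x) atTop
  have hL : Measurable L := Measurable.limsup hG
  have hLS : L ∘ S =ᵐ[μ] L := by
    filter_upwards [ae_all_iff.2 hFS] with x hx
    refine le_antisymm (limsup_le_limsup_of_le_add hr fun m => ?_)
      (limsup_le_limsup_of_le_add hr fun m => ?_)
    · refine (ENNReal.ofReal_le_ofReal ?_).trans ENNReal.ofReal_add_le
      have := (abs_le.1 (hx m)).2
      linarith
    · refine (ENNReal.ofReal_le_ofReal ?_).trans ENNReal.ofReal_add_le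
      have := (abs_le.1 (hx m)).1
      linarith
  obtain ⟨a, ha⟩ := hS.ae_eq_const_of_ae_eq_comp₀ hL.nullMeasurable hLS
  have hInt : ∀ m, Integrable (F m) μ := fun m =>
    Integrable.of_bound (hF m).aestronglyMeasurable C (by simpa using hC m)
  have hle : ENNReal.ofReal (c + C') ≤ a := by
    have h1 := limsup_lintegral_le (μ := μ) (f := G) (fun _ => ENNReal.ofReal (C + C')) hG
      (fun m => by
        filter_upwards [hC m] with x hx
        exact ENNReal.ofReal_le_ofReal (by have := (abs_le.1 hx).2; linarith)) (by simp)
    have h2 : ∫⁻ x, limsup (fun m => G m x) atTop ∂μ = a := by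
      rw [lintegral_congr_ae ha]; simp
    rw [h2] at h1
    refine le_trans (le_limsup_of_frequently_le (Eventually.frequently ?_)) h1
    filter_upwards [hc] with m hm
    have h3 := ofReal_integral_eq_lintegral_ofReal (f := fun x => F m x + C')
      ((hInt m).add (integrable_const _)) (by
        filter_upwards [hC m] with x hx
        have := (abs_le.1 hx).1
        simp only [Pi.zero_apply]; linarith)
    rw [integral_add (hInt m) (integrable_const _)] at h3
    simp only [integral_const, probReal_univ, one_smul] at h3
    exact (ENNReal.ofReal_le_ofReal (by linarith)).trans_eq h3
  filter_upwards [ha] with x hx ρ hρ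
  have : ENNReal.ofReal (ρ + C') < limsup (fun m => G m x) atTop := by
    refine lt_of_lt_of_le ?_ (hle.trans_eq hx.symm)
    exact (ENNReal.ofReal_lt_ofReal_iff hcC').2 (by linarith)
  refine (frequently_lt_of_lt_limsup (by isBoundedDefault) this).mono fun m hm => ?_
  by_contra! h
  exact absurd (ENNReal.ofReal_le_ofReal (by linarith : F m x + C' ≤ ρ + C')) (not_le.2 hm)

end ErgodicLimsup

section InnerCode

variable [MetricSpace X] [CompactSpace X] [mX : MeasurableSpace X] [BorelSpace X] {μ : Measure X}
  [IsProbabilityMeasure μ] {ι : Type*} [Fintype ι]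

/-- A finite partition can be replaced by a partition into separated compact sets and a small
remainder, losing at most one unit of entropy. -/
lemma exists_inner_code {γ : X → ι} (hγ : sig γ ≤ mX) :
    ∃ β : X → Option ι, sig β ≤ mX ∧ cEnt (sig β) μ γ ≤ 1 ∧ ∀ᶠ δ in 𝓝[>] (0 : ℝ),
      ∀ x y z, dist x z ≤ δ → dist y z ≤ δ → β x = none ∨ β y = none ∨ β x = β y := by
  classical
  set n : ℝ := ((Fintype.card ι : ℕ) : ℝ)
  have hn : 0 ≤ n := Nat.cast_nonneg _
  have hγ' : ∀ a, MeasurableSet (γ ⁻¹' {a}) := fun a => sig_le_iff.1 hγ _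
  have hK : ∀ a, ∃ K ⊆ γ ⁻¹' {a}, IsCompact K ∧ μ.real (γ ⁻¹' {a} \ K) ≤ 1 / (n + 1) ^ 2 := fun a => by
    obtain ⟨K, hK, hKc, hlt⟩ := (hγ' a).exists_isCompact_sdiff_lt (measure_ne_top μ _)
      (ε := ENNReal.ofReal (1 / (n + 1) ^ 2)) (by simp; positivity)
    exact ⟨K, hK, hKc, ENNReal.toReal_le_of_le_ofReal (by positivity) hlt.le⟩
  choose K hKsub hKc hKμ using hK
  set β : X → Option ι := fun x => if x ∈ K (γ x) then some (γ x) else none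
  have hβ_some : ∀ {x a}, β x = some a ↔ x ∈ K a := fun {x a} => by
    by_cases h : x ∈ K (γ x)
    · simp only [β, h, if_true, Option.some.injEq]
      refine ⟨fun e => e ▸ h, fun e => hKsub a e⟩
    · simp only [β, h, if_false, reduceCtorEq, false_iff]
      intro e
      have : γ x = a := hKsub a e
      exact h (this ▸ e)
  have hβ_some' : ∀ a, β ⁻¹' {some a} = K a := fun a => by ext x; exact hβ_some
  have hβ_none : β ⁻¹' {none} = ⋃ a, γ ⁻¹' {a} \ K a := by
    ext x
    by_cases h : x ∈ K (γ x) <;> simp [β, h]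
  have hβ : sig β ≤ mX := sig_le_iff_singleton.2 fun o => by
    cases o with
    | none => rw [hβ_none]; exact MeasurableSet.iUnion fun a => (hγ' a).diff (hKc a).measurableSet
    | some a => rw [hβ_some']; exact (hKc a).measurableSet
  refine ⟨β, hβ, ?_, ?_⟩
  · have hind : ∀ s : Set (Option ι), μ⟦β ⁻¹' s | sig β⟧ = (β ⁻¹' s).indicator fun _ => 1 := fun s =>
      condExp_of_stronglyMeasurable hβ
        (StronglyMeasurable.indicator stronglyMeasurable_const (measurableSet_sig β s))
        (integrable_indicator_one (sig_le_iff.1 hβ s))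
    have key : ∀ a, ∫ x, Real.negMulLog ((μ⟦γ ⁻¹' {a} | sig β⟧) x) ∂μ ≤ μ.real (β ⁻¹' {none}) := by
      intro a
      rw [← integral_indicator_one (sig_le_iff.1 hβ _)]
      refine integral_mono_ae (integrable_negMulLog_condProb hβ (hγ' a))
        (integrable_indicator_one (sig_le_iff.1 hβ _)) ?_
      have h1 := condProb_mono (m := sig β) (μ := μ) (β ⁻¹' {some a}) (γ ⁻¹' {a})
        (sig_le_iff.1 hβ _) (hγ' a) ((hβ_some' a).trans_subset (hKsub a))
      have h2 := condProb_mono (m := sig β) (μ := μ) (γ ⁻¹' {a}) (β ⁻¹' {some a, none})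
        (hγ' a) (sig_le_iff.1 hβ _) (fun x hx => by
          have hx : γ x = a := hx
          by_cases h : x ∈ K (γ x)
          · exact Or.inl (hβ_some.2 (hx ▸ h))
          · exact Or.inr (by simp [β, h]))
      rw [hind] at h1 h2
      filter_upwards [h1, h2, negMulLog_condProb_mem (μ := μ) hβ (hγ' a),
        condProb_mem (μ := μ) hβ (hγ' a)] with x h1 h2 h3 h4
      cases hx : β x with
      | none =>
        have : x ∈ β ⁻¹' {none} := hx
        simpa [this] using h3.2
      | some b =>
        have hx' : x ∉ β ⁻¹' {none} := by simp [hx]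
        rw [indicator_of_notMem hx']
        by_cases hab : b = a
        · have : x ∈ β ⁻¹' {some a} := by simp [hx, hab]
          rw [indicator_of_mem this] at h1
          rw [le_antisymm h4.2 h1]; simp
        · have : x ∉ β ⁻¹' {some a, none} := by simp [hx, hab]
          rw [indicator_of_notMem this] at h2
          rw [le_antisymm h2 h4.1]; simp
    have hnone : μ.real (β ⁻¹' {none}) ≤ n * (1 / (n + 1) ^ 2) := by
      rw [hβ_none]
      refine (measureReal_iUnion_fintype_le _).trans ((Finset.sum_le_sum fun a _ => hKμ a).trans ?_)
      simp [n]
    calc cEnt (sig β) μ γ ≤ ∑ _a : ι, μ.real (β ⁻¹' {none}) := Finset.sum_le_sum fun a _ => key a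
      _ = n * μ.real (β ⁻¹' {none}) := by simp [n]
      _ ≤ n * (n * (1 / (n + 1) ^ 2)) := by gcongr
      _ ≤ 1 := by
        rw [← mul_assoc, mul_one_div, div_le_one (by positivity)]
        nlinarith
  · have hδ : ∀ a b, ∀ᶠ δ in 𝓝[>] (0 : ℝ), a ≠ b → ∀ x ∈ K a, ∀ y ∈ K b, ∀ z, dist x z ≤ δ →
        dist y z ≤ δ → False := fun a b => by
      by_cases hab : a = b
      · exact Eventually.of_forall fun _ h => absurd hab h
      have hd : Disjoint (K a) (K b) := Set.disjoint_left.2 fun x hx hy =>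
        hab ((hKsub a hx : γ x = a).symm.trans (hKsub b hy))
      obtain ⟨δ, hδ, h⟩ := hd.exists_thickenings (hKc a) (hKc b).isClosed
      filter_upwards [Ioo_mem_nhdsGT hδ] with δ' hδ' _ x hx y hy z hxz hyz
      have hzx : z ∈ Metric.thickening δ (K a) :=
        Metric.mem_thickening_iff.2 ⟨x, hx, by rw [dist_comm]; exact hxz.trans_lt hδ'.2⟩
      have hzy : z ∈ Metric.thickening δ (K b) :=
        Metric.mem_thickening_iff.2 ⟨y, hy, by rw [dist_comm]; exact hyz.trans_lt hδ'.2⟩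
      exact Set.disjoint_left.1 h hzx hzy
    filter_upwards [eventually_all.2 fun a => eventually_all.2 (hδ a)] with δ h x y z hxz hyz
    cases hx : β x with
    | none => exact Or.inl rfl
    | some a =>
      cases hy : β y with
      | none => exact Or.inr (Or.inl rfl)
      | some b =>
        refine Or.inr (Or.inr ?_)
        by_contra hab
        exact h a b (fun e => hab (by rw [e])) x (hβ_some.1 hx) y (hβ_some.1 hy) z hxz hyz

end InnerCode

lemma comap_iterate_eq {G : MeasurableSpace X} {S : X → X} (hGS : G.comap S = G) (n : ℕ) : G.comap S^[n] = G := by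
  induction n with
  | zero => exact MeasurableSpace.comap_id
  | succ n ih => rw [Function.iterate_succ, ← MeasurableSpace.comap_comp, ih, hGS]

lemma sig_itin_mul_le {ι : Type*} [Finite ι] {S : X → X} (η : X → ι) (N n : ℕ) (hN : 0 < N) :
    sig (itin S η (n * N)) ≤ sig (tup (fun j => itin S η N ∘ S^[j * N]) n) := by
  rw [sig_itin_le_iff]
  intro i hi
  have h1 : sig (itin S η N ∘ S^[i / N * N]) ≤ sig (tup (fun j => itin S η N ∘ S^[j * N]) n) :=
    sig_tup_le_iff (ξ := fun j => itin S η N ∘ S^[j * N]).1 le_rfl (i / N) ((Nat.div_lt_iff_lt_mul hN).2 hi)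
  refine le_trans ?_ h1
  have h2 : η ∘ S^[i] =
      (fun w : Fin N → ι => w ⟨i % N, Nat.mod_lt _ hN⟩) ∘ (itin S η N ∘ S^[i / N * N]) := by
    funext x
    simp only [itin, tup, Function.comp_apply, ← Function.iterate_add_apply]
    rw [mul_comm, Nat.mod_add_div]
  rw [h2]
  exact sig_comp_le _ _

section Disintegration

open ProbabilityTheory

variable {G : MeasurableSpace X} [mX : MeasurableSpace X] [StandardBorelSpace X] {μ : Measure X}
  [IsProbabilityMeasure μ] {ι κ : Type*} [Fintype ι] [Fintype κ] {S : X → X}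

lemma ae_cEnt_condExpKernel (hG : G ≤ mX) {ξ : X → ι} (hξ : sig ξ ≤ mX) :
    (fun x => cEnt ⊥ (condExpKernel μ G x) ξ) =ᵐ[μ]
      fun x => ∑ a, Real.negMulLog ((μ⟦ξ ⁻¹' {a} | G⟧) x) := by
  have := fun a => condExpKernel_ae_eq_condExp (μ := μ) hG (sig_le_iff.1 hξ {a})
  filter_upwards [eventually_all.2 this] with x hx
  rw [cEnt_bot hξ]
  exact Finset.sum_congr rfl fun a _ => by rw [hx a]

lemma measurable_cEnt_condExpKernel (hG : G ≤ mX) {ξ : X → ι} (hξ : sig ξ ≤ mX) :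
    Measurable fun x => cEnt ⊥ (condExpKernel μ G x) ξ := by
  simp_rw [cEnt_bot hξ]
  refine Finset.measurable_sum _ fun a _ => Real.continuous_negMulLog.measurable.comp ?_
  exact ((measurable_condExpKernel (sig_le_iff.1 hξ {a})).mono hG le_rfl).ennreal_toReal

lemma integral_cEnt_condExpKernel (hG : G ≤ mX) {ξ : X → ι} (hξ : sig ξ ≤ mX) :
    ∫ x, cEnt ⊥ (condExpKernel μ G x) ξ ∂μ = cEnt G μ ξ := by
  rw [integral_congr_ae (ae_cEnt_condExpKernel hG hξ),
    integral_finsetSum _ fun a _ => integrable_negMulLog_condProb hG (sig_le_iff.1 hξ {a})]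
  rfl

lemma integrable_cEnt_condExpKernel (hG : G ≤ mX) {ξ : X → ι} (hξ : sig ξ ≤ mX) :
    Integrable (fun x => cEnt ⊥ (condExpKernel μ G x) ξ) μ :=
  (integrable_finsetSum _ fun a _ => integrable_negMulLog_condProb hG
    (sig_le_iff.1 hξ {a})).congr (ae_cEnt_condExpKernel hG hξ).symm

lemma cEnt_condExpKernel_comp (hS : MeasurePreserving S μ μ) (hG : G ≤ mX) (hGS : G.comap S = G)
    {ξ : X → ι} (hξ : sig ξ ≤ mX) :
    ∀ᵐ x ∂μ, cEnt ⊥ (condExpKernel μ G (S x)) ξ = cEnt ⊥ (condExpKernel μ G x) (ξ ∘ S) := by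
  have hξS : sig (ξ ∘ S) ≤ mX := by rw [sig_comp]; exact comap_le_borel hS hξ
  have h : ∀ a, μ⟦(ξ ∘ S) ⁻¹' {a} | G⟧ =ᵐ[μ] μ⟦ξ ⁻¹' {a} | G⟧ ∘ S := fun a => by
    have := condExp_comp_comap hS hG (integrable_indicator_one (sig_le_iff.1 hξ {a}))
    rwa [hGS] at this
  filter_upwards [ae_cEnt_condExpKernel hG hξS, hS.quasiMeasurePreserving.ae
    (ae_cEnt_condExpKernel hG hξ), eventually_all.2 h] with x h1 h2 h3
  rw [h1, h2]
  exact Finset.sum_congr rfl fun a _ => by rw [h3 a]; rfl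

lemma integral_condExpKernel_comp (hS : MeasurePreserving S μ μ) (hG : G ≤ mX)
    (hGS : G.comap S = G) {φ : X → ℝ} (hφ : Integrable φ μ) :
    ∀ᵐ x ∂μ, ∫ y, φ y ∂condExpKernel μ G (S x) = ∫ y, φ (S y) ∂condExpKernel μ G x := by
  have h := condExp_comp_comap hS hG hφ
  rw [hGS] at h
  have hφS : Integrable (φ ∘ S) μ := hS.integrable_comp_of_integrable hφ
  filter_upwards [h, hS.quasiMeasurePreserving.ae (condExp_ae_eq_integral_condExpKernel hG hφ),
    condExp_ae_eq_integral_condExpKernel hG hφS] with x h1 h2 h3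
  rw [← h2]
  exact h1.symm.trans h3

end Disintegration

section TupleEntropy

variable {m : MeasurableSpace X} [mX : MeasurableSpace X] {μ : Measure X} [IsProbabilityMeasure μ]
  {ι κ : Type*} [Fintype ι] [Fintype κ]

lemma cEnt_tup_le_mul (hm : m ≤ mX) {ζ : ℕ → X → ι} (hζ : ∀ i, sig (ζ i) ≤ mX) (n : ℕ) :
    cEnt m μ (tup ζ n) ≤ n * Fintype.card ι := by
  refine (cEnt_tup_le_sum hm hζ n).trans
    ((Finset.sum_le_sum fun j _ => cEnt_le_card hm (hζ j)).trans ?_)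
  simp

lemma abs_cEnt_tup_shift_sub_le (hm : m ≤ mX) {ζ : ℕ → X → ι} (hζ : ∀ i, sig (ζ i) ≤ mX) (n : ℕ) :
    |cEnt m μ (tup (fun i => ζ (i + 1)) n) - cEnt m μ (tup ζ n)| ≤ Fintype.card ι := by
  have h0 : sig (tup ζ n) ≤ mX := sig_tup_le_iff.2 fun i _ => hζ i
  have h1 : sig (tup (fun i => ζ (i + 1)) n) ≤ mX := sig_tup_le_iff.2 fun i _ => hζ (i + 1)
  have e0 := cEnt_chain (μ := μ) hm (hζ n) h0 (sig_tup_succ ζ n)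
  have e1 := cEnt_chain (μ := μ) hm (hζ 0) h1 (sig_tup_succ' ζ n)
  have a0 := cEnt_le_card (μ := μ) (sup_le hm h0) (hζ n)
  have a1 := cEnt_le_card (μ := μ) (sup_le hm h1) (hζ 0)
  have b0 := cEnt_nonneg (μ := μ) (sup_le hm h0) (hζ n)
  have b1 := cEnt_nonneg (μ := μ) (sup_le hm h1) (hζ 0)
  exact abs_le.2 ⟨by linarith, by linarith⟩

lemma cEnt_itin_mul_le {S : X → X} (hS : MeasurePreserving S μ μ) (hm : m ≤ mX) {η : X → ι}
    (hη : sig η ≤ mX) {β : X → κ} (hβ : sig β ≤ mX) {N : ℕ} (hN : 0 < N)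
    (h : cEnt (sig β) μ (itin S η N) ≤ 1) (n : ℕ) :
    cEnt m μ (itin S η (n * N)) ≤ cEnt m μ (tup (fun j => β ∘ S^[j * N]) n) + n := by
  have hγ := sig_itin_le hS hη N
  have hγ' : ∀ j, sig (itin S η N ∘ S^[j * N]) ≤ mX := fun j => sig_comp_iterate_le hS hγ _
  have hβ' : ∀ j, sig (β ∘ S^[j * N]) ≤ mX := fun j => sig_comp_iterate_le hS hβ _
  have hC : sig (tup (fun j => itin S η N ∘ S^[j * N]) n) ≤ mX := sig_tup_le_iff.2 fun j _ => hγ' j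
  have hB : sig (tup (fun j => β ∘ S^[j * N]) n) ≤ mX := sig_tup_le_iff.2 fun j _ => hβ' j
  have h1 : cEnt m μ (itin S η (n * N)) ≤ cEnt m μ (tup (fun j => itin S η N ∘ S^[j * N]) n) :=
    cEnt_mono_sig hm (sig_itin_le hS hη _) hC ((sig_itin_mul_le η N n hN).trans le_sup_right)
  have h2 := cEnt_prod (μ := μ) hm hC hB
  have h3 := cEnt_prod (μ := μ) hm hB hC
  rw [cEnt_prod_comm] at h3
  have h4 := cEnt_nonneg (μ := μ) (sup_le hm hC) hB
  have h5 : cEnt (m ⊔ sig (tup (fun j => β ∘ S^[j * N]) n)) μ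
      (tup (fun j => itin S η N ∘ S^[j * N]) n) ≤ n := by
    refine (cEnt_tup_le_sum (sup_le hm hB) hγ' n).trans ?_
    calc _ ≤ ∑ j ∈ Finset.range n, (1 : ℝ) := Finset.sum_le_sum fun j hj => ?_
      _ = n := by simp
    have h6 : sig (β ∘ S^[j * N]) ≤ m ⊔ sig (tup (fun j => β ∘ S^[j * N]) n) :=
      (sig_tup_le_iff (ξ := fun j => β ∘ S^[j * N]).1 le_rfl j (Finset.mem_range.1 hj)).trans le_sup_right
    refine (cEnt_anti h6 (sup_le hm hB) (hγ' j)).trans ?_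
    rw [sig_comp, cEnt_comp (hS.iterate _) hβ hγ]
    exact h
  linarith

end TupleEntropy

lemma birk_comp_sub (S : X → X) (f : X → ℝ) (n : ℕ) (x : X) :
    birk S f n (S x) - birk S f n x = f (S^[n] x) - f x := by
  have := Finset.sum_range_succ' (fun j => f (S^[j] x)) n
  rw [Finset.sum_range_succ] at this
  simp only [birk, ← Function.iterate_succ_apply]
  simp only [Function.iterate_zero, id] at this
  linarith

section BlockFunctional

open ProbabilityTheory

variable {κ : Type*} [Fintype κ] [MeasurableSpace X]

/-- Entropy of `β` along a progression of step `N`, averaged over the starting points and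
normalized per unit of time, plus the Birkhoff average of `f`. -/
def blockAvg (S : X → X) (f : X → ℝ) (β : X → κ) (N m : ℕ) (ν : Measure X) : ℝ :=
  ((∑ i ∈ Finset.range N, cEnt ⊥ ν (tup (fun j => β ∘ S^[i + j * N]) m)) / N +
    ∫ x, birk S f (m * N) x ∂ν) / (m * N)

variable {S : X → X} {f : X → ℝ} {β : X → κ} {N : ℕ}

lemma integral_birk {μ : Measure X} (hS : MeasurePreserving S μ μ) (hf : Integrable f μ) (n : ℕ) :
    ∫ x, birk S f n x ∂μ = n * ∫ x, f x ∂μ := by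
  have : ∀ j, ∫ x, f (S^[j] x) ∂μ = ∫ x, f x ∂μ := fun j => by
    have h := integral_map (μ := μ) (hS.iterate j).measurable.aemeasurable (f := f)
      (by rw [(hS.iterate j).map_eq]; exact hf.aestronglyMeasurable)
    rw [(hS.iterate j).map_eq] at h
    exact h.symm
  simp only [birk]
  rw [integral_finsetSum (f := fun j x => f (S^[j] x)) _ fun j _ =>
    (hS.iterate j).integrable_comp_of_integrable hf]
  simp [this]

lemma abs_integral_birk_le {ν : Measure X} [IsProbabilityMeasure ν] {M : ℝ}
    (hM : ∀ x, |f x| ≤ M) (n : ℕ) : |∫ x, birk S f n x ∂ν| ≤ n * M := by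
  have := norm_integral_le_of_norm_le_const (μ := ν) (f := birk S f n) (C := n * M)
    (ae_of_all _ fun x => abs_birk_le hM n x)
  simpa using this

lemma abs_blockAvg_le {ν : Measure X} [IsProbabilityMeasure ν] {M : ℝ}
    (hM : ∀ x, |f x| ≤ M) (hβ : ∀ j, sig (β ∘ S^[j]) ≤ ‹MeasurableSpace X›) (hN : 0 < N) (m : ℕ) :
    |blockAvg S f β N m ν| ≤ Fintype.card κ + M := by
  have hN' : (0 : ℝ) < N := Nat.cast_pos.2 hN
  have hM0 : 0 ≤ M := by
    obtain ⟨x⟩ := ν.nonempty_of_neZero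
    exact (abs_nonneg _).trans (hM x)
  rcases Nat.eq_zero_or_pos m with rfl | hm
  · simp only [blockAvg, Nat.cast_zero, zero_mul, div_zero, abs_zero]; positivity
  have hm' : (0 : ℝ) < m := Nat.cast_pos.2 hm
  have hmN : (0 : ℝ) < m * N := by positivity
  rw [blockAvg, abs_div, abs_of_pos hmN, div_le_iff₀ hmN]
  have h1 := abs_integral_birk_le (S := S) (ν := ν) hM (m * N)
  have h2 : |(∑ i ∈ Finset.range N, cEnt ⊥ ν (tup (fun j => β ∘ S^[i + j * N]) m)) / N| ≤
      m * Fintype.card κ := by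
    rw [abs_div, abs_of_pos hN', div_le_iff₀ hN', abs_of_nonneg
      (Finset.sum_nonneg fun i _ => cEnt_nonneg bot_le (sig_tup_le_iff.2 fun j _ => hβ _))]
    refine (Finset.sum_le_sum fun i _ => cEnt_tup_le_mul bot_le (fun j => hβ _) m).trans ?_
    rw [Finset.sum_const, Finset.card_range, nsmul_eq_mul, mul_comm]
  have h3 : (1 : ℝ) ≤ N := Nat.one_le_cast.2 hN
  have h4 : (m : ℝ) * Fintype.card κ ≤ m * N * Fintype.card κ := by
    have : (0 : ℝ) ≤ m * Fintype.card κ := by positivity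
    nlinarith
  push_cast at h1
  refine (abs_add_le _ _).trans ?_
  linarith

lemma blockAvg_le [MetricSpace X] [CompactSpace X] [BorelSpace X] {ν : Measure X}
    [IsProbabilityMeasure ν] {ι : Type*} [Fintype ι] {β : X → Option ι} {δ ε : ℝ} (hS : Continuous S) (hf : Continuous f)
    (hβm : sig β ≤ ‹MeasurableSpace X›) (hδ : 0 < δ)
    (hβ : ∀ x y z, dist x z ≤ δ → dist y z ≤ δ → β x = none ∨ β y = none ∨ β x = β y)
    (hfδ : ∀ x y, dist x y ≤ δ → f x ≤ f y + ε) (hN : 0 < N) {m : ℕ} (hm : 0 < m) :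
    blockAvg S f β N m ν ≤
      Real.log (sepPn S f (m * N) δ ν.support) / (m * N : ℕ) + Real.log 2 / N + ε := by
  have hN' : (0 : ℝ) < N := Nat.cast_pos.2 hN
  have hm' : (0 : ℝ) < m := Nat.cast_pos.2 hm
  have hmN : (0 : ℝ) < m * N := by positivity
  set B := Real.log (sepPn S f (m * N) δ ν.support) with hB
  have h1 : ∀ i ∈ Finset.range N, cEnt ⊥ ν (tup (fun j => β ∘ S^[i + j * N]) m) ≤
      B + m * Real.log 2 + m * N * ε - ∫ x, birk S f (m * N) x ∂ν := fun i hi => by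
    have := cEnt_tup_add_integral_le (ν := ν) hS hf hβm hδ hβ hfδ (m * N) m (fun j => i + j * N)
      (fun j hj => by
        have hi := Finset.mem_range.1 hi
        calc i + j * N < N + j * N := by omega
          _ = (j + 1) * N := by ring
          _ ≤ m * N := Nat.mul_le_mul_right _ hj)
    push_cast at this
    linarith
  have h2 := Finset.sum_le_sum h1
  rw [Finset.sum_const, Finset.card_range, nsmul_eq_mul, mul_comm, ← div_le_iff₀ hN'] at h2
  rw [blockAvg, div_le_iff₀ hmN]
  push_cast
  have : (B / (m * N) + Real.log 2 / N + ε) * (m * N) = B + m * Real.log 2 + m * N * ε := by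
    field_simp
  rw [this]
  linarith

end BlockFunctional

section FiberPressure

open ProbabilityTheory

variable {G : MeasurableSpace X} [mX : MeasurableSpace X] [StandardBorelSpace X] {μ : Measure X}
  [IsProbabilityMeasure μ] {ι κ : Type*} [Fintype ι] [Fintype κ] {S : X → X} {f : X → ℝ} {N : ℕ}

lemma abs_blockAvg_comp_sub_le (hS : MeasurePreserving S μ μ) (hG : G ≤ mX) (hGS : G.comap S = G)
    {β : X → κ} (hβ : sig β ≤ mX) {M : ℝ} (hf : Measurable f) (hM : ∀ x, |f x| ≤ M) (hN : 0 < N) (m : ℕ) :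
    ∀ᵐ x ∂μ, |blockAvg S f β N m (condExpKernel μ G (S x)) - blockAvg S f β N m (condExpKernel μ G x)| ≤
      (Fintype.card κ + 2 * M) / m := by
  have hβj : ∀ j, sig (β ∘ S^[j]) ≤ mX := fun j => sig_comp_iterate_le hS hβ j
  set ζ : ℕ → X → Fin m → κ := fun i => tup (fun j => β ∘ S^[i + j * N]) m with hζ_def
  have hζ : ∀ i, sig (ζ i) ≤ mX := fun i => sig_tup_le_iff.2 fun j _ => hβj _
  have hζS : ∀ i, ζ i ∘ S = ζ (i + 1) := fun i => by
    funext x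
    funext j
    change β (S^[i + j * N] (S x)) = β (S^[i + 1 + j * N] x)
    rw [← Function.iterate_succ_apply]
    congr 2
    omega
  have hbm : Measurable (birk S f (m * N)) :=
    Finset.measurable_sum _ fun j _ => hf.comp (hS.measurable.iterate j)
  have hbi : Integrable (birk S f (m * N)) μ :=
    Integrable.of_bound hbm.aestronglyMeasurable _ (ae_of_all _ fun x => abs_birk_le hM _ x)
  filter_upwards [ae_all_iff.2 fun i => cEnt_condExpKernel_comp hS hG hGS (hζ i),
    integral_condExpKernel_comp hS hG hGS hbi] with x h1 h2
  set ν := condExpKernel μ G x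
  rcases Nat.eq_zero_or_pos m with rfl | hm
  · simp [blockAvg]
  have hN' : (0 : ℝ) < N := Nat.cast_pos.2 hN
  have hm' : (0 : ℝ) < m := Nat.cast_pos.2 hm
  have hN1 : (1 : ℝ) ≤ N := Nat.one_le_cast.2 hN
  have hmN : (0 : ℝ) < m * N := by positivity
  have hM0 : 0 ≤ M := (abs_nonneg _).trans (hM x)
  have hbν : Integrable (birk S f (m * N)) ν :=
    Integrable.of_bound hbm.aestronglyMeasurable _ (ae_of_all _ fun x => abs_birk_le hM _ x)
  have hbν' : Integrable (fun y => birk S f (m * N) (S y)) ν :=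
    Integrable.of_bound (hbm.comp hS.measurable).aestronglyMeasurable _
      (ae_of_all _ fun x => abs_birk_le hM _ _)
  have h3 : |∫ y, birk S f (m * N) (S y) ∂ν - ∫ y, birk S f (m * N) y ∂ν| ≤ 2 * M := by
    rw [← integral_sub hbν' hbν]
    have := norm_integral_le_of_norm_le_const (μ := ν)
      (f := fun y => birk S f (m * N) (S y) - birk S f (m * N) y) (C := 2 * M)
      (ae_of_all _ fun y => by
        rw [birk_comp_sub, Real.norm_eq_abs]
        have := abs_sub (f (S^[m * N] y)) (f y)
        linarith [hM (S^[m * N] y), hM y])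
    simpa using this
  have h4 : |∑ i ∈ Finset.range N, cEnt ⊥ ν (ζ (i + 1)) - ∑ i ∈ Finset.range N, cEnt ⊥ ν (ζ i)| ≤
      Fintype.card κ := by
    rw [← Finset.sum_sub_distrib, Finset.sum_range_sub (fun i => cEnt ⊥ ν (ζ i))]
    have := abs_cEnt_tup_shift_sub_le (m := ⊥) (μ := ν) bot_le (ζ := fun j => β ∘ S^[0 + j * N])
      (fun j => hβj _) m
    have e : ζ N = tup (fun i => β ∘ S^[0 + (i + 1) * N]) m := by
      simp only [hζ_def]
      congr 1
      funext j
      congr 2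
      ring
    rw [e]
    exact this
  have e1 : blockAvg S f β N m (condExpKernel μ G (S x)) = ((∑ i ∈ Finset.range N, cEnt ⊥ ν (ζ (i + 1))) / N +
      ∫ y, birk S f (m * N) (S y) ∂ν) / (m * N) := by
    rw [blockAvg, h2]
    congr 3
    refine Finset.sum_congr rfl fun i _ => ?_
    rw [← hζS]
    exact h1 i
  have e2 : blockAvg S f β N m ν = ((∑ i ∈ Finset.range N, cEnt ⊥ ν (ζ i)) / N +
      ∫ y, birk S f (m * N) y ∂ν) / (m * N) := rfl
  rw [e1, e2, ← sub_div, abs_div, abs_of_pos hmN]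
  have h5 : |(∑ i ∈ Finset.range N, cEnt ⊥ ν (ζ (i + 1))) / N + ∫ y, birk S f (m * N) (S y) ∂ν -
      ((∑ i ∈ Finset.range N, cEnt ⊥ ν (ζ i)) / N + ∫ y, birk S f (m * N) y ∂ν)| ≤
      Fintype.card κ + 2 * M := by
    rw [add_sub_add_comm, ← sub_div]
    refine (abs_add_le _ _).trans (add_le_add ?_ h3)
    rw [abs_div, abs_of_pos hN']
    exact (div_le_self (abs_nonneg _) hN1).trans h4
  have h6 : 0 ≤ (Fintype.card κ : ℝ) + 2 * M := by positivity
  refine (div_le_div_of_nonneg_right h5 hmN.le).trans ?_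
  exact div_le_div_of_nonneg_left h6 hm' (le_mul_of_one_le_right hm'.le hN1)

lemma measurable_blockAvg (hS : Measurable S) (hG : G ≤ mX)
    {β : X → κ} (hβS : ∀ j, sig (β ∘ S^[j]) ≤ mX) (hf : Measurable f) (m : ℕ) :
    Measurable fun x => blockAvg S f β N m (condExpKernel μ G x) := by
  refine (((Finset.measurable_sum _ fun i _ => ?_).div_const _).add ?_).div_const _
  · exact measurable_cEnt_condExpKernel hG (sig_tup_le_iff.2 fun j _ => hβS _)
  · have hbm : Measurable (birk S f (m * N)) :=
      Finset.measurable_sum _ fun j _ => hf.comp (hS.iterate j)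
    exact (hbm.stronglyMeasurable.integral_condExpKernel (μ := μ) (m := G)).measurable.mono hG le_rfl

lemma le_integral_blockAvg (hS : MeasurePreserving S μ μ) (hG : G ≤ mX) (hGS : G.comap S = G)
    {η : X → ι} (hη : sig η ≤ mX) {c : ℝ} (hc : ∀ n : ℕ, n * c ≤ cEnt G μ (itin S η n))
    {β : X → κ} (hβ : sig β ≤ mX) (hβη : cEnt (sig β) μ (itin S η N) ≤ 1) {M : ℝ} (hf : Measurable f)
    (hM : ∀ x, |f x| ≤ M) (hN : 0 < N) {m : ℕ} (hm : 0 < m) :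
    c - 1 / N + ∫ x, f x ∂μ ≤ ∫ x, blockAvg S f β N m (condExpKernel μ G x) ∂μ := by
  have hN' : (0 : ℝ) < N := Nat.cast_pos.2 hN
  have hm' : (0 : ℝ) < m := Nat.cast_pos.2 hm
  have hmN : (0 : ℝ) < m * N := by positivity
  have hβj : ∀ j, sig (β ∘ S^[j]) ≤ mX := fun j => sig_comp_iterate_le hS hβ j
  have hfi : Integrable f μ := Integrable.of_bound hf.aestronglyMeasurable _ (ae_of_all _ hM)
  have hbm : Measurable (birk S f (m * N)) :=
    Finset.measurable_sum _ fun j _ => hf.comp (hS.measurable.iterate j)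
  have hbi : Integrable (birk S f (m * N)) μ :=
    Integrable.of_bound hbm.aestronglyMeasurable _ (ae_of_all _ fun x => abs_birk_le hM _ x)
  have hI : ∫ x, ∫ y, birk S f (m * N) y ∂condExpKernel μ G x ∂μ = m * N * ∫ x, f x ∂μ := by
    rw [← integral_congr_ae (condExp_ae_eq_integral_condExpKernel hG hbi), integral_condExp hG,
      integral_birk hS hfi]
    push_cast; ring
  set ζ : ℕ → X → Fin m → κ := fun i => tup (fun j => β ∘ S^[i + j * N]) m with hζ_def
  have hζ : ∀ i, sig (ζ i) ≤ mX := fun i => sig_tup_le_iff.2 fun j _ => hβj _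
  have hE : ∀ i, m * N * c - m ≤ cEnt G μ (ζ i) := fun i => by
    have e : ζ i = tup (fun j => β ∘ S^[j * N]) m ∘ S^[i] := by
      funext x
      funext j
      change β (S^[i + j * N] x) = β (S^[j * N] (S^[i] x))
      rw [← Function.iterate_add_apply, add_comm]
    have h0 : sig (tup (fun j => β ∘ S^[j * N]) m) ≤ mX := sig_tup_le_iff.2 fun j _ => hβj _
    have h1 := cEnt_comp (μ := μ) (hS.iterate i) hG h0
    rw [comap_iterate_eq hGS] at h1
    rw [e, h1]
    have h2 := cEnt_itin_mul_le hS hG hη hβ hN hβη m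
    have h3 := hc (m * N)
    push_cast at h3
    linarith
  have hInt : ∫ x, blockAvg S f β N m (condExpKernel μ G x) ∂μ =
      ((∑ i ∈ Finset.range N, cEnt G μ (ζ i)) / N + m * N * ∫ x, f x ∂μ) / (m * N) := by
    simp only [blockAvg]
    rw [integral_div, integral_add ((integrable_finsetSum _ fun i _ =>
      integrable_cEnt_condExpKernel hG (hζ i)).div_const _) hbi.integral_condExpKernel, hI,
      integral_div, integral_finsetSum _ fun i _ => integrable_cEnt_condExpKernel hG (hζ i)]
    simp_rw [integral_cEnt_condExpKernel hG (hζ _)]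
  rw [hInt, le_div_iff₀ hmN]
  have h2 := Finset.sum_le_sum fun i (_ : i ∈ Finset.range N) => hE i
  rw [Finset.sum_const, Finset.card_range, nsmul_eq_mul, mul_comm, ← le_div_iff₀ hN'] at h2
  have : (c - 1 / N + ∫ x, f x ∂μ) * (m * N) = m * N * c - m + m * N * ∫ x, f x ∂μ := by
    field_simp
  linarith

end FiberPressure

section FiberPressureBound

open ProbabilityTheory

variable {G : MeasurableSpace X} [MetricSpace X] [CompactSpace X] [mX : MeasurableSpace X] [BorelSpace X]
  {μ : Measure X} [IsProbabilityMeasure μ] {ι κ : Type*} [Fintype ι] [Fintype κ] {S : X → X} {f : X → ℝ}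

lemma ae_sub_le_pres_support (hS : Continuous S) (hSμ : Ergodic S μ) (hf : Continuous f) (hG : G ≤ mX)
    (hGS : G.comap S = G) {η : X → ι} (hη : sig η ≤ mX) {c : ℝ}
    (hc : ∀ n : ℕ, n * c ≤ cEnt G μ (itin S η n)) {N : ℕ} (hN : 0 < N) :
    ∀ᵐ x ∂μ, ((c + ∫ x, f x ∂μ - 4 / N : ℝ) : EReal) ≤ pres S f (condExpKernel μ G x).support := by
  have hN' : (0 : ℝ) < N := Nat.cast_pos.2 hN
  have hSμ' := hSμ.toMeasurePreserving
  obtain ⟨β, hβ, hβη, hβδ⟩ := exists_inner_code (μ := μ) (sig_itin_le hSμ' hη N)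
  obtain ⟨M, hM0, hM⟩ := exists_bound hf
  have hfδ : ∀ᶠ δ in 𝓝[>] (0 : ℝ), ∀ x y, dist x y ≤ δ → f x ≤ f y + 1 / N := by
    obtain ⟨δ, hδ, h⟩ := Metric.uniformContinuous_iff.1
      (CompactSpace.uniformContinuous_of_continuous hf) (1 / N) (by positivity)
    filter_upwards [Ioo_mem_nhdsGT hδ] with δ' hδ' x y hxy
    have := h (hxy.trans_lt hδ'.2)
    rw [Real.dist_eq] at this
    linarith [(abs_lt.1 this).2]
  obtain ⟨δ, ⟨hβδ, hfδ⟩, hδ⟩ := ((hβδ.and hfδ).and self_mem_nhdsWithin).exists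
  have hδ : 0 < δ := hδ
  have hβj : ∀ j, sig (β ∘ S^[j]) ≤ mX := fun j => sig_comp_iterate_le hSμ' hβ j
  have hr : Tendsto (fun m : ℕ => ((Fintype.card (Option (Fin N → ι)) : ℕ) + 2 * M) / (m : ℝ)) atTop (𝓝 0) :=
    tendsto_const_div_atTop_nhds_zero_nat _
  have key := Ergodic.ae_frequently_lt hSμ
    (F := fun m x => blockAvg S f β N m (condExpKernel μ G x))
    (fun m => measurable_blockAvg hS.measurable hG hβj hf.measurable m)
    (fun m => ae_of_all _ fun x => abs_blockAvg_le hM hβj hN m) hr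
    (fun m => abs_blockAvg_comp_sub_le hSμ' hG hGS hβ hf.measurable hM hN m)
    (c := c - 1 / N + ∫ x, f x ∂μ)
    ((eventually_gt_atTop 0).mono fun m hm =>
      le_integral_blockAvg hSμ' hG hGS hη hc hβ hβη hf.measurable hM hN hm)
  filter_upwards [key] with x hx
  have h1 := (hx (c + ∫ x, f x ∂μ - 2 / N) (by
    have : (1 : ℝ) / N < 2 / N := by gcongr; norm_num
    linarith)).and_eventually (eventually_gt_atTop 0)
  refine le_trans ?_ (le_iSup₂ (f := fun (δ : ℝ) (_ : 0 < δ) => atTop.limsup fun n : ℕ =>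
    ((Real.log (sepPn S f n δ (condExpKernel μ G x).support) / n : ℝ) : EReal)) δ hδ)
  refine le_limsup_of_frequently_le ?_
  refine (tendsto_id.atTop_mul_const' hN : Tendsto (fun m : ℕ => m * N) atTop atTop).frequently
    (h1.mono fun m hm => ?_)
  have h2 := blockAvg_le (ν := condExpKernel μ G x) hS hf hβ hδ hβδ hfδ hN hm.2
  have h3 : Real.log 2 / N ≤ 1 / N := by
    gcongr
    linarith [Real.log_two_lt_d9]
  have h4 : (4 : ℝ) / N = 2 / N + 1 / N + 1 / N := by ring
  have h5 := hm.1
  exact EReal.coe_le_coe_iff.2 (by linarith)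

/-- The fiber measures over an invariant σ-algebra are carried by sets of large pressure. -/
theorem ae_le_pres_support (hS : Continuous S) (hSμ : Ergodic S μ) (hf : Continuous f) (hG : G ≤ mX)
    (hGS : G.comap S = G) {η : X → ι} (hη : sig η ≤ mX) {c : ℝ}
    (hc : ∀ n : ℕ, n * c ≤ cEnt G μ (itin S η n)) :
    ∀ᵐ x ∂μ, ((c + ∫ x, f x ∂μ : ℝ) : EReal) ≤ pres S f (condExpKernel μ G x).support := by
  filter_upwards [ae_all_iff.2 fun N : ℕ =>
    ae_sub_le_pres_support hS hSμ hf hG hGS hη hc N.succ_pos] with x hx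
  refine EReal.ge_of_forall_gt_iff_ge.1 fun z hz => ?_
  have hz : z < c + ∫ x, f x ∂μ := EReal.coe_lt_coe_iff.1 hz
  have h := (tendsto_const_div_atTop_nhds_zero_nat (4 : ℝ)).comp (tendsto_add_atTop_nat 1)
  obtain ⟨N, hN⟩ := (h.eventually (gt_mem_nhds (sub_pos.2 hz))).exists
  refine le_trans (EReal.coe_le_coe_iff.2 ?_) (hx N)
  simp only [Function.comp_apply] at hN
  rw [Nat.succ_eq_add_one]
  linarith

end FiberPressureBound

section PressureOfSupports

open ProbabilityTheory

lemma pres_zero_le_zero_of_subsingleton [MetricSpace X] (S : X → X) {K : Set X} (hK : K.Subsingleton) :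
    pres S (fun _ => 0) K ≤ 0 := by
  refine iSup₂_le fun δ _ => limsup_le_of_le (by isBoundedDefault) (Eventually.of_forall fun n => ?_)
  have h0 : 0 ≤ sepPn S (fun _ => (0 : ℝ)) n δ K := Real.sSup_nonneg (by
    rintro _ ⟨E, -, -, rfl⟩
    exact Finset.sum_nonneg fun _ _ => (Real.exp_pos _).le)
  have h1 : sepPn S (fun _ => (0 : ℝ)) n δ K ≤ 1 := Real.sSup_le (by
    rintro _ ⟨E, hE, -, rfl⟩
    have : E.card ≤ 1 := Finset.card_le_one.2 fun a ha b hb => hK (hE ha) (hE hb)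
    simpa [birk] using this) zero_le_one
  have : Real.log (sepPn S (fun _ => (0 : ℝ)) n δ K) / n ≤ 0 :=
    div_nonpos_of_nonpos_of_nonneg (Real.log_nonpos h0 h1) (Nat.cast_nonneg n)
  exact_mod_cast this

lemma sig_itin_symm_comp {ι : Type*} [Finite ι] (T : X ≃ X) (η : X → ι) (n : ℕ) :
    sig (itin T.symm η n ∘ T^[n]) = sig (itin T (η ∘ T) n) := by
  have key : ∀ i j, i + j + 1 = n → (η ∘ T.symm^[i]) ∘ T^[n] = (η ∘ T) ∘ T^[j] := by
    rintro i j rfl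
    funext x
    have h : T.symm^[i] (T^[i] (T^[j + 1] x)) = T^[j + 1] x :=
      (Function.LeftInverse.iterate T.symm_apply_apply i) _
    simp only [Function.comp_apply, ← Function.iterate_succ_apply' (⇑T)]
    rw [← h, ← Function.iterate_add_apply (⇑T), add_assoc]
  apply le_antisymm
  · have e : itin T.symm η n ∘ T^[n] = tup (fun i => (η ∘ T.symm^[i]) ∘ T^[n]) n := rfl
    rw [e, sig_tup_le_iff]
    intro i hi
    rw [key i (n - 1 - i) (by omega)]
    exact sig_itin_le_iff.1 le_rfl _ (by omega)
  · rw [sig_itin_le_iff]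
    intro j hj
    rw [← key (n - 1 - j) j (by omega)]
    exact sig_tup_le_iff (ξ := fun i => (η ∘ T.symm^[i]) ∘ T^[n]).1 le_rfl _ (by omega)

lemma cEnt_itin_symm {ι : Type*} [Fintype ι] {G : MeasurableSpace X} [mX : MeasurableSpace X] {μ : Measure X}
    [IsProbabilityMeasure μ] {T : X ≃ᵐ X} (hT : MeasurePreserving T μ μ) (hG : G ≤ mX)
    (hGT : G.comap T = G) {η : X → ι} (hη : sig η ≤ mX) (n : ℕ) :
    cEnt G μ (itin T.symm η n) = cEnt G μ (itin T η n) := by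
  have hT' : MeasurePreserving T.symm μ μ := hT.symm T
  have h1 := cEnt_comp (hT.iterate n) hG (sig_itin_le hT' hη n)
  rw [comap_iterate_eq hGT] at h1
  have h2 := cEnt_comp hT hG (sig_itin_le hT hη n)
  rw [hGT] at h2
  rw [← h1, ← h2]
  have e : itin T η n ∘ T = itin T (η ∘ T) n := by
    funext x i
    change η (T^[i] (T x)) = η (T (T^[i] x))
    rw [← Function.iterate_succ_apply, Function.iterate_succ_apply']
  rw [e]
  refine cEnt_congr_sig hG ?_ (sig_itin_symm_comp T.toEquiv η n)
  rw [sig_comp]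
  exact comap_iterate_le_borel hT (sig_itin_le hT' hη n) n

variable {G : MeasurableSpace X} [MetricSpace X] [CompactSpace X] [mX : MeasurableSpace X] [BorelSpace X]
  {μ : Measure X} [IsProbabilityMeasure μ] {S : X → X} {f : X → ℝ}

lemma ae_add_le_pres_support (hS : Continuous S) (hSμ : Ergodic S μ) (hf : Continuous f) (hG : G ≤ mX)
    (hGS : G.comap S = G) {e : EReal} (he : ∀ c : ℝ, c < e → ∃ q : ℕ, ∃ η : X → (Fin q → Prop),
      sig η ≤ mX ∧ ∀ n : ℕ, n * c ≤ cEnt G μ (itin S η n)) :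
    ∀ᵐ x ∂μ, e + ((∫ x, f x ∂μ : ℝ) : EReal) ≤ pres S f (condExpKernel μ G x).support := by
  have h : ∀ q : ℚ, ∀ᵐ x ∂μ, ((q : ℝ) : EReal) < e →
      (((q : ℝ) + ∫ x, f x ∂μ : ℝ) : EReal) ≤ pres S f (condExpKernel μ G x).support := fun q => by
    by_cases hq : ((q : ℝ) : EReal) < e
    · obtain ⟨k, η, hη, hc⟩ := he q hq
      filter_upwards [ae_le_pres_support hS hSμ hf hG hGS hη hc] with x hx _ using hx
    · exact ae_of_all _ fun x h => absurd h hq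
  filter_upwards [ae_all_iff.2 h] with x hx
  refine EReal.ge_of_forall_gt_iff_ge.1 fun z hz => ?_
  have h1 : ((z - ∫ x, f x ∂μ : ℝ) : EReal) < e := by
    rw [EReal.coe_sub]
    exact EReal.sub_lt_of_lt_add hz
  obtain ⟨q, hq1, hq2⟩ := EReal.lt_iff_exists_rat_btwn.1 h1
  refine le_trans (EReal.coe_le_coe_iff.2 ?_) (hx q hq2)
  have := EReal.coe_lt_coe_iff.1 hq1
  linarith

lemma ae_nontrivial_support (hS : Continuous S) (hSμ : Ergodic S μ) (hG : G ≤ mX)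
    (hGS : G.comap S = G) {e : EReal} (he0 : 0 < e) (he : ∀ c : ℝ, c < e → ∃ q : ℕ, ∃ η : X → (Fin q → Prop),
      sig η ≤ mX ∧ ∀ n : ℕ, n * c ≤ cEnt G μ (itin S η n)) :
    ∀ᵐ x ∂μ, (condExpKernel μ G x).support.Nontrivial := by
  filter_upwards [ae_add_le_pres_support (f := fun _ => 0) hS hSμ continuous_const hG hGS he] with x hx
  by_contra h
  have := pres_zero_le_zero_of_subsingleton S (not_nontrivial_iff.1 h)
  simp only [integral_zero, EReal.coe_zero, add_zero] at hx
  exact absurd (hx.trans this) (not_le.2 he0)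

end PressureOfSupports

section ReverseMartingale

lemma aestronglyMeasurable_iInf {𝒜 : ℕ → MeasurableSpace X} [mX : MeasurableSpace X] {μ : Measure X}
    (h𝒜 : Antitone 𝒜) {v : X → ℝ} (hv : ∀ n, AEStronglyMeasurable[𝒜 n] v μ) :
    AEStronglyMeasurable[⨅ n, 𝒜 n] v μ := by
  choose w hw hvw using hv
  refine ⟨fun x => limsup (fun k => w k x) atTop, ?_, ?_⟩
  · refine Measurable.stronglyMeasurable (fun s hs => ?_ : Measurable[⨅ n, 𝒜 n] _)
    rw [MeasurableSpace.measurableSet_iInf]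
    intro n
    have : (fun x => limsup (fun k => w k x) atTop) = fun x => limsup (fun k => w (k + n) x) atTop := by
      funext x
      exact (limsup_nat_add (fun k => w k x) n).symm
    rw [this]
    have hm : Measurable[𝒜 n] fun x => limsup (fun k => w (k + n) x) atTop :=
      Measurable.limsup fun k => ((hw (k + n)).mono (h𝒜 (Nat.le_add_left n k))).measurable
    exact hm hs
  · filter_upwards [ae_all_iff.2 hvw] with x hx
    simp [← hx]

variable {𝒜 : ℕ → MeasurableSpace X} [mX : MeasurableSpace X] {μ : Measure X} [IsProbabilityMeasure μ]
  {f : X → ℝ}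

lemma exists_tendsto_condExpL2 (h𝒜 : Antitone 𝒜) (hle : ∀ n, 𝒜 n ≤ mX) (g : Lp ℝ 2 μ) :
    ∃ v : Lp ℝ 2 μ, Tendsto (fun n => (condExpL2 ℝ ℝ (hle n) g : Lp ℝ 2 μ)) atTop (𝓝 v) := by
  have hF : ∀ n, Fact (𝒜 n ≤ mX) := fun n => ⟨hle n⟩
  have hmono : Monotone fun n => (lpMeas ℝ ℝ (𝒜 n) 2 μ)ᗮ := fun a b hab =>
    Submodule.orthogonal_le fun w hw => mem_lpMeas_iff_aestronglyMeasurable.2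
      ((mem_lpMeas_iff_aestronglyMeasurable.1 hw).mono (h𝒜 hab))
  have h := Submodule.starProjection_tendsto_closure_iSup _ hmono g
  refine ⟨_, (tendsto_const_nhds (x := g)).sub h |>.congr fun n => ?_⟩
  rw [Submodule.starProjection_orthogonal']
  show g - (g - (lpMeas ℝ ℝ (𝒜 n) 2 μ).starProjection g) = _
  rw [sub_sub_cancel]
  rfl

/-- The reverse martingale convergence theorem, in `L¹`. -/
theorem tendsto_integral_abs_condExp_sub_iInf (h𝒜 : Antitone 𝒜) (hle : ∀ n, 𝒜 n ≤ mX)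
    (hf : MemLp f 2 μ) :
    Tendsto (fun n => ∫ x, |(μ[f | 𝒜 n]) x - (μ[f | ⨅ n, 𝒜 n]) x| ∂μ) atTop (𝓝 0) := by
  have hG : (⨅ n, 𝒜 n) ≤ mX := (iInf_le _ 0).trans (hle 0)
  obtain ⟨v, hv⟩ := exists_tendsto_condExpL2 h𝒜 hle hf.toLp
  have hfi : Integrable f μ := hf.integrable one_le_two
  have hvi : Integrable v μ := (Lp.memLp v).integrable one_le_two
  have hmeas : AEStronglyMeasurable[⨅ n, 𝒜 n] v μ := by
    refine aestronglyMeasurable_iInf h𝒜 fun n => ?_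
    refine (isClosed_aestronglyMeasurable (F := ℝ) (p := 2) (hle n)).mem_of_tendsto hv ?_
    filter_upwards [eventually_ge_atTop n] with k hk
    exact (aestronglyMeasurable_condExpL2 (hle k) _).mono (h𝒜 hk)
  have hnorm : Tendsto (fun n => ‖(condExpL2 ℝ ℝ (hle n) hf.toLp : Lp ℝ 2 μ) - v‖) atTop (𝓝 0) :=
    tendsto_iff_norm_sub_tendsto_zero.1 hv
  have hL1 : Tendsto (fun n => ∫ x, |(μ[f | 𝒜 n]) x - v x| ∂μ) atTop (𝓝 0) := by
    refine squeeze_zero (fun n => integral_nonneg fun x => abs_nonneg _) (fun n => ?_) hnorm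
    have h1 : ((condExpL2 ℝ ℝ (hle n) hf.toLp : Lp ℝ 2 μ) - v : Lp ℝ 2 μ) =ᵐ[μ]
        fun x => (μ[f | 𝒜 n]) x - v x := by
      filter_upwards [Lp.coeFn_sub (condExpL2 ℝ ℝ (hle n) hf.toLp : Lp ℝ 2 μ) v,
        hf.condExpL2_ae_eq_condExp (𝕜 := ℝ) (hle n)] with x hx hx'
      rw [hx, Pi.sub_apply, hx']
    have h2 : Integrable (fun x => (μ[f | 𝒜 n]) x - v x) μ := integrable_condExp.sub hvi
    have h3 : ∫ x, |(μ[f | 𝒜 n]) x - v x| ∂μ =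
        (eLpNorm (fun x => (μ[f | 𝒜 n]) x - v x) 1 μ).toReal := by
      rw [eLpNorm_one_eq_lintegral_enorm, ← integral_norm_eq_lintegral_enorm h2.1]
      rfl
    rw [h3, Lp.norm_def, eLpNorm_congr_ae h1]
    have h4 := (Lp.memLp ((condExpL2 ℝ ℝ (hle n) hf.toLp : Lp ℝ 2 μ) - v)).2
    rw [eLpNorm_congr_ae h1] at h4
    exact ENNReal.toReal_mono h4.ne (eLpNorm_le_eLpNorm_of_exponent_le one_le_two h2.1)
  have hvG : μ[v | ⨅ n, 𝒜 n] =ᵐ[μ] v :=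
    condExp_of_aestronglyMeasurable' hG hmeas hvi
  have hzero : ∫ x, |(μ[f | ⨅ n, 𝒜 n]) x - v x| ∂μ = 0 := by
    refine le_antisymm (ge_of_tendsto' hL1 fun n => ?_) (integral_nonneg fun x => abs_nonneg _)
    refine le_trans (le_of_eq (integral_congr_ae ?_))
      (integral_abs_condExp_le (m := ⨅ n, 𝒜 n) (fun x => (μ[f | 𝒜 n]) x - v x))
    filter_upwards [condExp_sub (μ := μ) (m := ⨅ n, 𝒜 n) (integrable_condExp (m := 𝒜 n) (f := f)) hvi,
      condExp_condExp_of_le (μ := μ) (f := f) (iInf_le 𝒜 n) (hle n), hvG] with x h1 h2 h3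
    have : (μ[fun x => (μ[f | 𝒜 n]) x - v x | ⨅ n, 𝒜 n]) x = (μ[μ[f | 𝒜 n] - ⇑v | ⨅ n, 𝒜 n]) x := rfl
    rw [this, h1, Pi.sub_apply, h2, h3]
  have hae : μ[f | ⨅ n, 𝒜 n] =ᵐ[μ] v := by
    have hInt : Integrable (fun x => (μ[f | ⨅ n, 𝒜 n]) x - v x) μ := integrable_condExp.sub hvi
    rw [integral_eq_zero_iff_of_nonneg (fun x => abs_nonneg _) hInt.abs] at hzero
    filter_upwards [hzero] with x hx
    exact sub_eq_zero.1 (abs_eq_zero.1 hx)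
  refine hL1.congr fun n => integral_congr_ae ?_
  filter_upwards [hae] with x hx
  rw [hx]

end ReverseMartingale

section ConditionalMixing

/-- Mixing conditionally on the σ-algebra `G`, uniformly in `L¹`. -/
def IsCondMixing (G : MeasurableSpace X) [mX : MeasurableSpace X] (μ : Measure X) (S : X → X) : Prop :=
  ∀ U V, MeasurableSet U → MeasurableSet V → Tendsto (fun m => ∫ x, |(μ⟦U ∩ S^[m] ⁻¹' V | G⟧) x -
    (μ⟦U | G⟧) x * (μ⟦V | G⟧) (S^[m] x)| ∂μ) atTop (𝓝 0)

variable {G B 𝒜 : MeasurableSpace X} [mX : MeasurableSpace X] {μ : Measure X} [IsProbabilityMeasure μ]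
  {h w : X → ℝ}

lemma integrable_mul_of_abs_le (hh : Integrable h μ) (hw : AEStronglyMeasurable w μ)
    (hw1 : ∀ᵐ x ∂μ, |w x| ≤ 1) : Integrable (h * w) μ :=
  hh.mul_bdd (c := 1) hw hw1

lemma integral_abs_condExp_mul_le (hGB : G ≤ B) (hB : B ≤ mX) (hh : Integrable h μ)
    (hw : AEStronglyMeasurable[B] w μ) (hw1 : ∀ᵐ x ∂μ, |w x| ≤ 1) :
    ∫ x, |(μ[h * w | G]) x| ∂μ ≤ ∫ x, |(μ[h | B]) x| ∂μ := by
  have hw' : AEStronglyMeasurable w μ := hw.mono hB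
  have hhw := integrable_mul_of_abs_le hh hw' hw1
  have h1 : μ[h * w | G] =ᵐ[μ] μ[μ[h | B] * w | G] :=
    (condExp_condExp_of_le hGB hB).symm.trans
      (condExp_congr_ae (condExp_mul_of_aestronglyMeasurable_right hw hhw hh))
  have h2 := integrable_mul_of_abs_le (integrable_condExp (f := h) (m := B)) hw' hw1
  calc ∫ x, |(μ[h * w | G]) x| ∂μ = ∫ x, |(μ[μ[h | B] * w | G]) x| ∂μ :=
        integral_congr_ae (h1.mono fun x hx => by simp only [hx])
    _ ≤ ∫ x, |(μ[h | B] * w) x| ∂μ := integral_abs_condExp_le _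
    _ ≤ ∫ x, |(μ[h | B]) x| ∂μ := by
        refine integral_mono_ae h2.abs integrable_condExp.abs ?_
        filter_upwards [hw1] with x hx
        rw [Pi.mul_apply, abs_mul]
        exact mul_le_of_le_one_right (abs_nonneg _) hx

lemma comap_iterate_comap_symm_iterate (T : X ≃ᵐ X) {k m : ℕ} (hkm : k ≤ m) :
    (𝒜.comap T.symm^[k]).comap T^[m] = 𝒜.comap T^[m - k] := by
  rw [MeasurableSpace.comap_comp]
  congr 1
  obtain ⟨n, rfl⟩ := Nat.exists_eq_add_of_le hkm
  rw [Nat.add_sub_cancel_left, Function.iterate_add, ← Function.comp_assoc]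
  have : T.symm^[k] ∘ T^[k] = id :=
    (Function.LeftInverse.iterate (fun x => T.symm_apply_apply x) k).comp_eq_id
  rw [this, Function.id_comp]

lemma exists_integral_abs_sub_condExp_lt {c : ℕ → MeasurableSpace X} (hc : Monotone c)
    (hcX : ∀ n, c n ≤ mX) (hsup : ⨆ n, c n = mX) {f : X → ℝ} (hf : Integrable f μ) {ε : ℝ} (hε : 0 < ε) :
    ∃ k, ∫ x, |f x - (μ[f | c k]) x| ∂μ < ε := by
  let ℱ : Filtration ℕ mX := ⟨c, hc, hcX⟩
  have h1 := tendsto_eLpNorm_condExp (μ := μ) (ℱ := ℱ) f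
  have h2 : μ[f | ⨆ n, ℱ n] =ᵐ[μ] f := by
    have : (⨆ n, (ℱ n : MeasurableSpace X)) = mX := hsup
    rw [this]
    exact condExp_of_aestronglyMeasurable' le_rfl hf.1 hf
  obtain ⟨k, hk⟩ := ((tendsto_order.1 h1).2 (ENNReal.ofReal ε) (ENNReal.ofReal_pos.2 hε)).exists
  refine ⟨k, ?_⟩
  have h3 : eLpNorm (μ[f | ℱ k] - μ[f | ⨆ n, ℱ n]) 1 μ = eLpNorm (fun x => f x - (μ[f | c k]) x) 1 μ := by
    rw [← eLpNorm_neg]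
    refine eLpNorm_congr_ae (h2.mono fun x hx => ?_)
    simp only [Pi.neg_apply, Pi.sub_apply, hx, neg_sub]
    rfl
  rw [h3, eLpNorm_one_eq_lintegral_enorm] at hk
  have h4 : Integrable (fun x => f x - (μ[f | c k]) x) μ := hf.sub integrable_condExp
  calc ∫ x, |f x - (μ[f | c k]) x| ∂μ = (∫⁻ x, ‖f x - (μ[f | c k]) x‖ₑ ∂μ).toReal :=
        integral_norm_eq_lintegral_enorm h4.1
    _ < ε := by rwa [← ENNReal.lt_ofReal_iff_toReal_lt h4.2.ne]

lemma integral_abs_condProb_sub_le {T : X ≃ᵐ X} (hT : MeasurePreserving T μ μ) (h𝒜 : 𝒜 ≤ mX)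
    (hG : G ≤ mX)
    (hGn : ∀ n, G ≤ 𝒜.comap T^[n]) (hGT : G.comap T = G) {U V : Set X} (hU : MeasurableSet U) (hV : MeasurableSet V) {k m : ℕ}
    (hkm : k ≤ m) :
    ∫ x, |(μ⟦U ∩ T^[m] ⁻¹' V | G⟧) x - (μ⟦U | G⟧) x * (μ⟦V | G⟧) (T^[m] x)| ∂μ ≤
      ∫ x, |(μ⟦U | 𝒜.comap T^[m - k]⟧) x - (μ⟦U | G⟧) x| ∂μ +
      ∫ x, |V.indicator (fun _ => (1 : ℝ)) x - (μ⟦V | 𝒜.comap T.symm^[k]⟧) x| ∂μ := by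
  have hB : 𝒜.comap T^[m - k] ≤ mX := comap_iterate_le_borel hT h𝒜 _
  have hC : 𝒜.comap T.symm^[k] ≤ mX := comap_iterate_le_borel (hT.symm T) h𝒜 _
  have hTm : MeasurePreserving T^[m] μ μ := hT.iterate m
  set a := μ⟦U | G⟧ with ha
  set u : X → ℝ := U.indicator fun _ => 1 with hu
  set v : X → ℝ := V.indicator fun _ => 1 with hv
  set g := μ⟦V | 𝒜.comap T.symm^[k]⟧ with hg
  have hui : Integrable u μ := integrable_indicator_one hU
  have hvi : Integrable v μ := integrable_indicator_one hV
  have hu1 : ∀ x, u x ∈ Icc (0 : ℝ) 1 := fun x => by by_cases hx : x ∈ U <;> simp [hu, hx]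
  have hv1 : ∀ x, v x ∈ Icc (0 : ℝ) 1 := fun x => by by_cases hx : x ∈ V <;> simp [hv, hx]
  have ha1 : ∀ᵐ x ∂μ, a x ∈ Icc (0 : ℝ) 1 := condProb_mem hG hU
  have hg1 : ∀ᵐ x ∂μ, g x ∈ Icc (0 : ℝ) 1 := condProb_mem hC hV
  have habs : ∀ t : ℝ, t ∈ Icc (0 : ℝ) 1 → |t| ≤ 1 := fun t ht => by
    rw [abs_of_nonneg ht.1]; exact ht.2
  have hai : Integrable a μ := integrable_condExp
  have hgi : Integrable g μ := integrable_condExp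
  have hh : Integrable (u - a) μ := hui.sub hai
  have hvT : Integrable (v ∘ T^[m]) μ := hTm.integrable_comp_of_integrable hvi
  have hgT : Integrable (g ∘ T^[m]) μ := hTm.integrable_comp_of_integrable hgi
  have hgT1 : ∀ᵐ x ∂μ, |(g ∘ T^[m]) x| ≤ 1 :=
    (hTm.quasiMeasurePreserving.ae hg1).mono fun x hx => habs _ hx
  have hvT1 : ∀ᵐ x ∂μ, |(v ∘ T^[m]) x| ≤ 1 := ae_of_all _ fun x => habs _ (hv1 _)
  have hgB : AEStronglyMeasurable[𝒜.comap T^[m - k]] (g ∘ T^[m]) μ := by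
    rw [← comap_iterate_comap_symm_iterate T hkm]
    exact (stronglyMeasurable_condExp.comp_measurable (comap_measurable T^[m])).aestronglyMeasurable
  have huv : U.indicator (fun _ => (1 : ℝ)) * (v ∘ T^[m]) = (U ∩ T^[m] ⁻¹' V).indicator fun _ => 1 := by
    funext x
    by_cases h1 : x ∈ U <;> by_cases h2 : T^[m] x ∈ V <;> simp [hv, h1, h2]
  have hint1 := integrable_mul_of_abs_le hui hvT.1 hvT1
  have hint2 := integrable_mul_of_abs_le hai hvT.1 hvT1
  have hint3 := integrable_mul_of_abs_le hh hvT.1 hvT1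
  have hint4 := integrable_mul_of_abs_le hh hgT.1 hgT1
  have e1 : μ[a * (v ∘ T^[m]) | G] =ᵐ[μ] fun x => a x * (μ⟦V | G⟧) (T^[m] x) := by
    have e2 : μ[v ∘ T^[m] | G] =ᵐ[μ] μ⟦V | G⟧ ∘ T^[m] := by
      have := condExp_comp_comap (μ := μ) hTm hG hvi
      rwa [comap_iterate_eq hGT m] at this
    filter_upwards [condExp_mul_of_stronglyMeasurable_left (stronglyMeasurable_condExp) hint2 hvT, e2]
      with x h1 h2
    rw [h1, Pi.mul_apply, h2]
    rfl
  have e3 : (fun x => (μ⟦U ∩ T^[m] ⁻¹' V | G⟧) x - a x * (μ⟦V | G⟧) (T^[m] x)) =ᵐ[μ]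
      μ[(u - a) * (v ∘ T^[m]) | G] := by
    rw [sub_mul]
    filter_upwards [e1, condExp_sub (m := G) hint1 hint2] with x h1 h2
    rw [h2, Pi.sub_apply, h1, hu, huv]
  have e4 : ∀ᵐ x ∂μ, |(μ[(u - a) * (v ∘ T^[m]) | G]) x| ≤
      |(μ[(u - a) * (g ∘ T^[m]) | G]) x| +
      |(μ[(u - a) * (v ∘ T^[m]) - (u - a) * (g ∘ T^[m]) | G]) x| := by
    filter_upwards [condExp_sub (m := G) hint3 hint4] with x hx
    rw [hx, Pi.sub_apply]
    have := abs_sub_abs_le_abs_sub ((μ[(u - a) * (v ∘ T^[m]) | G]) x) ((μ[(u - a) * (g ∘ T^[m]) | G]) x)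
    linarith
  have b1 : ∫ x, |(μ[(u - a) * (g ∘ T^[m]) | G]) x| ∂μ ≤ ∫ x, |(μ⟦U | 𝒜.comap T^[m - k]⟧) x - a x| ∂μ := by
    refine (integral_abs_condExp_mul_le (hGn _) hB hh hgB hgT1).trans (le_of_eq ?_)
    refine integral_congr_ae ?_
    filter_upwards [condExp_sub (m := 𝒜.comap T^[m - k]) hui hai] with x hx
    rw [hx, Pi.sub_apply, condExp_of_stronglyMeasurable hB
      (stronglyMeasurable_condExp.mono (hGn (m - k))) hai]
  have b2 : ∫ x, |(μ[(u - a) * (v ∘ T^[m]) - (u - a) * (g ∘ T^[m]) | G]) x| ∂μ ≤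
      ∫ x, |v x - g x| ∂μ := by
    refine (integral_abs_condExp_le _).trans ?_
    have hvg : Integrable (fun x => |v x - g x|) μ := (hvi.sub hgi).abs
    have hmap : ∫ x, |v x - g x| ∂μ = ∫ x, |v (T^[m] x) - g (T^[m] x)| ∂μ := by
      conv_lhs => rw [← hTm.map_eq]
      exact integral_map hTm.aemeasurable (by rw [hTm.map_eq]; exact hvg.1)
    rw [hmap]
    refine integral_mono_ae (hint3.sub hint4).abs (hTm.integrable_comp_of_integrable hvg) ?_
    filter_upwards [ha1] with x hx
    have h1 := hu1 x
    simp only [Pi.sub_apply, Pi.mul_apply, Function.comp_apply, ← mul_sub, abs_mul]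
    refine mul_le_of_le_one_left (abs_nonneg _) (abs_le.2 ⟨?_, ?_⟩) <;> linarith [hx.1, hx.2, h1.1, h1.2]
  calc _ = ∫ x, |(μ[(u - a) * (v ∘ T^[m]) | G]) x| ∂μ :=
        integral_congr_ae (e3.mono fun x hx => congrArg abs hx)
    _ ≤ ∫ x, (|(μ[(u - a) * (g ∘ T^[m]) | G]) x| +
        |(μ[(u - a) * (v ∘ T^[m]) - (u - a) * (g ∘ T^[m]) | G]) x|) ∂μ :=
        integral_mono_ae integrable_condExp.abs (integrable_condExp.abs.add integrable_condExp.abs) e4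
    _ = _ := integral_add integrable_condExp.abs integrable_condExp.abs
    _ ≤ _ := add_le_add b1 b2

end ConditionalMixing

section MixingOnSupports

open ProbabilityTheory

variable {G 𝒜 : MeasurableSpace X} [mX : MeasurableSpace X] {μ : Measure X} [IsProbabilityMeasure μ]

lemma antitone_comap_iterate {T : X → X} (h𝒜T : 𝒜.comap T ≤ 𝒜) : Antitone fun n => 𝒜.comap T^[n] :=
  antitone_nat_of_succ_le fun n => by
    rw [Function.iterate_succ', ← MeasurableSpace.comap_comp]
    exact MeasurableSpace.comap_mono h𝒜T

lemma monotone_comap_symm_iterate {T : X ≃ᵐ X} (h𝒜T : 𝒜.comap T ≤ 𝒜) :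
    Monotone fun n => 𝒜.comap T.symm^[n] :=
  monotone_nat_of_le_succ fun n => by
    rw [Function.iterate_succ', ← MeasurableSpace.comap_comp]
    refine MeasurableSpace.comap_mono ?_
    have := MeasurableSpace.comap_mono (g := T.symm) h𝒜T
    rwa [MeasurableSpace.comap_comp, T.self_comp_symm, MeasurableSpace.comap_id] at this

theorem isCondMixing_tail {T : X ≃ᵐ X} (hT : MeasurePreserving T μ μ) (h𝒜 : 𝒜 ≤ mX)
    (h𝒜T : 𝒜.comap T ≤ 𝒜) (hsup : ⨆ n, 𝒜.comap T.symm^[n] = mX) : IsCondMixing (tail T 𝒜) μ T := by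
  intro U V hU hV
  have hG : tail T 𝒜 ≤ mX := (tail_le T).trans h𝒜
  refine tendsto_order.2 ⟨fun a ha => Eventually.of_forall fun m =>
    ha.trans_le (integral_nonneg fun x => abs_nonneg _), fun ε hε => ?_⟩
  obtain ⟨k, hk⟩ := exists_integral_abs_sub_condExp_lt (monotone_comap_symm_iterate h𝒜T)
    (fun n => comap_iterate_le_borel (hT.symm T) h𝒜 n) hsup (integrable_indicator_one (μ := μ) hV)
    (half_pos hε)
  have h1 := tendsto_integral_abs_condExp_sub_iInf (μ := μ) (antitone_comap_iterate h𝒜T)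
    (fun n => comap_iterate_le_borel hT h𝒜 n) (f := U.indicator fun _ => 1)
    ((memLp_const 1).indicator hU)
  have h2 := (h1.comp (tendsto_sub_atTop_nat k)).eventually (gt_mem_nhds (half_pos hε))
  filter_upwards [h2, eventually_ge_atTop k] with m hm hkm
  have h3 := integral_abs_condProb_sub_le hT h𝒜 hG (tail_le_comap T) (comap_tail h𝒜T) hU hV hkm
  exact h3.trans_lt (by linarith [show ∫ x, |(μ⟦U | 𝒜.comap T^[m - k]⟧) x - (μ⟦U | tail T 𝒜⟧) x| ∂μ <
    ε / 2 from hm])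

theorem IsCondMixing.symm {T : X ≃ᵐ X} (hT : MeasurePreserving T μ μ) (hG : G ≤ mX)
    (hGT : G.comap T = G) (h : IsCondMixing G μ T) : IsCondMixing G μ T.symm := by
  intro U V hU hV
  refine (h V U hV hU).congr fun m => ?_
  have hTm : MeasurePreserving T^[m] μ μ := hT.iterate m
  have hS : Measurable T.symm^[m] := T.symm.measurable.iterate m
  have hinv : ∀ x, T.symm^[m] (T^[m] x) = x :=
    Function.LeftInverse.iterate (fun x => T.symm_apply_apply x) m
  have hset : T^[m] ⁻¹' (U ∩ T.symm^[m] ⁻¹' V) = V ∩ T^[m] ⁻¹' U := by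
    ext x; simp [hinv, and_comm]
  have hW := hU.inter (hS hV)
  have e1 : μ⟦V ∩ T^[m] ⁻¹' U | G⟧ =ᵐ[μ] μ⟦U ∩ T.symm^[m] ⁻¹' V | G⟧ ∘ T^[m] := by
    have := condExp_comp_comap (μ := μ) hTm hG (integrable_indicator_one hW)
    rw [comap_iterate_eq hGT m] at this
    rwa [← hset]
  set F : X → ℝ := fun x => |(μ⟦U ∩ T.symm^[m] ⁻¹' V | G⟧) x -
    (μ⟦U | G⟧) x * (μ⟦V | G⟧) (T.symm^[m] x)| with hF
  have hFm : StronglyMeasurable F := by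
    have hm : ∀ W : Set X, StronglyMeasurable (μ⟦W | G⟧) := fun W => stronglyMeasurable_condExp.mono hG
    exact ((hm _).sub ((hm _).mul ((hm _).comp_measurable hS))).norm
  have hmap : ∫ x, F x ∂μ = ∫ x, F (T^[m] x) ∂μ := by
    conv_lhs => rw [← hTm.map_eq]
    exact integral_map hTm.aemeasurable hFm.aestronglyMeasurable
  rw [hmap]
  refine integral_congr_ae (e1.mono fun x hx => ?_)
  simp only [hF, hinv, hx, Function.comp_apply, mul_comm]

lemma measure_eq_zero_of_tendsto_inter {S : X → X} (hS : MeasurePreserving S μ μ) {D : Set X}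
    (hD : MeasurableSet D) (h : Tendsto (fun m => μ.real (D ∩ S^[m] ⁻¹' D)) atTop (𝓝 0)) :
    μ.real D = 0 := by
  set δ := μ.real D with hδ
  have key : ∀ J : ℕ, 0 < J → J * δ ^ 2 ≤ 2 := by
    intro J hJ
    have hJ' : (0 : ℝ) < J := by exact_mod_cast hJ
    obtain ⟨M, hM⟩ := eventually_atTop.1 (h.eventually (gt_mem_nhds (show (0 : ℝ) < 1 / J by positivity)))
    set K := M + 1 with hK
    set u : ℕ → X → ℝ := fun j => (S^[j * K] ⁻¹' D).indicator fun _ => 1 with hu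
    have hDj : ∀ j, MeasurableSet (S^[j * K] ⁻¹' D) := fun j => (hS.measurable.iterate _) hD
    have hui : ∀ j, Integrable (u j) μ := fun j => integrable_indicator_one (hDj j)
    have hmul : ∀ i j, (fun x => u i x * u j x) =
        ((S^[i * K] ⁻¹' D) ∩ (S^[j * K] ⁻¹' D)).indicator fun _ => (1 : ℝ) := by
      intro i j
      funext x
      by_cases h1 : x ∈ S^[i * K] ⁻¹' D <;> by_cases h2 : x ∈ S^[j * K] ⁻¹' D <;> simp [hu, h1, h2]
    have hInt : ∀ {s : Set X}, MeasurableSet s → ∫ x, s.indicator (fun _ => (1 : ℝ)) x ∂μ = μ.real s :=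
      fun hs => integral_indicator_one hs
    have hu1 : ∀ j, ∫ x, u j x ∂μ = δ := fun j => by
      rw [hInt (hDj j), hδ, (hS.iterate _).measureReal_preimage hD.nullMeasurableSet]
    have huu : ∀ i j, Integrable (fun x => u i x * u j x) μ := fun i j => by
      rw [hmul]; exact integrable_indicator_one ((hDj i).inter (hDj j))
    have hlt : ∀ i j, i < j → ∫ x, u i x * u j x ∂μ ≤ 1 / J := by
      intro i j hij
      rw [hmul, hInt ((hDj i).inter (hDj j))]
      have : S^[i * K] ⁻¹' D ∩ S^[j * K] ⁻¹' D = S^[i * K] ⁻¹' (D ∩ S^[(j - i) * K] ⁻¹' D) := by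
        rw [preimage_inter, ← preimage_comp, ← Function.iterate_add, ← add_mul, Nat.sub_add_cancel hij.le]
      rw [this, (hS.iterate _).measureReal_preimage
        (hD.inter ((hS.measurable.iterate _) hD)).nullMeasurableSet]
      refine (hM _ ?_).le
      have : 1 * K ≤ (j - i) * K := Nat.mul_le_mul_right _ (by omega)
      omega
    have hle : ∀ i j, ∫ x, u i x * u j x ∂μ ≤ 1 / J + if i = j then 1 else 0 := by
      intro i j
      rcases lt_trichotomy i j with hij | hij | hij
      · simpa [hij.ne] using hlt i j hij
      · rw [hmul, hInt ((hDj i).inter (hDj j)), if_pos hij]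
        exact measureReal_le_one.trans (le_add_of_nonneg_left (by positivity))
      · simpa [hij.ne', mul_comm] using hlt j i hij
    have hsq : ∫ x, (∑ j ∈ Finset.range J, u j x) ^ 2 ∂μ ≤ 2 * J := by
      simp_rw [sq, Finset.sum_mul_sum]
      rw [integral_finsetSum (f := fun i x => ∑ j ∈ Finset.range J, u i x * u j x) _
        fun i _ => integrable_finsetSum _ fun j _ => huu i j]
      simp_rw [integral_finsetSum (f := fun j x => u _ x * u j x) _ fun j _ => huu _ j]
      calc _ ≤ ∑ i ∈ Finset.range J, ∑ j ∈ Finset.range J, ((1 : ℝ) / J + if i = j then 1 else 0) :=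
            Finset.sum_le_sum fun i _ => Finset.sum_le_sum fun j _ => hle i j
        _ = ∑ i ∈ Finset.range J, 2 := Finset.sum_congr rfl fun i hi => by
            rw [Finset.sum_add_distrib, Finset.sum_ite_eq, if_pos hi]
            simp only [Finset.sum_const, Finset.card_range, nsmul_eq_mul]
            field_simp
            norm_num
        _ = 2 * J := by simp [mul_comm]
    have hF : Integrable (fun x => ∑ j ∈ Finset.range J, u j x) μ :=
      integrable_finsetSum _ fun j _ => hui j
    have hF2 : Integrable (fun x => (∑ j ∈ Finset.range J, u j x) ^ 2) μ := by
      simp_rw [sq, Finset.sum_mul_sum]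
      exact integrable_finsetSum _ fun i _ => integrable_finsetSum _ fun j _ => huu i j
    have hF1 : ∫ x, ∑ j ∈ Finset.range J, u j x ∂μ = J * δ := by
      rw [integral_finsetSum (f := u) _ fun j _ => hui j]
      simp [hu1]
    have hpos : 0 ≤ ∫ x, ((∑ j ∈ Finset.range J, u j x) - J * δ) ^ 2 ∂μ :=
      integral_nonneg fun x => sq_nonneg _
    have hexp : ∫ x, ((∑ j ∈ Finset.range J, u j x) - J * δ) ^ 2 ∂μ =
        ∫ x, (∑ j ∈ Finset.range J, u j x) ^ 2 ∂μ - (J * δ) ^ 2 := by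
      have : (fun x => ((∑ j ∈ Finset.range J, u j x) - J * δ) ^ 2) = fun x =>
          (∑ j ∈ Finset.range J, u j x) ^ 2 -
            ((2 * (J * δ)) * (∑ j ∈ Finset.range J, u j x) - (J * δ) ^ 2) := by
        funext x; ring
      have hlin : Integrable (fun x => (2 * (J * δ)) * (∑ j ∈ Finset.range J, u j x) - (J * δ) ^ 2) μ :=
        (hF.const_mul _).sub (integrable_const _)
      rw [this, integral_sub hF2 hlin,
        integral_sub (hF.const_mul _) (integrable_const _), integral_const_mul, hF1]
      simp
      ring
    rw [hexp] at hpos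
    have : J * (J * δ ^ 2) ≤ J * 2 := by nlinarith
    exact le_of_mul_le_mul_left this hJ'
  by_contra hne
  have hpos : 0 < δ ^ 2 := by positivity
  obtain ⟨J, hJ⟩ := exists_nat_gt (2 / δ ^ 2)
  have h2 := key (J + 1) J.succ_pos
  rw [div_lt_iff₀ hpos] at hJ
  push_cast at h2
  nlinarith

lemma ae_exists_condProb_inter_pos {S : X → X} (hS : MeasurePreserving S μ μ) (hG : G ≤ mX)
    (hmix : IsCondMixing G μ S) {k : ℕ} {U V : Fin k → Set X} (hU : ∀ i, MeasurableSet (U i))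
    (hV : ∀ i, MeasurableSet (V i)) (N : ℕ) :
    ∀ᵐ x ∂μ, (∀ i, 0 < (μ⟦U i | G⟧) x) → (∀ i, 0 < (μ⟦V i | G⟧) x) →
      ∃ m ≥ N, ∀ i, 0 < (μ⟦U i ∩ S^[m] ⁻¹' V i | G⟧) x := by
  have hm : ∀ W : Set X, Measurable (μ⟦W | G⟧) := fun W => (stronglyMeasurable_condExp.mono hG).measurable
  set D : ℝ → Set X := fun c => {x | (∀ i, c < (μ⟦U i | G⟧) x) ∧ (∀ i, c < (μ⟦V i | G⟧) x) ∧
    ∀ m ≥ N, ∃ i, (μ⟦U i ∩ S^[m] ⁻¹' V i | G⟧) x ≤ 0} with hDdef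
  have hD : ∀ c, MeasurableSet (D c) := fun c => by
    have : D c = (⋂ i, {x | c < (μ⟦U i | G⟧) x}) ∩ ((⋂ i, {x | c < (μ⟦V i | G⟧) x}) ∩
        ⋂ m ≥ N, ⋃ i, {x | (μ⟦U i ∩ S^[m] ⁻¹' V i | G⟧) x ≤ 0}) := by
      ext x
      simp [hDdef]
    rw [this]
    exact (MeasurableSet.iInter fun i => measurableSet_lt measurable_const (hm _)).inter
      ((MeasurableSet.iInter fun i => measurableSet_lt measurable_const (hm _)).inter
      (MeasurableSet.iInter fun m => MeasurableSet.iInter fun _ =>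
        MeasurableSet.iUnion fun i => measurableSet_le (hm _) measurable_const))
  have hzero : ∀ c > 0, μ.real (D c) = 0 := by
    intro c hc
    refine measure_eq_zero_of_tendsto_inter hS (hD c) ?_
    set Q : ℕ → Fin k → X → ℝ := fun m i x => |(μ⟦U i ∩ S^[m] ⁻¹' V i | G⟧) x -
      (μ⟦U i | G⟧) x * (μ⟦V i | G⟧) (S^[m] x)| with hQ
    have hQi : ∀ m i, Integrable (Q m i) μ := fun m i => by
      refine (integrable_condExp.sub (integrable_mul_of_abs_le integrable_condExp
        ((hm (V i)).comp (hS.measurable.iterate m)).aestronglyMeasurable ?_)).abs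
      filter_upwards [(hS.iterate m).quasiMeasurePreserving.ae (condProb_mem hG (hV i))] with x hx
      exact abs_le.2 ⟨by linarith [hx.1, show ((μ⟦V i | G⟧) ∘ S^[m]) x = (μ⟦V i | G⟧) (S^[m] x) from rfl], hx.2⟩
    have h0 : Tendsto (fun m => (1 / c ^ 2) * ∑ i, ∫ x, Q m i x ∂μ) atTop (𝓝 0) := by
      have := (tendsto_finsetSum Finset.univ fun i _ => hmix (U i) (V i) (hU i) (hV i)).const_mul (1 / c ^ 2)
      simpa using this
    refine squeeze_zero' (Eventually.of_forall fun _ => measureReal_nonneg) ?_ h0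
    filter_upwards [eventually_ge_atTop N] with m hmN
    have hE : MeasurableSet (D c ∩ S^[m] ⁻¹' D c) := (hD c).inter ((hS.measurable.iterate m) (hD c))
    rw [one_div, ← div_eq_inv_mul, le_div_iff₀ (by positivity), ← integral_finsetSum _ fun i _ => hQi m i,
      ← integral_indicator_one hE, ← integral_mul_const]
    refine integral_mono (((integrable_const (1 : ℝ)).indicator hE).mul_const _)
      (integrable_finsetSum _ fun i _ => hQi m i) fun x => ?_
    by_cases hx : x ∈ D c ∩ S^[m] ⁻¹' D c
    · simp only [indicator_of_mem hx, Pi.one_apply, one_mul]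
      obtain ⟨⟨h1, -, h2⟩, -, h3, -⟩ := hx
      obtain ⟨i, hi⟩ := h2 m hmN
      refine le_trans ?_ (Finset.single_le_sum (f := fun i => Q m i x) (fun j _ => abs_nonneg _)
        (Finset.mem_univ i))
      have h4 : c * c ≤ (μ⟦U i | G⟧) x * (μ⟦V i | G⟧) (S^[m] x) :=
        mul_le_mul (h1 i).le (h3 i).le hc.le (hc.trans (h1 i)).le
      simp only [hQ]
      rw [abs_sub_comm]
      exact le_trans (by linarith [sq c]) (le_abs_self _)
    · simp only [indicator_of_notMem hx, zero_mul]
      exact Finset.sum_nonneg fun i _ => abs_nonneg _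
  have hae : ∀ᵐ x ∂μ, ∀ n : ℕ, x ∉ D (1 / ((n : ℝ) + 1)) := ae_all_iff.2 fun n => by
    have := hzero (1 / ((n : ℝ) + 1)) (by positivity)
    rw [measureReal_eq_zero_iff] at this
    exact measure_eq_zero_iff_ae_notMem.1 this
  filter_upwards [hae] with x hx hxU hxV
  have hev : ∀ᶠ n : ℕ in atTop, (∀ i, 1 / ((n : ℝ) + 1) < (μ⟦U i | G⟧) x) ∧
      ∀ i, 1 / ((n : ℝ) + 1) < (μ⟦V i | G⟧) x := by
    have ht := tendsto_one_div_add_atTop_nhds_zero_nat (𝕜 := ℝ)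
    exact (eventually_all.2 fun i => ht.eventually (gt_mem_nhds (hxU i))).and
      (eventually_all.2 fun i => ht.eventually (gt_mem_nhds (hxV i)))
  obtain ⟨n, h1, h2⟩ := hev.exists
  by_contra hcon
  push Not at hcon
  exact hx n ⟨h1, h2, hcon⟩

theorem ae_isMixingOn_support [MetricSpace X] [CompactSpace X] [BorelSpace X]
    {S : X → X} (hS : MeasurePreserving S μ μ) (hG : G ≤ mX)
    (hmix : IsCondMixing G μ S) {U : ℕ → Set X} (hU : TopologicalSpace.IsTopologicalBasis (range U)) :
    ∀ᵐ x ∂μ, IsMixingOn S (condExpKernel μ G x).support := by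
  have hUo : ∀ p, IsOpen (U p) := fun p => hU.isOpen (mem_range_self p)
  have hUm : ∀ p, MeasurableSet (U p) := fun p => (hUo p).measurableSet
  have hk : ∀ {W : Set X}, MeasurableSet W → ∀ᵐ x ∂μ, (condExpKernel μ G x).real W = (μ⟦W | G⟧) x :=
    fun hW => condExpKernel_ae_eq_condExp hG hW
  have h1 : ∀ᵐ x ∂μ, ∀ p, (condExpKernel μ G x).real (U p) = (μ⟦U p | G⟧) x :=
    ae_all_iff.2 fun p => hk (hUm p)
  have h2 : ∀ᵐ x ∂μ, ∀ p q m, (condExpKernel μ G x).real (U p ∩ S^[m] ⁻¹' U q) =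
      (μ⟦U p ∩ S^[m] ⁻¹' U q | G⟧) x :=
    ae_all_iff.2 fun p => ae_all_iff.2 fun q => ae_all_iff.2 fun m =>
      hk ((hUm p).inter ((hS.measurable.iterate m) (hUm q)))
  have h3 : ∀ᵐ x ∂μ, ∀ k (p q : Fin k → ℕ) N, (∀ i, 0 < (μ⟦U (p i) | G⟧) x) →
      (∀ i, 0 < (μ⟦U (q i) | G⟧) x) → ∃ m ≥ N, ∀ i, 0 < (μ⟦U (p i) ∩ S^[m] ⁻¹' U (q i) | G⟧) x :=
    ae_all_iff.2 fun k => ae_all_iff.2 fun p => ae_all_iff.2 fun q => ae_all_iff.2 fun N =>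
      ae_exists_condProb_inter_pos hS hG hmix (fun i => hUm (p i)) (fun i => hUm (q i)) N
  filter_upwards [h1, h2, h3] with x h1 h2 h3
  have hpos : ∀ p, ((condExpKernel μ G x).support ∩ U p).Nonempty → 0 < (μ⟦U p | G⟧) x := by
    rintro p ⟨y, hy, hyU⟩
    rw [← h1 p]
    exact ENNReal.toReal_pos ((Measure.mem_support_iff_forall y).1 hy _ ((hUo p).mem_nhds hyU)).ne'
      (measure_ne_top _ _)
  refine isMixingOn_of_basis hU fun k p q N hp hq => ?_
  obtain ⟨m, hmN, hm⟩ := h3 k p q N (fun i => hpos _ (hp i)) fun i => hpos _ (hq i)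
  refine ⟨m, hmN, fun i => ?_⟩
  have h4 := hm i
  rw [← h2] at h4
  obtain ⟨y, ⟨hy1, hy2⟩, hy⟩ := Measure.nonempty_inter_support_of_pos (ENNReal.toReal_pos_iff.1 h4).1
  exact ⟨y, ⟨hy, hy1⟩, hy2⟩

end MixingOnSupports

section StableSets

open ProbabilityTheory

lemma mem_stableSet_of_eventually_iff [MetricSpace X] [CompactSpace X] {T : X → X} {U : ℕ → Set X}
    (hU : TopologicalSpace.IsTopologicalBasis (range U)) {x y : X}
    (h : ∀ p, ∀ᶠ i in atTop, T^[i] x ∈ U p ↔ T^[i] y ∈ U p) : y ∈ stableSet T x := by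
  refine Metric.tendsto_nhds.2 fun ε hε => ?_
  have : ∀ z : X, ∃ p, z ∈ U p ∧ U p ⊆ Metric.ball z (ε / 2) := fun z => by
    obtain ⟨_, ⟨p, rfl⟩, hz, hp⟩ :=
      hU.exists_subset_of_mem_open (Metric.mem_ball_self (half_pos hε)) (Metric.isOpen_ball (x := z))
    exact ⟨p, hz, hp⟩
  choose p hzp hp using this
  obtain ⟨t, -, ht⟩ := isCompact_univ.elim_nhds_subcover (fun z => U (p z))
    fun z _ => (hU.isOpen (mem_range_self _)).mem_nhds (hzp z)
  filter_upwards [(Finset.eventually_all t).2 fun z _ => h (p z)] with i hi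
  obtain ⟨z, hzt, hz⟩ := mem_iUnion₂.1 (ht (mem_univ (T^[i] x)))
  have h1 := hp z hz
  have h2 := hp z ((hi z hzt).1 hz)
  rw [Metric.mem_ball] at h1 h2
  rw [dist_zero_right, Real.norm_of_nonneg dist_nonneg]
  linarith [dist_triangle_right (T^[i] x) (T^[i] y) z]

variable {G B 𝒜 : MeasurableSpace X} [mX : MeasurableSpace X] {μ : Measure X} [IsProbabilityMeasure μ]

lemma ae_condExpKernel_mem_iff [StandardBorelSpace X] (hB : B ≤ mX) {A : Set X}
    (hA : MeasurableSet[B] A) : ∀ᵐ x ∂μ, ∀ᵐ y ∂(condExpKernel μ B x), x ∈ A ↔ y ∈ A := by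
  have h1 : μ⟦A | B⟧ = A.indicator fun _ => 1 :=
    condExp_of_stronglyMeasurable hB (stronglyMeasurable_const.indicator hA)
      (integrable_indicator_one (hB _ hA))
  filter_upwards [condExpKernel_ae_eq_condExp (μ := μ) hB (hB _ hA)] with x hx
  rw [h1] at hx
  by_cases hxA : x ∈ A
  · rw [indicator_of_mem hxA] at hx
    have : condExpKernel μ B x A = 1 := by
      rw [← ENNReal.toReal_eq_one_iff]; exact hx
    filter_upwards [(prob_compl_eq_zero_iff (hB _ hA)).2 this] with y hy
    simpa [hxA] using hy
  · rw [indicator_of_notMem hxA, measureReal_eq_zero_iff, measure_eq_zero_iff_ae_notMem] at hx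
    filter_upwards [hx] with y hy
    simp [hxA, hy]

lemma ae_condProb_iInf_pos_imp {T : X ≃ᵐ X} (hT : MeasurePreserving T μ μ) (h𝒜 : 𝒜 ≤ mX)
    (h𝒜T : 𝒜.comap T ≤ 𝒜) {U : Set X} (hU : MeasurableSet U) :
    ∀ᵐ x ∂μ, 0 < (μ⟦U | tail T 𝒜⟧) x → ∃ n : ℕ, 0 < (μ⟦U | 𝒜.comap T^[n]⟧) x := by
  have hG : tail T 𝒜 ≤ mX := (tail_le T).trans h𝒜
  have hn : ∀ n, 𝒜.comap T^[n] ≤ mX := fun n => comap_iterate_le_borel hT h𝒜 n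
  have h1 := tendsto_integral_abs_condExp_sub_iInf (μ := μ) (antitone_comap_iterate h𝒜T) hn
    (f := U.indicator fun _ => 1) ((memLp_const 1).indicator hU)
  set a := μ⟦U | tail T 𝒜⟧ with ha
  have ha0 : ∀ᵐ x ∂μ, a x ∈ Icc (0 : ℝ) 1 := condProb_mem hG hU
  have hai : Integrable a μ := integrable_condExp
  set Z : Set X := ⋂ n, {x | (μ⟦U | 𝒜.comap T^[n]⟧) x ≤ 0} with hZ
  have hZm : MeasurableSet Z := MeasurableSet.iInter fun n =>
    measurableSet_le (stronglyMeasurable_condExp.mono (hn n)).measurable measurable_const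
  have h2 : ∫ x in Z, a x ∂μ = 0 := by
    refine le_antisymm (ge_of_tendsto' h1 fun n => ?_) (setIntegral_nonneg_of_ae (ha0.mono fun x hx => hx.1))
    have hi : Integrable (fun x => |(μ⟦U | 𝒜.comap T^[n]⟧) x - a x|) μ := (integrable_condExp.sub hai).abs
    refine le_trans ?_ (setIntegral_le_integral (s := Z) hi (ae_of_all _ fun x => abs_nonneg _))
    refine setIntegral_mono_on hai.integrableOn hi.integrableOn hZm fun x hx => ?_
    have hxn : (μ⟦U | 𝒜.comap T^[n]⟧) x ≤ 0 := mem_iInter.1 hx n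
    rw [abs_sub_comm]
    exact le_trans (by linarith) (le_abs_self _)
  rw [setIntegral_eq_zero_iff_of_nonneg_ae (ae_restrict_of_ae (ha0.mono fun x hx => hx.1))
    hai.integrableOn] at h2
  filter_upwards [(ae_restrict_iff' hZm).1 h2] with x hx hpos
  by_contra hcon
  push Not at hcon
  exact hpos.ne' (hx (mem_iInter.2 hcon))

lemma ae_condProb_pos_imp_of_le_mod (hB : B ≤ mX) (hG : G ≤ mX)
    (h : ∀ A, MeasurableSet[B] A → ∃ A', MeasurableSet[G] A' ∧ A =ᵐ[μ] A') {U : Set X}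
    (hU : MeasurableSet U) : ∀ᵐ x ∂μ, 0 < (μ⟦U | G⟧) x → 0 < (μ⟦U | B⟧) x := by
  set Z : Set X := {x | (μ⟦U | B⟧) x ≤ 0} with hZ
  have hm : Measurable[B] (μ⟦U | B⟧) := stronglyMeasurable_condExp.measurable
  have hZm : MeasurableSet[B] Z := hm measurableSet_Iic
  obtain ⟨Z', hZ'm, hZZ'⟩ := h Z hZm
  have hUi := integrable_indicator_one (μ := μ) hU
  have hG0 : ∀ᵐ x ∂μ, (μ⟦U | G⟧) x ∈ Icc (0 : ℝ) 1 := condProb_mem hG hU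
  have h1 : ∫ x in Z', (μ⟦U | G⟧) x ∂μ = 0 := by
    refine le_antisymm ?_ (setIntegral_nonneg_of_ae (hG0.mono fun x hx => hx.1))
    rw [setIntegral_condExp hG hUi hZ'm, ← setIntegral_congr_set hZZ', ← setIntegral_condExp hB hUi hZm]
    exact setIntegral_nonpos (hB _ hZm) fun x hx => hx
  rw [setIntegral_eq_zero_iff_of_nonneg_ae (ae_restrict_of_ae (hG0.mono fun x hx => hx.1))
    integrable_condExp.integrableOn] at h1
  filter_upwards [(ae_restrict_iff' (hG _ hZ'm)).1 h1, hZZ'.mem_iff] with x h1 h2 hpos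
  by_contra hcon
  exact hpos.ne' (h1 (h2.1 (not_lt.1 hcon)))

theorem ae_support_subset_closure_stableSet [MetricSpace X] [CompactSpace X] [BorelSpace X] {T : X ≃ᵐ X}
    (hT : MeasurePreserving T μ μ) {U : ℕ → Set X} (hU : TopologicalSpace.IsTopologicalBasis (range U))
    (h𝒜 : 𝒜 ≤ mX) (h𝒜T : 𝒜.comap T ≤ 𝒜)
    (hev : ∀ p, ∃ k, ∀ i ≥ k, MeasurableSet[𝒜] (T^[i] ⁻¹' U p)) (hG : G ≤ mX)
    (h : ∀ A, MeasurableSet[tail T 𝒜] A → ∃ A', MeasurableSet[G] A' ∧ A =ᵐ[μ] A') :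
    ∀ᵐ x ∂μ, (condExpKernel μ G x).support ⊆ closure (stableSet T x) := by
  have hUo : ∀ p, IsOpen (U p) := fun p => hU.isOpen (mem_range_self p)
  have hUm : ∀ p, MeasurableSet (U p) := fun p => (hUo p).measurableSet
  have hn : ∀ n, 𝒜.comap T^[n] ≤ mX := fun n => comap_iterate_le_borel hT h𝒜 n
  choose k hk using hev
  have h1 : ∀ᵐ x ∂μ, ∀ p, (condExpKernel μ G x).real (U p) = (μ⟦U p | G⟧) x :=
    ae_all_iff.2 fun p => condExpKernel_ae_eq_condExp hG (hUm p)
  have h2 : ∀ᵐ x ∂μ, ∀ p n, (condExpKernel μ (𝒜.comap T^[n]) x).real (U p) = (μ⟦U p | 𝒜.comap T^[n]⟧) x :=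
    ae_all_iff.2 fun p => ae_all_iff.2 fun n => condExpKernel_ae_eq_condExp (hn n) (hUm p)
  have h3 : ∀ᵐ x ∂μ, ∀ p, 0 < (μ⟦U p | G⟧) x → 0 < (μ⟦U p | tail T 𝒜⟧) x :=
    ae_all_iff.2 fun p => ae_condProb_pos_imp_of_le_mod ((tail_le T).trans h𝒜) hG h (hUm p)
  have h4 : ∀ᵐ x ∂μ, ∀ p, 0 < (μ⟦U p | tail T 𝒜⟧) x → ∃ n : ℕ, 0 < (μ⟦U p | 𝒜.comap T^[n]⟧) x :=
    ae_all_iff.2 fun p => ae_condProb_iInf_pos_imp hT h𝒜 h𝒜T (hUm p)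
  have h5 : ∀ᵐ x ∂μ, ∀ n p i, ∀ᵐ y ∂(condExpKernel μ (𝒜.comap T^[n]) x), k p ≤ i →
      (T^[i + n] x ∈ U p ↔ T^[i + n] y ∈ U p) := by
    refine ae_all_iff.2 fun n => ae_all_iff.2 fun p => ae_all_iff.2 fun i => ?_
    by_cases hi : k p ≤ i
    · have hm : MeasurableSet[𝒜.comap T^[n]] (T^[i + n] ⁻¹' U p) :=
        ⟨T^[i] ⁻¹' U p, hk p i hi, by rw [← preimage_comp, ← Function.iterate_add]⟩
      filter_upwards [ae_condExpKernel_mem_iff (μ := μ) (hn n) hm] with x hx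
      filter_upwards [hx] with y hy _
      exact hy
    · exact ae_of_all _ fun x => ae_of_all _ fun y h => absurd h hi
  filter_upwards [h1, h2, h3, h4, h5] with x h1 h2 h3 h4 h5 z hz
  rw [hU.mem_closure_iff]
  rintro _ ⟨p, rfl⟩ hzp
  have hpos : 0 < (μ⟦U p | G⟧) x := by
    rw [← h1 p]
    exact ENNReal.toReal_pos ((Measure.mem_support_iff_forall z).1 hz _ ((hUo p).mem_nhds hzp)).ne'
      (measure_ne_top _ _)
  obtain ⟨n, hnpos⟩ := h4 p (h3 p hpos)
  rw [← h2] at hnpos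
  have h6 : ∀ᵐ y ∂(condExpKernel μ (𝒜.comap T^[n]) x), ∀ p i, k p ≤ i →
      (T^[i + n] x ∈ U p ↔ T^[i + n] y ∈ U p) := ae_all_iff.2 fun p => ae_all_iff.2 fun i => h5 n p i
  obtain ⟨y, hyU, hy⟩ := ((frequently_ae_mem_iff.2 (ENNReal.toReal_pos_iff.1 hnpos).1.ne').and_eventually
    h6).exists
  refine ⟨y, hyU, mem_stableSet_of_eventually_iff hU fun q => ?_⟩
  filter_upwards [eventually_ge_atTop (k q + n)] with i hi
  have := hy q (i - n) (by omega)
  rwa [Nat.sub_add_cancel (by omega)] at this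

end StableSets

section Assembly

open ProbabilityTheory

lemma Ergodic.measurableEquiv_symm [MeasurableSpace X] {μ : Measure X} {T : X ≃ᵐ X}
    (h : Ergodic T μ) : Ergodic T.symm μ := by
  refine ⟨h.toMeasurePreserving.symm T, ⟨fun s hs hsT => h.aeconst_set hs ?_⟩⟩
  ext x
  have := Set.ext_iff.1 hsT (T x)
  simpa using this.symm

lemma TopologicalSpace.exists_seq_isTopologicalBasis [TopologicalSpace X]
    [SecondCountableTopology X] [Nonempty X] :
    ∃ U : ℕ → Set X, IsTopologicalBasis (range U) := by
  have hb := isBasis_countableBasis X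
  obtain ⟨s, hs, -⟩ := hb.exists_subset_of_mem_open (mem_univ (Classical.arbitrary X)) isOpen_univ
  obtain ⟨U, hU⟩ := (countable_countableBasis X).exists_eq_range ⟨s, hs⟩
  exact ⟨U, hU ▸ hb⟩

theorem ae_exists_isWeaklyMixingSet_of_isRokhlinSinai {𝒜 𝒜' : MeasurableSpace X} [MetricSpace X]
    [CompactSpace X] [mX : MeasurableSpace X] [BorelSpace X] {μ : Measure X}
    [IsProbabilityMeasure μ] {T : X ≃ᵐ X} (hTc : Continuous T) (hTc' : Continuous T.symm)
    (hT : Ergodic T μ) {U : ℕ → Set X} (hU : TopologicalSpace.IsTopologicalBasis (range U))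
    (h : @IsRokhlinSinai X 𝒜 mX μ T U) (h' : @IsRokhlinSinai X 𝒜' mX μ T.symm U)
    {f : X → ℝ} (hf : Continuous f) (hpos : 0 < mEnt μ T) :
    ∀ᵐ x ∂μ, ∃ E : Set X, IsClosed E ∧ E ⊆ closure (stableSet T x) ∩ closure (stableSet T.symm x) ∧
      IsWeaklyMixingSet T E ∧ IsWeaklyMixingSet T.symm E ∧
      mPres μ T f ≤ pres T f E ∧ mPres μ T f ≤ pres T.symm f E := by
  have hT' := hT.measurableEquiv_symm
  have hm := hT.toMeasurePreserving
  have hm' := hT'.toMeasurePreserving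
  have hG : tail T 𝒜 ≤ mX := (tail_le T).trans h.le
  have hGT : (tail T 𝒜).comap T = tail T 𝒜 := comap_tail h.comap_le
  have hGT' : (tail T 𝒜).comap T.symm = tail T 𝒜 := comap_symm_tail h.comap_le
  have he' : ∀ c : ℝ, (c : EReal) < mEnt μ T → ∃ q : ℕ, ∃ η : X → (Fin q → Prop),
      sig η ≤ mX ∧ ∀ n : ℕ, n * c ≤ cEnt (tail T 𝒜) μ (itin T.symm η n) := fun c hc => by
    obtain ⟨q, η, hη, hle⟩ := h.exists_le_cEnt c hc
    exact ⟨q, η, hη, fun n => (hle n).trans_eq (cEnt_itin_symm hm hG hGT hη n).symm⟩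
  have hmix : IsCondMixing (tail T 𝒜) μ T := isCondMixing_tail hm h.le h.comap_le h.iSup_eq
  filter_upwards [
    ae_support_subset_closure_stableSet hm hU h.le h.comap_le h.eventually_measurable hG
      fun A hA => ⟨A, hA, .rfl⟩,
    ae_support_subset_closure_stableSet hm' hU h'.le h'.comap_le h'.eventually_measurable hG
      fun A hA => by
        have hAm : MeasurableSet[mX] A := h'.le _ (tail_le _ _ hA)
        exact h.exists_tail A hAm ((ent_symm hm (sig_mem_le_iff.2 hAm)).symm.trans
          (h'.ent_eq_zero A hA)),
    ae_isMixingOn_support hm hG hmix hU,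
    ae_isMixingOn_support hm' hG (hmix.symm hm hG hGT) hU,
    ae_nontrivial_support hTc hT hG hGT hpos h.exists_le_cEnt,
    ae_add_le_pres_support hTc hT hf hG hGT h.exists_le_cEnt,
    ae_add_le_pres_support hTc' hT' hf hG hGT' he'] with x hs hu hx hx' hnt hp hp'
  have hcl := (condExpKernel μ (tail T 𝒜) x).isClosed_support
  exact ⟨_, hcl, subset_inter hs hu, hx.isWeaklyMixingSet hTc hcl hnt,
    hx'.isWeaklyMixingSet hTc' hcl hnt, hp, hp'⟩

end Assembly

/-- For a TDS `(X,T)`, `f ∈ C(X,ℝ)` and an ergodic `T`-invariant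
Borel probability measure `μ` with `h_μ(T) > 0`: for `μ`-a.e. `x` there is a
closed `E(x) ⊆ cl(W^s(x,T)) ∩ cl(W^u(x,T))` which is weakly mixing for `T` and
for `T⁻¹`, with `P(T,f,E(x)) ≥ P_μ(T,f)` and `P(T⁻¹,f,E(x)) ≥ P_μ(T,f)`. -/
theorem stmt12 [MetricSpace X] [CompactSpace X] [MeasurableSpace X] [BorelSpace X]
    (T : X ≃ₜ X) (f : C(X, ℝ)) (μ : Measure X) [IsProbabilityMeasure μ]
    (herg : Ergodic ⇑T μ) (hpos : 0 < mEnt μ ⇑T) :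
    ∀ᵐ x ∂μ, ∃ E : Set X, IsClosed E ∧
      E ⊆ closure (stableSet ⇑T x) ∩ closure (stableSet ⇑T.symm x) ∧
      IsWeaklyMixingSet ⇑T E ∧ IsWeaklyMixingSet ⇑T.symm E ∧
      mPres μ ⇑T ⇑f ≤ pres ⇑T ⇑f E ∧ mPres μ ⇑T ⇑f ≤ pres ⇑T.symm ⇑f E := by
  have := μ.nonempty_of_neZero
  obtain ⟨U, hU⟩ := TopologicalSpace.exists_seq_isTopologicalBasis (X := X)
  have hgen := (BorelSpace.measurable_eq (α := X)).trans
    hU.borel_eq_generateFrom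
  have herg' : Ergodic T.toMeasurableEquiv μ := herg
  have hm := herg'.toMeasurePreserving
  have key := fun 𝒜 𝒜' => @ae_exists_isWeaklyMixingSet_of_isRokhlinSinai X 𝒜 𝒜' _ _ _ _ _ _
    T.toMeasurableEquiv T.continuous T.symm.continuous herg' U hU
  obtain ⟨𝒜, h⟩ := exists_rokhlinSinai hm U hgen
  revert 𝒜
  obtain ⟨𝒜', h'⟩ := exists_rokhlinSinai (hm.symm T.toMeasurableEquiv) U hgen
  exact fun 𝒜 h => key 𝒜 𝒜' h h' f.continuous hpos
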